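/- arXiv:2506.17575 — 3 statements merged into one kernel-verified Lean document; each statement's English description precedes it below -/
import Mathlib

section
/- Let 1 < α ≤ 4/3. Then there exists a constant C > 0 depending only on α such that for every λ > 0 and every t > 0, E_{α,2}(−λ t^α) ≥ C / (1 + λ t^α). -/
/-- The two-parameter Mittag-Leffler function `E_{α,β}(t) = ∑_{k=0}^∞ t^k / Γ(α k + β)`
on the real line, with `Γ` the real Gamma function. -/
noncomputable def mittagLeffler (α β t : ℝ) : ℝ :=
  ∑' k : ℕ, t ^ k / Real.Gamma (α * k + β)

section MLHelpers

open Complex Filter Topology Set MeasureTheory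


lemma ml_removable (G : ℂ → ℂ) (P : Finset ℂ) (S : Set ℂ)
    (hG : ∀ w ∈ S, w ∉ P → DifferentiableAt ℂ G w)
    (hP : ∀ p ∈ P, S ∈ 𝓝 p)
    (hres : ∀ p ∈ P, Tendsto (fun w => (w - p) * G w) (𝓝[≠] p) (𝓝 0)) :
    ∃ g : ℂ → ℂ, (∀ w ∈ S, DifferentiableAt ℂ g w) ∧ ∀ w, w ∉ P → g w = G w := by
  classical
  refine ⟨fun w => if w ∈ P then limUnder (𝓝[≠] w) G else G w, ?_, ?_⟩
  · intro w hw
    by_cases hwP : w ∈ P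
    · have hopen : ((P.erase w : Finset ℂ) : Set ℂ)ᶜ ∈ 𝓝 w :=
        (Finset.finite_toSet _).isClosed.isOpen_compl.mem_nhds (by simp)
      have hU : S ∩ ((P.erase w : Finset ℂ) : Set ℂ)ᶜ ∈ 𝓝 w := inter_mem (hP w hwP) hopen
      have hd := Complex.differentiableOn_update_limUnder_of_isLittleO (f := G) hU
        (by
          intro z hz
          apply (hG z hz.1.1 _).differentiableWithinAt
          intro hzP
          apply hz.1.2
          simp only [Finset.coe_erase, Set.mem_sdiff, Finset.mem_coe, mem_singleton_iff]
          exact ⟨hzP, hz.2⟩)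
        (by
          rw [Asymptotics.isLittleO_iff_tendsto']
          · have h1 := hres w hwP
            have h2 : Tendsto (fun z : ℂ => (z - w) * G w) (𝓝[≠] w) (𝓝 0) := by
              have : Tendsto (fun z : ℂ => (z - w) * G w) (𝓝 w) (𝓝 ((w - w) * G w)) :=
                Continuous.tendsto (by fun_prop) w
              simp only [sub_self, zero_mul] at this
              exact this.mono_left nhdsWithin_le_nhds
            have h3 := h1.sub h2
            simp only [sub_zero] at h3
            refine h3.congr fun z => ?_
            rw [div_inv_eq_mul]; ring
          · filter_upwards [self_mem_nhdsWithin] with z hz h0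
            exact absurd h0 (inv_ne_zero (sub_ne_zero.2 hz)))
      refine (hd.differentiableAt hU).congr_of_eventuallyEq ?_
      filter_upwards [hU] with z hz
      by_cases hzw : z = w
      · subst hzw; simp [hwP]
      · have : z ∉ P := by
          intro hzP
          apply hz.2
          simp only [Finset.coe_erase, Set.mem_sdiff, Finset.mem_coe, mem_singleton_iff]
          exact ⟨hzP, hzw⟩
        simp [this, Function.update_of_ne hzw]
    · refine (hG w hw hwP).congr_of_eventuallyEq ?_
      filter_upwards [(Finset.finite_toSet P).isClosed.isOpen_compl.mem_nhds
        (show w ∈ ((P : Set ℂ))ᶜ by simpa using hwP)] with z hz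
      have : z ∉ P := by simpa using hz
      simp [this]
  · intro w hw
    simp [hw]

lemma ml_exp_inj {w p : ℂ} (hw : |w.im| ≤ Real.pi) (hp : |p.im| < Real.pi)
    (h : cexp w = cexp p) : w = p := by
  obtain ⟨n, hn⟩ := Complex.exp_eq_exp_iff_exists_int.1 h
  have him : w.im = p.im + n * (2 * Real.pi) := by
    rw [hn]; simp
  have h1 := abs_le.1 hw
  have h2 := abs_lt.1 hp
  have hpi := Real.pi_pos
  have : n = 0 := by
    by_contra hne
    rcases lt_or_gt_of_ne hne with h | h
    · have : (n : ℝ) ≤ -1 := by exact_mod_cast Int.le_sub_one_of_lt h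
      nlinarith
    · have : (1 : ℝ) ≤ n := by exact_mod_cast h
      nlinarith
  simpa [this] using hn

lemma ml_exp_re_atTop (c : ℂ) (hc : 0 < c.re) (hi : c.im = 0) :
    Tendsto (fun w : ℂ => cexp (-(c * w))) (comap re atTop) (𝓝 0) := by
  rw [tendsto_zero_iff_norm_tendsto_zero]
  have : (fun w : ℂ => ‖cexp (-(c * w))‖) = (fun x : ℝ => Real.exp (-(c.re * x))) ∘ re := by
    ext w; simp [Complex.norm_exp, hi]
  rw [this]
  refine Tendsto.comp ?_ tendsto_comap
  refine Real.tendsto_exp_atBot.comp (tendsto_neg_atTop_atBot.comp ?_)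
  exact tendsto_id.const_mul_atTop hc

lemma ml_exp_re_atBot (c : ℂ) (hc : 0 < c.re) (hi : c.im = 0) :
    Tendsto (fun w : ℂ => cexp (c * w)) (comap re atBot) (𝓝 0) := by
  rw [tendsto_zero_iff_norm_tendsto_zero]
  have : (fun w : ℂ => ‖cexp (c * w)‖) = (fun x : ℝ => Real.exp (c.re * x)) ∘ re := by
    ext w; simp [Complex.norm_exp, hi]
  rw [this]
  refine Tendsto.comp ?_ tendsto_comap
  refine Real.tendsto_exp_atBot.comp ?_
  exact tendsto_id.const_mul_atBot hc

lemma ml_vert (l : Filter ℝ) (g : ℂ → ℂ) (L : ℂ)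
    (hg : ∀ w : ℂ, |w.im| ≤ Real.pi → ContinuousAt g w)
    (h : Tendsto g (comap re l) (𝓝 L)) :
    Tendsto (fun R : ℝ => ∫ y in (-Real.pi)..Real.pi, g (R + y * I)) l (𝓝 (2 * Real.pi * L)) := by
  have hpi := Real.pi_pos
  have hint : ∀ R : ℝ, IntervalIntegrable (fun y : ℝ => g (R + y * I)) volume (-Real.pi) Real.pi := by
    intro R
    apply ContinuousOn.intervalIntegrable
    intro y hy
    rw [uIcc_of_le (by linarith)] at hy
    apply ContinuousAt.continuousWithinAt
    apply ContinuousAt.comp (g := g) (f := fun y : ℝ => (R + y * I : ℂ))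
    · apply hg; simp; exact abs_le.2 hy
    · fun_prop
  rw [Metric.tendsto_nhds] at h ⊢
  intro ε hε
  have h1 := h (ε / (4 * Real.pi)) (by positivity)
  rw [eventually_comap] at h1
  filter_upwards [h1] with R hR
  have e : (∫ y in (-Real.pi)..Real.pi, g (R + y * I)) - 2 * Real.pi * L
      = ∫ y in (-Real.pi)..Real.pi, (g (R + y * I) - L) := by
    rw [intervalIntegral.integral_sub (hint R) (by simp)]
    simp
    left; ring
  rw [dist_eq_norm, e]
  have := intervalIntegral.norm_integral_le_of_norm_le_const (a := -Real.pi) (b := Real.pi)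
    (f := fun y : ℝ => g (R + y * I) - L) (C := ε / (4 * Real.pi)) (by
      intro y _
      rw [← dist_eq_norm]
      exact (hR _ (by simp)).le)
  refine this.trans_lt ?_
  rw [abs_of_pos (by linarith)]
  field_simp
  linarith

lemma ml_rect (F : ℂ → ℂ) (P : Finset ℂ) (c : ℂ → ℂ)
    (hP : ∀ p ∈ P, |p.im| < Real.pi)
    (hF : ∀ w : ℂ, |w.im| ≤ Real.pi → w ∉ P → DifferentiableAt ℂ F w)
    (hres : ∀ p ∈ P, Tendsto (fun w => (w - p) * F w) (𝓝[≠] p) (𝓝 (c p)))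
    (hT : Tendsto F (comap re atTop) (𝓝 0))
    (hB : Tendsto F (comap re atBot) (𝓝 0))
    (hint : Integrable (fun x : ℝ => F (x - Real.pi * I) - F (x + Real.pi * I))) :
    ∫ x : ℝ, (F (x - Real.pi * I) - F (x + Real.pi * I)) = 2 * Real.pi * I * ∑ p ∈ P, c p := by
  classical
  have hpi := Real.pi_pos
  set κ : ℂ → ℂ → ℂ := fun q w => cexp w / (cexp w - cexp q) with hκ
  have hκd : ∀ q ∈ P, ∀ w : ℂ, |w.im| ≤ Real.pi → w ≠ q → DifferentiableAt ℂ (κ q) w := by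
    intro q hq w hw hne
    apply DifferentiableAt.div
    · fun_prop
    · fun_prop
    · intro h0
      exact hne (ml_exp_inj hw (hP q hq) (sub_eq_zero.1 h0))
  have hκres : ∀ q ∈ P, ∀ p ∈ P, Tendsto (fun w => (w - p) * κ q w) (𝓝[≠] p)
      (𝓝 (if p = q then 1 else 0)) := by
    intro q hq p hp
    split_ifs with h
    · subst h
      have h1 : Tendsto (slope cexp p) (𝓝[≠] p) (𝓝 (cexp p)) :=
        hasDerivAt_iff_tendsto_slope.1 (Complex.hasDerivAt_exp p)
      have h2 : Tendsto cexp (𝓝[≠] p) (𝓝 (cexp p)) :=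
        (Complex.continuous_exp.tendsto p).mono_left nhdsWithin_le_nhds
      have h3 := h2.div h1 (Complex.exp_ne_zero p)
      rw [div_self (Complex.exp_ne_zero p)] at h3
      refine h3.congr fun w => ?_
      simp only [hκ, slope_def_field, Pi.div_apply]
      rw [div_div_eq_mul_div]; ring
    · have h1 := (hκd q hq p (hP p hp).le h).continuousAt
      have h2 : ContinuousAt (fun w => (w - p) * κ q w) p := by fun_prop
      have h3 := h2.tendsto
      simp only [sub_self, zero_mul] at h3
      exact h3.mono_left nhdsWithin_le_nhds
  set S : Set ℂ := {w | |w.im| ≤ Real.pi} with hS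
  obtain ⟨g, hgd, hgG⟩ := ml_removable (fun w => F w - ∑ q ∈ P, c q * κ q w) P S
    (by
      intro w hw hwP
      apply (hF w hw hwP).sub
      apply DifferentiableAt.fun_sum
      intro q hq
      apply DifferentiableAt.const_mul
      exact hκd q hq w hw (fun h => hwP (h ▸ hq)))
    (by
      intro p hp
      have : {w : ℂ | |w.im| < Real.pi} ∈ 𝓝 p :=
        (isOpen_lt (by fun_prop) continuous_const).mem_nhds (hP p hp)
      filter_upwards [this] with w hw
      exact le_of_lt hw)
    (by
      intro p hp
      have h1 : Tendsto (fun w => ∑ q ∈ P, c q * ((w - p) * κ q w)) (𝓝[≠] p)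
          (𝓝 (∑ q ∈ P, c q * (if p = q then 1 else 0))) :=
        tendsto_finsetSum _ fun q hq => (hκres q hq p hp).const_mul _
      have h2 := (hres p hp).sub h1
      have e : c p - ∑ q ∈ P, c q * (if p = q then 1 else 0) = 0 := by
        simp [hp]
      rw [e] at h2
      refine h2.congr fun w => ?_
      rw [mul_sub, Finset.mul_sum]
      congr 1
      apply Finset.sum_congr rfl
      intro q _; ring)
  have hgc : ∀ w : ℂ, |w.im| ≤ Real.pi → ContinuousAt g w := fun w hw => (hgd w hw).continuousAt
  have hPtop : ∀ᶠ w in comap re atTop, w ∉ P := by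
    obtain ⟨M, hM⟩ := (P.finite_toSet.image re).bddAbove
    rw [eventually_comap]
    filter_upwards [eventually_gt_atTop M] with R hR w hw hwP
    have := hM (mem_image_of_mem re hwP)
    linarith
  have hPbot : ∀ᶠ w in comap re atBot, w ∉ P := by
    obtain ⟨M, hM⟩ := (P.finite_toSet.image re).bddBelow
    rw [eventually_comap]
    filter_upwards [eventually_lt_atBot M] with R hR w hw hwP
    have := hM (mem_image_of_mem re hwP)
    linarith
  have hgT : Tendsto g (comap re atTop) (𝓝 (-∑ q ∈ P, c q)) := by
    have h1 : Tendsto (fun w => F w - ∑ q ∈ P, c q * κ q w) (comap re atTop)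
        (𝓝 (0 - ∑ q ∈ P, c q * 1)) := by
      refine hT.sub (tendsto_finsetSum _ fun q hq => Tendsto.const_mul _ ?_)
      have h2 := ml_exp_re_atTop 1 (by simp) (by simp)
      have h3 : Tendsto (fun w => 1 / (1 - cexp q * cexp (-(1 * w)))) (comap re atTop)
          (𝓝 (1 / (1 - cexp q * 0))) :=
        tendsto_const_nhds.div (tendsto_const_nhds.sub (h2.const_mul _)) (by simp)
      simp only [mul_zero, sub_zero, div_one] at h3
      refine h3.congr fun w => ?_
      simp only [hκ, one_mul]
      have : cexp w - cexp q = cexp w * (1 - cexp q * cexp (-w)) := by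
        rw [mul_sub, mul_left_comm, ← Complex.exp_add]; simp
      rw [this, div_mul_eq_div_div, div_self (Complex.exp_ne_zero w)]
    simp only [mul_one, zero_sub] at h1
    refine h1.congr' ?_
    filter_upwards [hPtop] with w hw
    exact (hgG w hw).symm
  have hgB : Tendsto g (comap re atBot) (𝓝 0) := by
    have h1 : Tendsto (fun w => F w - ∑ q ∈ P, c q * κ q w) (comap re atBot)
        (𝓝 (0 - ∑ q ∈ P, c q * 0)) := by
      refine hB.sub (tendsto_finsetSum _ fun q hq => Tendsto.const_mul _ ?_)
      have h2 := ml_exp_re_atBot 1 (by simp) (by simp)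
      simp only [one_mul] at h2
      have h3 := h2.div (h2.sub_const (cexp q)) (by simp [Complex.exp_ne_zero])
      simp only [zero_div, zero_sub] at h3
      exact h3
    simp only [mul_zero, sub_zero, Finset.sum_const_zero] at h1
    refine h1.congr' ?_
    filter_upwards [hPbot] with w hw
    exact (hgG w hw).symm
  have hV1 := ml_vert atTop g _ hgc hgT
  have hV2 := (ml_vert atBot g _ hgc hgB).comp tendsto_neg_atTop_atBot
  have hH : ∀ x : ℝ, g (x - Real.pi * I) - g (x + Real.pi * I)
      = F (x - Real.pi * I) - F (x + Real.pi * I) := by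
    intro x
    have hn1 : (x - Real.pi * I : ℂ) ∉ P := by
      intro h
      have := hP _ h
      simp [abs_of_pos hpi] at this
    have hn2 : (x + Real.pi * I : ℂ) ∉ P := by
      intro h
      have := hP _ h
      simp [abs_of_pos hpi] at this
    rw [hgG _ hn1, hgG _ hn2]
    have : ∀ q, κ q (x - Real.pi * I) = κ q (x + Real.pi * I) := by
      intro q
      simp [hκ, Complex.exp_add, Complex.exp_sub, div_neg]
    simp only [this]; ring
  have hlim := intervalIntegral_tendsto_integral hint tendsto_neg_atTop_atBot tendsto_id
  have hzero : ∀ R : ℝ, (∫ x in (-R)..R, (F (x - Real.pi * I) - F (x + Real.pi * I)))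
      = I * (∫ y in (-Real.pi)..Real.pi, g (((-R : ℝ) : ℂ) + y * I))
        - I * (∫ y in (-Real.pi)..Real.pi, g (R + y * I)) := by
    intro R
    have h := Complex.integral_boundary_rect_eq_zero_of_differentiableOn g
      (-R - Real.pi * I) (R + Real.pi * I) (by
        intro w hw
        apply (hgd w _).differentiableWithinAt
        have := hw.2
        simp at this
        rw [uIcc_of_le (by linarith)] at this
        exact abs_le.2 this)
    simp only [sub_re, neg_re, ofReal_re, mul_re, I_re, mul_zero, ofReal_im, I_im, mul_one,
      sub_self, sub_zero, add_re, add_zero, sub_im, neg_im, neg_zero, mul_im, zero_sub, add_im,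
      zero_add, smul_eq_mul] at h
    have e : (∫ x in (-R)..R, (F (x - Real.pi * I) - F (x + Real.pi * I)))
      = (∫ x in (-R)..R, g (x + ((-Real.pi : ℝ) : ℂ) * I)) - ∫ x in (-R)..R, g (x + Real.pi * I) := by
      rw [← intervalIntegral.integral_sub]
      · apply intervalIntegral.integral_congr
        intro x _
        simp only
        rw [← hH x]
        congr 2
        push_cast; ring
      · apply Continuous.intervalIntegrable
        rw [continuous_iff_continuousAt]
        intro x
        apply ContinuousAt.comp (g := g) (f := fun x : ℝ => (x + ((-Real.pi : ℝ) : ℂ) * I : ℂ))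
        · apply hgc; simp [abs_of_pos hpi]
        · fun_prop
      · apply Continuous.intervalIntegrable
        rw [continuous_iff_continuousAt]
        intro x
        apply ContinuousAt.comp (g := g) (f := fun x : ℝ => (x + Real.pi * I : ℂ))
        · apply hgc; simp [abs_of_pos hpi]
        · fun_prop
    rw [e]
    linear_combination h
  have h2 := (hV2.const_mul I).sub (hV1.const_mul I)
  have h3 := tendsto_nhds_unique (hlim.congr (fun R => hzero R)) h2
  rw [h3]; ring



noncomputable def mlk (α x : ℝ) : ℝ :=
  (-Real.sin (α * Real.pi) / Real.pi) * Real.exp ((α - 1) * x) /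
    (Real.exp (α * x) ^ 2 + 2 * Real.cos (α * Real.pi) * Real.exp (α * x) + 1)

lemma ml_sin_neg {α : ℝ} (h1 : 1 < α) (h2 : α ≤ 4 / 3) : Real.sin (α * Real.pi) < 0 := by
  have hpi := Real.pi_pos
  have : 0 < Real.sin (α * Real.pi - Real.pi) := by
    apply Real.sin_pos_of_pos_of_lt_pi <;> nlinarith
  rw [Real.sin_sub_pi] at this
  linarith

lemma mlk_den {α : ℝ} (h1 : 1 < α) (h2 : α ≤ 4 / 3) : ∃ c > 0, ∀ x : ℝ,
    c * (Real.exp (α * x) ^ 2 + 1) ≤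
      Real.exp (α * x) ^ 2 + 2 * Real.cos (α * Real.pi) * Real.exp (α * x) + 1 := by
  have hs := ml_sin_neg h1 h2
  have hc : |Real.cos (α * Real.pi)| < 1 := by
    rw [abs_lt]
    constructor <;> nlinarith [Real.sin_sq_add_cos_sq (α * Real.pi)]
  refine ⟨1 - |Real.cos (α * Real.pi)|, by linarith, fun x => ?_⟩
  have h3 := neg_abs_le (Real.cos (α * Real.pi))
  have h4 := abs_nonneg (Real.cos (α * Real.pi))
  have h5 := Real.exp_pos (α * x)
  nlinarith [mul_nonneg h4 (sq_nonneg (Real.exp (α * x) - 1))]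

lemma mlk_pos {α : ℝ} (h1 : 1 < α) (h2 : α ≤ 4 / 3) (x : ℝ) : 0 < mlk α x := by
  obtain ⟨c, hc, h⟩ := mlk_den h1 h2
  have hs := ml_sin_neg h1 h2
  have := h x
  have hd : 0 < Real.exp (α * x) ^ 2 + 2 * Real.cos (α * Real.pi) * Real.exp (α * x) + 1 :=
    lt_of_lt_of_le (by positivity) this
  unfold mlk
  have : 0 < -Real.sin (α * Real.pi) := by linarith
  have := Real.pi_pos
  positivity

lemma mlk_cont {α : ℝ} (h1 : 1 < α) (h2 : α ≤ 4 / 3) : Continuous (mlk α) := by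
  obtain ⟨c, hc, h⟩ := mlk_den h1 h2
  unfold mlk
  apply Continuous.div
  · fun_prop
  · fun_prop
  · intro x
    have : 0 < c * (Real.exp (α * x) ^ 2 + 1) := by positivity
    exact (lt_of_lt_of_le this (h x)).ne'

lemma mlk_bound {α : ℝ} (h1 : 1 < α) (h2 : α ≤ 4 / 3) : ∃ C > 0, ∀ x : ℝ,
    mlk α x ≤ C * Real.exp (-(α - 1) * |x|) ∧
    Real.exp x * mlk α x ≤ C * Real.exp (-(α - 1) * |x|) := by
  obtain ⟨c, hc, h⟩ := mlk_den h1 h2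
  have hs := ml_sin_neg h1 h2
  have hpi := Real.pi_pos
  have hs' : 0 < -Real.sin (α * Real.pi) / Real.pi := div_pos (by linarith) hpi
  refine ⟨(-Real.sin (α * Real.pi) / Real.pi) / c, by positivity, fun x => ?_⟩
  have hd : 0 < c * (Real.exp (α * x) ^ 2 + 1) := by positivity
  have hA : mlk α x ≤ (-Real.sin (α * Real.pi) / Real.pi) / c *
      (Real.exp ((α - 1) * x) / (Real.exp (α * x) ^ 2 + 1)) := by
    unfold mlk
    calc _ ≤ (-Real.sin (α * Real.pi) / Real.pi) * Real.exp ((α - 1) * x) /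
          (c * (Real.exp (α * x) ^ 2 + 1)) :=
          div_le_div_of_nonneg_left (by positivity) hd (h x)
      _ = _ := by field_simp
  have hB : Real.exp ((α - 1) * x) / (Real.exp (α * x) ^ 2 + 1) ≤ Real.exp (-(α - 1) * |x|) ∧
      Real.exp x * (Real.exp ((α - 1) * x) / (Real.exp (α * x) ^ 2 + 1))
        ≤ Real.exp (-(α - 1) * |x|) := by
    have hq : 0 < Real.exp (α * x) ^ 2 + 1 := by positivity
    rw [← mul_div_assoc, div_le_iff₀ hq, div_le_iff₀ hq, ← Real.exp_add, ← Real.exp_nat_mul,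
      mul_add, ← Real.exp_add, mul_one]
    rcases le_total 0 x with hx | hx
    · rw [abs_of_nonneg hx]
      have := Real.exp_pos (-(α - 1) * x)
      constructor
      · have : Real.exp ((α - 1) * x) ≤ Real.exp (-(α - 1) * x + (2 : ℕ) * (α * x)) :=
          Real.exp_le_exp.2 (by push_cast; nlinarith)
        linarith
      · have : Real.exp (x + (α - 1) * x) ≤ Real.exp (-(α - 1) * x + (2 : ℕ) * (α * x)) :=
          Real.exp_le_exp.2 (by push_cast; nlinarith)
        linarith
    · rw [abs_of_nonpos hx]
      have := Real.exp_pos (-(α - 1) * (-x) + (2 : ℕ) * (α * x))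
      constructor
      · have : Real.exp ((α - 1) * x) ≤ Real.exp (-(α - 1) * (-x)) :=
          Real.exp_le_exp.2 (by nlinarith)
        linarith
      · have : Real.exp (x + (α - 1) * x) ≤ Real.exp (-(α - 1) * (-x)) :=
          Real.exp_le_exp.2 (by nlinarith)
        linarith
  have hp : 0 < (-Real.sin (α * Real.pi) / Real.pi) / c := by positivity
  constructor
  · exact hA.trans (mul_le_mul_of_nonneg_left hB.1 hp.le)
  · calc _ ≤ Real.exp x * _ := mul_le_mul_of_nonneg_left hA (Real.exp_pos x).le
      _ = (-Real.sin (α * Real.pi) / Real.pi) / c * (Real.exp x * (Real.exp ((α - 1) * x) / (Real.exp (α * x) ^ 2 + 1))) := by ring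
      _ ≤ _ := mul_le_mul_of_nonneg_left hB.2 hp.le

lemma ml_exp_abs_int {b : ℝ} (hb : 0 < b) : Integrable (fun x : ℝ => Real.exp (-b * |x|)) := by
  have h1 : IntegrableOn (fun x : ℝ => Real.exp (-b * |x|)) (Ioi 0) :=
    (integrableOn_exp_mul_Ioi (a := -b) (by linarith) 0).congr_fun
      (fun x hx => by simp only; rw [abs_of_pos hx]) measurableSet_Ioi
  have h2 : IntegrableOn (fun x : ℝ => Real.exp (-b * |x|)) (Iic 0) :=
    (integrableOn_exp_mul_Iic (a := b) hb 0).congr_fun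
      (fun x hx => by simp only; rw [abs_of_nonpos hx]; ring_nf) measurableSet_Iic
  rw [← integrableOn_univ, ← Iic_union_Ioi (a := (0 : ℝ))]
  exact h2.union h1

lemma mlk_int {α : ℝ} (h1 : 1 < α) (h2 : α ≤ 4 / 3) : Integrable (mlk α) := by
  obtain ⟨C, hC, h⟩ := mlk_bound h1 h2
  refine Integrable.mono' ((ml_exp_abs_int (b := α - 1) (by linarith)).const_mul C)
    (mlk_cont h1 h2).aestronglyMeasurable (ae_of_all _ fun x => ?_)
  rw [Real.norm_of_nonneg (mlk_pos h1 h2 x).le]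
  exact (h x).1

lemma mlk_int' {α : ℝ} (h1 : 1 < α) (h2 : α ≤ 4 / 3) :
    Integrable (fun x => Real.exp x * mlk α x) := by
  obtain ⟨C, hC, h⟩ := mlk_bound h1 h2
  refine Integrable.mono' ((ml_exp_abs_int (b := α - 1) (by linarith)).const_mul C)
    (Real.continuous_exp.mul (mlk_cont h1 h2)).aestronglyMeasurable (ae_of_all _ fun x => ?_)
  rw [Real.norm_of_nonneg (mul_pos (Real.exp_pos x) (mlk_pos h1 h2 x)).le]
  exact (h x).2

lemma ml_res_aux (N D : ℂ → ℂ) (p d : ℂ) (hN : ContinuousAt N p) (hD : HasDerivAt D d p)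
    (h0 : D p = 0) (hd : d ≠ 0) :
    Tendsto (fun w => (w - p) * (N w / D w)) (𝓝[≠] p) (𝓝 (N p / d)) := by
  have h1 : Tendsto (slope D p) (𝓝[≠] p) (𝓝 d) := hasDerivAt_iff_tendsto_slope.1 hD
  have h2 : Tendsto N (𝓝[≠] p) (𝓝 (N p)) := hN.tendsto.mono_left nhdsWithin_le_nhds
  refine (h2.div h1 hd).congr fun w => ?_
  rw [Pi.div_apply, slope_def_field, h0, sub_zero, div_div_eq_mul_div]; ring

lemma ml_zeros {α : ℝ} (h1 : 1 < α) (h2 : α ≤ 4 / 3) (w : ℂ) (hw : |w.im| ≤ Real.pi)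
    (h : cexp (α * w) + 1 = 0) : w = Real.pi / α * I ∨ w = -(Real.pi / α * I) := by
  have hpi := Real.pi_pos
  have hα : (α : ℂ) ≠ 0 := by exact_mod_cast (by linarith : α ≠ 0)
  have h3 : cexp (α * w) = cexp (Real.pi * I) := by
    rw [Complex.exp_pi_mul_I]; linear_combination h
  obtain ⟨n, hn⟩ := Complex.exp_eq_exp_iff_exists_int.1 h3
  have him : α * w.im = Real.pi + n * (2 * Real.pi) := by
    have := congrArg im hn
    simpa using this
  have hb := abs_le.1 hw
  have hn' : n = 0 ∨ n = -1 := by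
    have hu : n < 1 := by
      by_contra hge
      have : (1 : ℝ) ≤ n := by exact_mod_cast not_lt.1 hge
      nlinarith
    have hl : -2 < n := by
      by_contra hge
      have : (n : ℝ) ≤ -2 := by exact_mod_cast not_lt.1 hge
      nlinarith
    omega
  rcases hn' with rfl | rfl
  · left
    field_simp
    linear_combination hn
  · right
    field_simp
    push_cast at hn
    linear_combination hn

lemma ml_stieltjes {α : ℝ} (h1 : 1 < α) (h2 : α ≤ 4 / 3) (σ : ℂ) (hσ : |σ.im| < Real.pi / 2) :
    ∫ x : ℝ, (mlk α x : ℂ) / (cexp x + cexp σ) =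
      cexp ((α - 2) * σ) / (cexp (α * σ) + 1)
      + (1 / α) * (cexp (-(Real.pi / α * I)) / (cexp (Real.pi / α * I) - cexp σ)
        + cexp (Real.pi / α * I) / (cexp (-(Real.pi / α * I)) - cexp σ)) := by
  have hpi := Real.pi_pos
  have hα : (α : ℂ) ≠ 0 := by exact_mod_cast (by linarith : α ≠ 0)
  set w0 : ℂ := Real.pi / α * I with hw0
  have hw0im : w0.im = Real.pi / α := by
    have : w0 = ((Real.pi / α : ℝ) : ℂ) * I := by rw [hw0]; push_cast; rfl
    rw [this]; simp
  have hb1 : Real.pi / α < Real.pi := by rw [div_lt_iff₀ (by linarith)]; nlinarith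
  have hb2 : Real.pi / 2 < Real.pi / α := by
    apply div_lt_div_of_pos_left hpi <;> linarith
  have hb0 : 0 < Real.pi / α := by linarith
  have hσ' := abs_lt.1 hσ
  have hne1 : w0 ≠ σ := by intro h; rw [← h, hw0im] at hσ'; linarith
  have hne2 : -w0 ≠ σ := by intro h; rw [← h, neg_im, hw0im] at hσ'; linarith
  have hne3 : w0 ≠ -w0 := by
    intro h
    have := congrArg im h
    rw [neg_im, hw0im] at this; linarith
  have hσne : ∀ w : ℂ, |w.im| ≤ Real.pi → w ≠ σ → cexp w - cexp σ ≠ 0 := by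
    intro w hw hne h0
    exact hne (ml_exp_inj hw (by linarith) (sub_eq_zero.1 h0))
  have him1 : |w0.im| < Real.pi := by rw [hw0im, abs_of_pos hb0]; exact hb1
  have him2 : |(-w0).im| < Real.pi := by rw [neg_im, abs_neg]; exact him1
  have hσπ : |σ.im| < Real.pi := by linarith
  have he1 : cexp (α * w0) = -1 := by
    rw [hw0, show (α : ℂ) * (Real.pi / α * I) = Real.pi * I by field_simp, Complex.exp_pi_mul_I]
  have he2 : cexp (α * -w0) = -1 := by
    rw [mul_neg, Complex.exp_neg, he1]; norm_num
  have hσD : cexp (α * σ) + 1 ≠ 0 := by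
    intro h
    rcases ml_zeros h1 h2 σ hσπ.le h with h | h
    · exact hne1 h.symm
    · exact hne2 h.symm
  set F : ℂ → ℂ := fun w => cexp ((α - 1) * w) / ((cexp (α * w) + 1) * (cexp w - cexp σ)) with hF
  have key := ml_rect F {σ, w0, -w0}
    (fun p => if p = σ then cexp ((α - 1) * σ) / (cexp (α * σ) + 1) / cexp σ
      else cexp ((α - 1) * p) / (cexp p - cexp σ) / (α * cexp (α * p)))
    (by
      intro p hp
      simp only [Finset.mem_insert, Finset.mem_singleton] at hp
      rcases hp with rfl | rfl | rfl <;> assumption)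
    (by
      intro w hw hwP
      simp only [Finset.mem_insert, Finset.mem_singleton, not_or] at hwP
      apply DifferentiableAt.div
      · fun_prop
      · fun_prop
      · apply mul_ne_zero
        · intro h0
          rcases ml_zeros h1 h2 w hw h0 with h | h
          · exact hwP.2.1 h
          · exact hwP.2.2 h
        · exact hσne w hw hwP.1)
    (by
      intro p hp
      have hpole : ∀ p : ℂ, cexp (α * p) = -1 → |p.im| ≤ Real.pi → p ≠ σ →
          Tendsto (fun w => (w - p) * F w) (𝓝[≠] p)
            (𝓝 (cexp ((α - 1) * p) / (cexp p - cexp σ) / (α * cexp (α * p)))) := by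
        intro p hp1 hp2 hp3
        have := ml_res_aux (fun w => cexp ((α - 1) * w) / (cexp w - cexp σ))
          (fun w => cexp (α * w) + 1) p (α * cexp (α * p))
          (by
            apply ContinuousAt.div
            · fun_prop
            · fun_prop
            · exact hσne p hp2 hp3)
          (by
            have h := ((hasDerivAt_id p).const_mul (α : ℂ)).cexp.add_const 1
            simp only [id, mul_one] at h
            rw [mul_comm (α : ℂ) (cexp _)]
            exact h)
          (by rw [hp1]; ring) (mul_ne_zero hα (Complex.exp_ne_zero _))
        refine this.congr fun w => ?_
        simp only [hF]
        rw [div_div, mul_comm (cexp w - cexp σ)]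
      simp only [Finset.mem_insert, Finset.mem_singleton] at hp
      rcases hp with rfl | rfl | rfl
      · simp only [if_true]
        have := ml_res_aux (fun w => cexp ((α - 1) * w) / (cexp (α * w) + 1))
          (fun w => cexp w - cexp p) p (cexp p)
          (by
            apply ContinuousAt.div
            · fun_prop
            · fun_prop
            · exact hσD)
          ((Complex.hasDerivAt_exp p).sub_const _)
          (by simp) (Complex.exp_ne_zero _)
        refine this.congr fun w => ?_
        simp only [hF]
        rw [div_div]
      · rw [if_neg hne1]; exact hpole w0 he1 him1.le hne1
      · rw [if_neg hne2]; exact hpole _ he2 him2.le hne2)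
    (by
      have t1 := ml_exp_re_atTop 2 (by simp) (by simp)
      have t2 := ml_exp_re_atTop α (by simp; linarith) (by simp)
      have t3 := ml_exp_re_atTop 1 (by simp) (by simp)
      have := t1.div ((t2.const_add 1).mul ((t3.const_mul (cexp σ)).const_sub 1)) (by simp)
      simp only [zero_div] at this
      refine this.congr fun w => ?_
      simp only [hF, Pi.div_apply, one_mul]
      have a1 : cexp (α * w) + 1 = cexp (α * w) * (1 + cexp (-(α * w))) := by
        rw [mul_add, ← Complex.exp_add]; simp
      have a2 : cexp w - cexp σ = cexp w * (1 - cexp σ * cexp (-w)) := by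
        rw [mul_sub, mul_left_comm, ← Complex.exp_add]; simp
      have a3 : cexp ((α - 1) * w) = cexp (α * w) * cexp w * cexp (-(2 * w)) := by
        rw [← Complex.exp_add, ← Complex.exp_add]; congr 1; ring
      rw [a1, a2, a3]
      rw [show cexp (α * w) * (1 + cexp (-(α * w))) * (cexp w * (1 - cexp σ * cexp (-w)))
        = (cexp (α * w) * cexp w) * ((1 + cexp (-(α * w))) * (1 - cexp σ * cexp (-w))) by ring]
      rw [mul_div_mul_left _ _ (mul_ne_zero (Complex.exp_ne_zero _) (Complex.exp_ne_zero _))])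
    (by
      have t1 := ml_exp_re_atBot (α - 1) (by simp; linarith) (by simp)
      have t2 := ml_exp_re_atBot α (by simp; linarith) (by simp)
      have t3 := ml_exp_re_atBot 1 (by simp) (by simp)
      have := t1.div ((t2.add_const 1).mul (t3.sub_const (cexp σ))) (by simp [Complex.exp_ne_zero])
      simp only [zero_div, one_mul] at this
      exact this)
  have hden : ∀ x : ℝ, cexp x + cexp σ ≠ 0 := by
    intro x h0
    have := congrArg re h0
    rw [add_re, Complex.exp_re, Complex.exp_re] at this
    simp at this
    have hc : 0 < Real.cos σ.im := Real.cos_pos_of_mem_Ioo ⟨by linarith, by linarith⟩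
    have : 0 < Real.exp σ.re * Real.cos σ.im := mul_pos (Real.exp_pos _) hc
    have := Real.exp_pos x
    linarith
  have hdiff : ∀ x : ℝ, F (x - Real.pi * I) - F (x + Real.pi * I)
      = 2 * Real.pi * I * ((mlk α x : ℂ) / (cexp x + cexp σ)) := by
    intro x
    set a : ℂ := cexp (α * Real.pi * I) with ha
    have ha0 : a ≠ 0 := Complex.exp_ne_zero _
    have e1 : cexp ((α - 1) * (x - Real.pi * I)) = -cexp ((α - 1) * x) * a⁻¹ := by
      rw [show ((α : ℂ) - 1) * (x - Real.pi * I) = (α - 1) * x + (-(α * Real.pi * I)) + Real.pi * I by ring,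
        Complex.exp_add, Complex.exp_add, Complex.exp_pi_mul_I, Complex.exp_neg]; ring
    have e2 : cexp ((α - 1) * (x + Real.pi * I)) = -cexp ((α - 1) * x) * a := by
      rw [show ((α : ℂ) - 1) * (x + Real.pi * I) = (α - 1) * x + (α * Real.pi * I) + (-(Real.pi * I)) by ring,
        Complex.exp_add, Complex.exp_add, Complex.exp_neg (Real.pi * I), Complex.exp_pi_mul_I]
      norm_num; ring
    have e3 : cexp (α * (x - Real.pi * I)) = cexp (α * x) * a⁻¹ := by
      rw [show (α : ℂ) * (x - Real.pi * I) = α * x + (-(α * Real.pi * I)) by ring,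
        Complex.exp_add, Complex.exp_neg]
    have e4 : cexp (α * (x + Real.pi * I)) = cexp (α * x) * a := by
      rw [show (α : ℂ) * (x + Real.pi * I) = α * x + (α * Real.pi * I) by ring,
        Complex.exp_add]
    have e5 : cexp (x - Real.pi * I) = -cexp x := by
      rw [Complex.exp_sub, Complex.exp_pi_mul_I]; simp [div_neg]
    have e6 : cexp (x + Real.pi * I) = -cexp x := by
      rw [Complex.exp_add, Complex.exp_pi_mul_I]; simp
    have hcos : a + a⁻¹ = 2 * Complex.cos (α * Real.pi) := by
      rw [ha, ← Complex.exp_neg, Complex.cos]; ring_nf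
    have hsin : a⁻¹ - a = -2 * I * Complex.sin (α * Real.pi) := by
      rw [ha, ← Complex.exp_neg, Complex.sin]
      rw [show -((α : ℂ) * Real.pi * I) = -(α * Real.pi) * I by ring]
      ring_nf; rw [I_sq]; ring
    have hz1 : cexp (α * x) * a⁻¹ + 1 ≠ 0 := by
      rw [← e3]; intro h0
      rcases ml_zeros h1 h2 _ (by simp [abs_of_pos hpi]) h0 with h | h
      · have := congrArg im h; rw [hw0im] at this; simp at this; linarith
      · have := congrArg im h; rw [neg_im, hw0im] at this; simp at this; linarith
    have hz2 : cexp (α * x) * a + 1 ≠ 0 := by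
      rw [← e4]; intro h0
      rcases ml_zeros h1 h2 _ (by simp [abs_of_pos hpi]) h0 with h | h
      · have := congrArg im h; rw [hw0im] at this; simp at this; linarith
      · have := congrArg im h; rw [neg_im, hw0im] at this; simp at this; linarith
    have hkk : (mlk α x : ℂ) = (-Complex.sin (α * Real.pi) / Real.pi) * cexp ((α - 1) * x) /
        ((cexp (α * x) * a⁻¹ + 1) * (cexp (α * x) * a + 1)) := by
      unfold mlk
      push_cast
      congr 1
      rw [← hcos]
      linear_combination (-cexp (α * x) ^ 2) * (inv_mul_cancel₀ ha0)
    have hpi' : (Real.pi : ℂ) ≠ 0 := by exact_mod_cast hpi.ne'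
    have hd1 : -cexp x - cexp σ ≠ 0 := by
      intro h; apply hden x; linear_combination -h
    simp only [hF]
    rw [e1, e2, e3, e4, e5, e6, hkk]
    rw [show 2 * Real.pi * I * ((-Complex.sin (α * Real.pi) / Real.pi) * cexp ((α - 1) * x) /
        ((cexp (α * x) * a⁻¹ + 1) * (cexp (α * x) * a + 1)) / (cexp x + cexp σ))
        = (a⁻¹ - a) * cexp ((α - 1) * x) /
        ((cexp (α * x) * a⁻¹ + 1) * (cexp (α * x) * a + 1)) / (cexp x + cexp σ) by
          rw [hsin]; field_simp]
    have hd2 := hden x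
    rw [show -cexp x - cexp σ = -(cexp x + cexp σ) by ring]
    rw [div_sub_div _ _ (mul_ne_zero hz1 (neg_ne_zero.2 hd2)) (mul_ne_zero hz2 (neg_ne_zero.2 hd2)),
      div_div, div_eq_div_iff
        (mul_ne_zero (mul_ne_zero hz1 (neg_ne_zero.2 hd2)) (mul_ne_zero hz2 (neg_ne_zero.2 hd2)))
        (mul_ne_zero (mul_ne_zero hz1 hz2) hd2)]
    have haa : a⁻¹ * a = 1 := inv_mul_cancel₀ ha0
    generalize a⁻¹ = b at *
    ring
  simp only [hdiff] at key
  have hcσ : 0 < (cexp σ).re := by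
    rw [Complex.exp_re]
    exact mul_pos (Real.exp_pos _) (Real.cos_pos_of_mem_Ioo ⟨by linarith, by linarith⟩)
  have hint : Integrable (fun x : ℝ => 2 * Real.pi * I * ((mlk α x : ℂ) / (cexp x + cexp σ))) := by
    apply Integrable.const_mul
    refine Integrable.mono' ((mlk_int h1 h2).mul_const ((cexp σ).re)⁻¹) ?_ (ae_of_all _ fun x => ?_)
    · apply Continuous.aestronglyMeasurable
      apply Continuous.div
      · exact Complex.continuous_ofReal.comp (mlk_cont h1 h2)
      · fun_prop
      · exact hden
    · rw [norm_div, div_eq_mul_inv, Complex.norm_real, Real.norm_of_nonneg (mlk_pos h1 h2 x).le]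
      apply mul_le_mul_of_nonneg_left _ (mlk_pos h1 h2 x).le
      apply inv_anti₀ hcσ
      refine le_trans ?_ (Complex.re_le_norm _)
      rw [add_re]
      have : 0 < (cexp x).re := by rw [← Complex.ofReal_exp, ofReal_re]; exact Real.exp_pos x
      linarith
  have key2 := key hint
  rw [integral_const_mul] at key2
  have hpi' : (2 * Real.pi * I : ℂ) ≠ 0 := by
    apply mul_ne_zero (mul_ne_zero two_ne_zero (by exact_mod_cast hpi.ne')) I_ne_zero
  have key3 := mul_left_cancel₀ hpi' key2
  rw [key3, Finset.sum_insert (by simp [hne1.symm, hne2.symm]),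
    Finset.sum_insert (by simp [hne3]), Finset.sum_singleton, if_pos rfl, if_neg hne1, if_neg hne2]
  have r1 : cexp ((α - 1) * w0) = -cexp (-w0) := by
    rw [show ((α : ℂ) - 1) * w0 = α * w0 + -w0 by ring, Complex.exp_add, he1]; ring
  have r2 : cexp ((α - 1) * -w0) = -cexp w0 := by
    rw [show ((α : ℂ) - 1) * -w0 = α * -w0 + w0 by ring, Complex.exp_add, he2]; ring
  have r3 : cexp ((α - 1) * σ) = cexp ((α - 2) * σ) * cexp σ := by
    rw [← Complex.exp_add]; congr 1; ring
  have z1 := hσne w0 him1.le hne1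
  have z2 := hσne (-w0) him2.le hne2
  rw [r1, r2, r3, he1, he2]
  have z0 := Complex.exp_ne_zero σ
  field_simp



lemma ml_gamma_real_int {a ρ : ℝ} (ha : 0 < a) (hρ : 0 < ρ) :
    IntegrableOn (fun t : ℝ => t ^ (a - 1) * Real.exp (-(ρ * t))) (Ioi 0) := by
  by_contra h
  have h1 := Real.integral_rpow_mul_exp_neg_mul_Ioi ha hρ
  rw [integral_undef h] at h1
  have : 0 < (1 / ρ) ^ a * Real.Gamma a := mul_pos (by positivity) (Real.Gamma_pos_of_pos ha)
  linarith

lemma ml_gamma_complex {a : ℝ} (ha : 0 < a) (s : ℂ) (hs : 0 < s.re) :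
    ∫ t in Ioi (0 : ℝ), ((t ^ (a - 1) : ℝ) : ℂ) * cexp (-(s * t)) =
      Real.Gamma a * cexp (-(a * Complex.log s)) := by
  set μ : Measure ℝ := (volume.restrict (Ioi 0)).withDensity (fun t => ENNReal.ofReal (t ^ (a - 1)))
    with hμ
  have hmeas : Measurable (fun t : ℝ => ENNReal.ofReal (t ^ (a - 1))) := by fun_prop
  have htop : ∀ᵐ t ∂(volume.restrict (Ioi (0 : ℝ))), ENNReal.ofReal (t ^ (a - 1)) < ⊤ :=
    ae_of_all _ fun t => ENNReal.ofReal_lt_top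
  have hmgf : ∀ z : ℂ, ProbabilityTheory.complexMGF id μ z
      = ∫ t in Ioi (0 : ℝ), ((t ^ (a - 1) : ℝ) : ℂ) * cexp (z * t) := by
    intro z
    rw [ProbabilityTheory.complexMGF, hμ, integral_withDensity_eq_integral_toReal_smul hmeas htop]
    apply setIntegral_congr_fun measurableSet_Ioi
    intro t ht
    simp only [id]
    rw [ENNReal.toReal_ofReal (Real.rpow_nonneg (le_of_lt ht) _), Complex.real_smul]
  have hset : Iio 0 ⊆ ProbabilityTheory.integrableExpSet id μ := by
    intro x hx
    simp only [mem_Iio] at hx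
    change Integrable _ μ
    rw [hμ, integrable_withDensity_iff_integrable_smul' hmeas htop]
    refine (ml_gamma_real_int ha (ρ := -x) (by linarith)).congr_fun ?_ measurableSet_Ioi
    intro t ht
    simp only [id]
    rw [ENNReal.toReal_ofReal (Real.rpow_nonneg (le_of_lt ht) _), smul_eq_mul]
    simp
  have hA : AnalyticOnNhd ℂ (fun z => ProbabilityTheory.complexMGF id μ (-z)) {z : ℂ | 0 < z.re} := by
    apply DifferentiableOn.analyticOnNhd
    · apply DifferentiableOn.comp (g := ProbabilityTheory.complexMGF id μ) (f := fun z : ℂ => -z)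
        (t := {z : ℂ | z.re ∈ interior (ProbabilityTheory.integrableExpSet id μ)})
        ProbabilityTheory.differentiableOn_complexMGF
      · fun_prop
      · intro z hz
        have : Iio 0 ⊆ interior (ProbabilityTheory.integrableExpSet id μ) :=
          interior_maximal hset isOpen_Iio
        apply this
        simpa using hz
    · exact isOpen_lt continuous_const Complex.continuous_re
  have hB : AnalyticOnNhd ℂ (fun z => (Real.Gamma a : ℂ) * cexp (-(a * Complex.log z))) {z : ℂ | 0 < z.re} := by
    apply DifferentiableOn.analyticOnNhd
    · intro z hz
      apply DifferentiableAt.differentiableWithinAt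
      have : z ∈ slitPlane := Or.inl hz
      have := Complex.differentiableAt_log this
      fun_prop
    · exact isOpen_lt continuous_const Complex.continuous_re
  have hreal : ∀ x : ℝ, 0 < x → ProbabilityTheory.complexMGF id μ (-x)
      = (Real.Gamma a : ℂ) * cexp (-(a * Complex.log x)) := by
    intro x hx
    rw [hmgf]
    have h1 := Real.integral_rpow_mul_exp_neg_mul_Ioi ha hx
    have h2 : ∫ t in Ioi (0 : ℝ), ((t ^ (a - 1) : ℝ) : ℂ) * cexp (-x * t)
      = ((∫ t in Ioi (0 : ℝ), t ^ (a - 1) * Real.exp (-(x * t)) : ℝ) : ℂ) := by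
      rw [← integral_complex_ofReal]
      congr 1; ext t; push_cast; ring_nf
    rw [h2, h1, Real.rpow_def_of_pos (by positivity), Complex.ofReal_mul, mul_comm,
      ← Complex.ofReal_log hx.le]
    congr 1
    push_cast
    rw [one_div, Real.log_inv]
    push_cast; ring_nf
  have hEq := hA.eqOn_of_preconnected_of_frequently_eq hB
    ((convex_halfSpace_re_gt 0).isPreconnected) (z₀ := 1) (by simp) (by
      have h3 : Tendsto (fun n : ℕ => (((1 : ℝ) + 1 / ((n : ℝ) + 1) : ℝ) : ℂ)) atTop (𝓝[≠] 1) := by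
        rw [tendsto_nhdsWithin_iff]
        constructor
        · have : Tendsto (fun n : ℕ => ((1 : ℝ) + 1 / ((n : ℝ) + 1) : ℝ)) atTop (𝓝 (1 + 0)) :=
            tendsto_const_nhds.add tendsto_one_div_add_atTop_nhds_zero_nat
          have h4 := (Complex.continuous_ofReal.tendsto _).comp this
          simp only [add_zero, ofReal_one] at h4
          exact h4
        · refine Eventually.of_forall fun n => ?_
          simp only [mem_compl_iff, mem_singleton_iff]
          intro h
          have h5 : ((1 : ℝ) + 1 / ((n : ℝ) + 1) : ℝ) = 1 := by exact_mod_cast h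
          have : 0 < 1 / ((n : ℝ) + 1) := by positivity
          linarith
      apply h3.frequently
      apply Frequently.of_forall
      intro n
      exact hreal _ (by positivity))
  have := hEq (show s ∈ {z : ℂ | 0 < z.re} from hs)
  simp only [hmgf] at this
  rw [← this]
  congr 1; ext t; ring_nf

noncomputable def mlf (α t : ℝ) : ℝ := ∑' k : ℕ, (-1) ^ k * t ^ (α * k + 1) / Real.Gamma (α * k + 2)

lemma ml_gamma_ge {α : ℝ} (h1 : 1 < α) (k : ℕ) : (k.factorial : ℝ) ≤ Real.Gamma (α * k + 2) := by
  have h2 : Real.Gamma ((k + 1 : ℕ) + 1) ≤ Real.Gamma (α * k + 2) := by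
    apply Real.Gamma_strictMonoOn_Ici.monotoneOn
    · simp; have : (0 : ℝ) ≤ k := by positivity
      linarith
    · simp; positivity
    · push_cast; have : (0 : ℝ) ≤ k := by positivity
      nlinarith
  rw [Real.Gamma_nat_eq_factorial] at h2
  refine le_trans ?_ h2
  exact_mod_cast Nat.factorial_le (Nat.le_succ k)

lemma ml_gamma_pos {α : ℝ} (h1 : 1 < α) (k : ℕ) : 0 < Real.Gamma (α * k + 2) :=
  lt_of_lt_of_le (by positivity) (ml_gamma_ge h1 k)

lemma ml_term_bound {α : ℝ} (h1 : 1 < α) (M x : ℝ) (hx : |x| ≤ M) (k : ℕ) :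
    ‖x ^ k / Real.Gamma (α * k + 2)‖ ≤ M ^ k / k.factorial := by
  rw [norm_div, norm_pow, Real.norm_eq_abs, Real.norm_of_nonneg (ml_gamma_pos h1 k).le]
  have := abs_nonneg x
  apply div_le_div₀ (pow_nonneg (by linarith) k) (pow_le_pow_left₀ this hx k) (by positivity) (ml_gamma_ge h1 k)

lemma ml_summable {α : ℝ} (h1 : 1 < α) (x : ℝ) :
    Summable (fun k : ℕ => x ^ k / Real.Gamma (α * k + 2)) :=
  Summable.of_norm_bounded (Real.summable_pow_div_factorial |x|) (ml_term_bound h1 |x| x le_rfl)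

noncomputable def mlE (α x : ℝ) : ℝ := ∑' k : ℕ, x ^ k / Real.Gamma (α * k + 2)

lemma mlE_cont {α : ℝ} (h1 : 1 < α) : Continuous (mlE α) := by
  rw [continuous_iff_continuousAt]
  intro x
  have h : ContinuousOn (mlE α) (Icc (-(|x| + 1)) (|x| + 1)) := by
    apply continuousOn_tsum (u := fun k : ℕ => (|x| + 1) ^ k / k.factorial)
    · intro k; fun_prop
    · exact Real.summable_pow_div_factorial _
    · intro k y hy
      exact ml_term_bound h1 _ y (abs_le.2 hy) k
  apply h.continuousAt
  apply Icc_mem_nhds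
  · have := neg_abs_le x; linarith
  · have := le_abs_self x; linarith

lemma mlf_eq {α : ℝ} (t : ℝ) (ht : 0 < t) : mlf α t = t * mlE α (-(t ^ α)) := by
  unfold mlf mlE
  rw [← tsum_mul_left]
  congr 1; ext k
  rw [Real.rpow_add ht, Real.rpow_mul ht.le, Real.rpow_one, Real.rpow_natCast, neg_pow]
  ring

lemma ml_integrable_tsum {F : ℕ → ℝ → ℂ} {μ : Measure ℝ} (hF : ∀ i, Integrable (F i) μ)
    (hs : Summable fun i => ∫ a, ‖F i a‖ ∂μ)
    (hm : AEStronglyMeasurable (fun a => ∑' i, F i a) μ) : Integrable (fun a => ∑' i, F i a) μ := by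
  refine ⟨hm, ?_⟩
  rw [hasFiniteIntegral_iff_enorm]
  calc ∫⁻ a, ‖∑' i, F i a‖ₑ ∂μ ≤ ∫⁻ a, ∑' i, ‖F i a‖ₑ ∂μ := lintegral_mono fun a => enorm_tsum_le_tsum_enorm
    _ = ∑' i, ∫⁻ a, ‖F i a‖ₑ ∂μ := lintegral_tsum fun i => (hF i).1.enorm
    _ = ∑' i, ENNReal.ofReal (∫ a, ‖F i a‖ ∂μ) := by
      congr 1; ext i
      rw [ofReal_integral_norm_eq_lintegral_enorm (hF i)]
    _ < ⊤ := by
      exact hs.tsum_ofReal_lt_top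

lemma mlf_laplace {α : ℝ} (h1 : 1 < α) (s : ℂ) (hs : 1 < s.re) :
    IntegrableOn (fun t : ℝ => (mlf α t : ℂ) * cexp (-(s * t))) (Ioi 0) ∧
    ∫ t in Ioi (0 : ℝ), (mlf α t : ℂ) * cexp (-(s * t)) =
      cexp ((α - 2) * Complex.log s) / (cexp (α * Complex.log s) + 1) := by
  set σ := Complex.log s with hσ
  have hs0 : s ≠ 0 := by intro h; simp [h] at hs; linarith
  have hσre : 0 < σ.re := by
    rw [hσ, Complex.log_re]
    apply Real.log_pos
    exact hs.trans_le (Complex.re_le_norm s)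
  set F : ℕ → ℝ → ℂ := fun k t => ((-1) ^ k / Real.Gamma (α * k + 2) : ℂ) *
    (((t ^ ((α * k + 2) - 1) : ℝ) : ℂ) * cexp (-(s * t))) with hF
  have hak : ∀ k : ℕ, 0 < α * k + 2 := fun k => by positivity
  have hFn : ∀ k : ℕ, ∀ t ∈ Ioi (0 : ℝ), ‖F k t‖ = 1 / Real.Gamma (α * k + 2) *
      (t ^ ((α * k + 2) - 1) * Real.exp (-(s.re * t))) := by
    intro k t ht
    simp only [hF, norm_mul, norm_div, norm_pow, norm_neg, norm_one, one_pow, Complex.norm_real,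
      Complex.norm_exp]
    rw [Real.norm_of_nonneg (ml_gamma_pos h1 k).le,
      Real.norm_of_nonneg (Real.rpow_nonneg (le_of_lt ht) _)]
    simp
  have hFi : ∀ k, IntegrableOn (F k) (Ioi 0) := by
    intro k
    have h := (ml_gamma_real_int (hak k) (ρ := s.re) (by linarith)).const_mul
      (1 / Real.Gamma (α * k + 2))
    refine Integrable.mono' h ?_ ?_
    · simp only [hF]
      apply Measurable.aestronglyMeasurable
      fun_prop
    · filter_upwards [ae_restrict_mem measurableSet_Ioi] with t ht
      rw [hFn k t ht]
  have hFnorm : ∀ k : ℕ, ∫ t in Ioi (0 : ℝ), ‖F k t‖ = (1 / s.re) ^ (α * k + 2) := by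
    intro k
    rw [setIntegral_congr_fun measurableSet_Ioi (hFn k), integral_const_mul,
      Real.integral_rpow_mul_exp_neg_mul_Ioi (hak k) (by linarith)]
    field_simp [(ml_gamma_pos h1 k).ne']
  have hsum : Summable fun k => ∫ t in Ioi (0 : ℝ), ‖F k t‖ := by
    simp only [hFnorm]
    have hq0 : 0 < 1 / s.re := by positivity
    have hq1 : 1 / s.re < 1 := by rw [div_lt_one (by linarith)]; exact hs
    have : ∀ k : ℕ, (1 / s.re) ^ (α * k + 2) = ((1 / s.re) ^ α) ^ k * (1 / s.re) ^ (2 : ℝ) := by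
      intro k
      rw [Real.rpow_add hq0, Real.rpow_mul hq0.le, Real.rpow_natCast]
    simp only [this]
    apply Summable.mul_right
    apply summable_geometric_of_lt_one (by positivity)
    exact Real.rpow_lt_one hq0.le hq1 (by linarith)
  have htsum : ∀ t : ℝ, ∑' k, F k t = (mlf α t : ℂ) * cexp (-(s * t)) := by
    intro t
    unfold mlf
    rw [Complex.ofReal_tsum, ← tsum_mul_right]
    congr 1; ext k
    simp only [hF]
    push_cast
    rw [show α * (k : ℝ) + 2 - 1 = α * k + 1 by ring]
    ring
  have hFint : ∀ k : ℕ, ∫ t in Ioi (0 : ℝ), F k t = cexp (-(2 * σ)) * (-cexp (-(α * σ))) ^ k := by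
    intro k
    simp only [hF]
    rw [integral_const_mul, ml_gamma_complex (hak k) s (by linarith), ← hσ]
    have : (Real.Gamma (α * k + 2) : ℂ) ≠ 0 := by exact_mod_cast (ml_gamma_pos h1 k).ne'
    rw [neg_pow (cexp _), ← Complex.exp_nat_mul]
    field_simp
    rw [← Complex.exp_add]
    push_cast; ring_nf
  constructor
  · have := ml_integrable_tsum hFi hsum (by
      simp only [htsum]
      apply ContinuousOn.aestronglyMeasurable _ measurableSet_Ioi
      apply ContinuousOn.mul _ (by fun_prop)
      apply Complex.continuous_ofReal.comp_continuousOn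
      have hc : ContinuousOn (fun t : ℝ => t * mlE α (-(t ^ α))) (Ioi 0) := by
        apply continuousOn_id.mul
        apply (mlE_cont h1).comp_continuousOn
        apply ContinuousOn.neg
        intro t ht
        exact (Real.continuousAt_rpow_const t α (Or.inl (ne_of_gt ht))).continuousWithinAt
      exact hc.congr fun t ht => mlf_eq t ht)
    simp only [htsum] at this
    exact this
  · have h := integral_tsum_of_summable_integral_norm hFi hsum
    simp only [htsum] at h
    rw [← h]
    simp only [hFint]
    rw [tsum_mul_left, tsum_geometric_of_norm_lt_one]
    · have e1 : cexp ((α - 2) * σ) = cexp (α * σ) * cexp (-(2 * σ)) := by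
        rw [← Complex.exp_add]; ring_nf
      have e2 : cexp (α * σ) + 1 = cexp (α * σ) * (1 - -cexp (-(α * σ))) := by
        rw [sub_neg_eq_add, mul_add, ← Complex.exp_add]; simp
      rw [e1, e2, mul_div_mul_left _ _ (Complex.exp_ne_zero _), div_eq_mul_inv]
    · rw [norm_neg, Complex.norm_exp]
      simp
      positivity



lemma ml_unique (g : ℝ → ℂ) (hg : ContinuousOn g (Ioi 0))
    (hi : IntegrableOn (fun t : ℝ => g t * cexp (-(2 * t))) (Ioi 0))
    (h0 : ∀ s : ℂ, s.re = 2 → ∫ t in Ioi (0 : ℝ), g t * cexp (-(s * t)) = 0) (t : ℝ) (ht : 0 < t) :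
    g t = 0 := by
  set d : ℝ → ℂ := indicator (Ioi 0) (fun t : ℝ => g t * cexp (-(2 * t))) with hd
  have hdi : Integrable d := (integrable_indicator_iff measurableSet_Ioi).2 hi
  have hF : FourierTransform.fourier d = fun _ => (0 : ℂ) := by
    ext w
    rw [Real.fourier_eq']
    rw [← h0 (2 + 2 * Real.pi * w * I) (by simp), ← integral_indicator measurableSet_Ioi]
    congr 1; ext v
    by_cases hv : v ∈ Ioi (0 : ℝ)
    · simp only [hd, indicator_of_mem hv, smul_eq_mul]
      rw [mul_left_comm, ← Complex.exp_add]
      congr 2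
      simp
      ring
    · simp only [hd, indicator_of_notMem hv, smul_zero]
  have hc : ContinuousAt d t := by
    have h1 : ContinuousAt (fun t : ℝ => g t * cexp (-(2 * t))) t :=
      (hg.continuousAt (Ioi_mem_nhds ht)).mul (by fun_prop)
    apply h1.congr
    filter_upwards [Ioi_mem_nhds ht] with u hu
    simp only [hd, indicator_of_mem hu]
  have h := hdi.fourierInv_fourier_eq (by rw [hF]; exact integrable_zero _ _ _) hc
  rw [hF] at h
  have h2 : d t = 0 := by
    rw [← h, Real.fourierInv_eq']
    simp
  simp only [hd, indicator_of_mem (show t ∈ Ioi (0 : ℝ) from ht)] at h2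
  exact (mul_eq_zero.1 h2).resolve_right (Complex.exp_ne_zero _)

noncomputable def mlA (α t : ℝ) : ℝ := ∫ x : ℝ, Real.exp (-(t * Real.exp x)) * mlk α x

lemma mlA_int {α : ℝ} (h1 : 1 < α) (h2 : α ≤ 4 / 3) (t : ℝ) (ht : 0 ≤ t) :
    Integrable (fun x : ℝ => Real.exp (-(t * Real.exp x)) * mlk α x) := by
  have hk := mlk_cont h1 h2
  refine (mlk_int h1 h2).mono' (by fun_prop) (ae_of_all _ fun x => ?_)
  have hp := mlk_pos h1 h2 x
  rw [Real.norm_of_nonneg (by positivity)]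
  have : Real.exp (-(t * Real.exp x)) ≤ 1 := Real.exp_le_one_iff.2 (by have := Real.exp_pos x; nlinarith)
  nlinarith

lemma mlA_cont {α : ℝ} (h1 : 1 < α) (h2 : α ≤ 4 / 3) : ContinuousOn (mlA α) (Ici 0) := by
  have hk := mlk_cont h1 h2
  unfold mlA
  apply continuousOn_of_dominated (bound := mlk α)
  · intro t ht; fun_prop
  · intro t ht
    refine ae_of_all _ fun x => ?_
    have ht : 0 ≤ t := ht
    have hp := mlk_pos h1 h2 x
    rw [Real.norm_of_nonneg (by positivity)]
    have : Real.exp (-(t * Real.exp x)) ≤ 1 := Real.exp_le_one_iff.2 (by have := Real.exp_pos x; nlinarith)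
    nlinarith
  · exact mlk_int h1 h2
  · exact ae_of_all _ fun x => by fun_prop

lemma mlA_laplace {α : ℝ} (h1 : 1 < α) (h2 : α ≤ 4 / 3) (s : ℂ) (hs : s.re = 2) :
    IntegrableOn (fun t : ℝ => (mlA α t : ℂ) * cexp (-(s * t))) (Ioi 0) ∧
    ∫ t in Ioi (0 : ℝ), (mlA α t : ℂ) * cexp (-(s * t)) =
      ∫ x : ℝ, (mlk α x : ℂ) / (cexp x + s) := by
  have hk := mlk_cont h1 h2
  set F : ℝ × ℝ → ℂ := fun p => ((Real.exp (-(p.1 * Real.exp p.2)) * mlk α p.2 : ℝ) : ℂ) * cexp (-(s * p.1))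
    with hF
  have hFi : Integrable F ((volume.restrict (Ioi (0 : ℝ))).prod volume) := by
    have hb : Integrable (fun p : ℝ × ℝ => Real.exp (-2 * p.1) * mlk α p.2)
        ((volume.restrict (Ioi (0 : ℝ))).prod volume) :=
      Integrable.mul_prod (f := fun t : ℝ => Real.exp (-2 * t)) (g := mlk α)
        (exp_neg_integrableOn_Ioi 0 (by norm_num)) (mlk_int h1 h2)
    refine hb.mono' ?_ ?_
    · apply Continuous.aestronglyMeasurable
      fun_prop
    · have := Measure.quasiMeasurePreserving_fst (μ := volume.restrict (Ioi (0 : ℝ)))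
        (ν := (volume : Measure ℝ)) |>.ae (ae_restrict_mem measurableSet_Ioi)
      filter_upwards [this] with p hp
      have hp : 0 < p.1 := hp
      have hm := mlk_pos h1 h2 p.2
      simp only [hF]
      rw [norm_mul, Complex.norm_real, Real.norm_of_nonneg (by positivity), Complex.norm_exp]
      have e1 : (-(s * (p.1 : ℂ))).re = -2 * p.1 := by simp [hs]
      rw [e1, mul_comm (Real.exp (-2 * p.1))]
      have : Real.exp (-(p.1 * Real.exp p.2)) ≤ 1 :=
        Real.exp_le_one_iff.2 (by have := Real.exp_pos p.2; nlinarith)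
      gcongr
      nlinarith
  have hA : ∀ t : ℝ, ∫ x : ℝ, F (t, x) = (mlA α t : ℂ) * cexp (-(s * t)) := by
    intro t
    simp only [hF]
    rw [integral_mul_const, integral_complex_ofReal]
    rfl
  constructor
  · have := hFi.integral_prod_left
    simp only [hA] at this
    exact this
  · simp only [← hA]
    rw [integral_integral_swap (f := fun t x => F (t, x)) hFi]
    congr 1; ext x
    have e2 : ∀ t : ℝ, F (t, x) = (mlk α x : ℂ) * cexp (-(cexp x + s) * t) := by
      intro t
      simp only [hF]
      push_cast
      rw [mul_comm (cexp _) (mlk α x : ℂ), mul_assoc, ← Complex.exp_add]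
      ring_nf
    simp only [e2]
    have hre : (-(cexp x + s)).re < 0 := by
      have : (cexp x).re = Real.exp x := by rw [← Complex.ofReal_exp, Complex.ofReal_re]
      have h3 := Real.exp_pos x
      simp only [neg_re, add_re, this, hs]; linarith
    rw [integral_const_mul, integral_exp_mul_complex_Ioi hre]
    simp [div_eq_mul_inv]
    rw [show -s + -cexp x = -(cexp x + s) by ring, inv_neg]; ring

noncomputable def mlB (α t : ℝ) : ℝ :=
  2 / α * Real.exp (-(Real.cos (Real.pi - Real.pi / α) * t)) *
    Real.cos (Real.sin (Real.pi - Real.pi / α) * t + (Real.pi - Real.pi / α))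

lemma mlB_eq {α : ℝ} (h1 : 1 < α) (t : ℝ) : (mlB α t : ℂ) =
    -(1 / α) * (cexp (-(Real.pi / α * I)) * cexp (cexp (Real.pi / α * I) * t)
      + cexp (Real.pi / α * I) * cexp (cexp (-(Real.pi / α * I)) * t)) := by
  have hα : (α : ℂ) ≠ 0 := by exact_mod_cast (by linarith : α ≠ 0)
  set δ : ℝ := Real.pi - Real.pi / α with hδ
  have ea : cexp (Real.pi / α * I) = -cexp (-(δ * I)) := by
    rw [show (Real.pi / α * I : ℂ) = Real.pi * I + -(δ * I) by rw [hδ]; push_cast; ring,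
      Complex.exp_add, Complex.exp_pi_mul_I]; ring
  have eb : cexp (-(Real.pi / α * I)) = -cexp (δ * I) := by
    rw [show (-(Real.pi / α * I) : ℂ) = -(Real.pi * I) + (δ * I) by rw [hδ]; push_cast; ring,
      Complex.exp_add, Complex.exp_neg, Complex.exp_pi_mul_I]; norm_num
  have ec : cexp (Real.pi / α * I) = -Real.cos δ + Real.sin δ * I := by
    rw [ea, show (-(δ * I) : ℂ) = ((-δ : ℝ) : ℂ) * I by push_cast; ring, Complex.exp_mul_I]
    push_cast
    rw [Complex.cos_neg, Complex.sin_neg]; ring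
  have ed : cexp (-(Real.pi / α * I)) = -Real.cos δ - Real.sin δ * I := by
    rw [eb, Complex.exp_mul_I]
    push_cast
    ring
  have e1 : cexp (cexp (Real.pi / α * I) * t) =
    cexp (-(Real.cos δ * t)) * cexp (Real.sin δ * t * I) := by
    rw [ec, ← Complex.exp_add]; ring_nf
  have e2 : cexp (cexp (-(Real.pi / α * I)) * t) =
    cexp (-(Real.cos δ * t)) * cexp (-(Real.sin δ * t * I)) := by
    rw [ed, ← Complex.exp_add]; ring_nf
  have e3 : (Real.cos (Real.sin δ * t + δ) : ℂ) =
      (cexp (Real.sin δ * t * I) * cexp (δ * I) + cexp (-(Real.sin δ * t * I)) * cexp (-(δ * I))) / 2 := by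
    rw [Complex.ofReal_cos, Complex.cos, ← Complex.exp_add, ← Complex.exp_add, Complex.ofReal_add,
      Complex.ofReal_mul]
    ring_nf
  rw [e1, e2, ea, eb]
  unfold mlB
  rw [← hδ, Complex.ofReal_mul, e3, Complex.ofReal_mul, Complex.ofReal_exp, Complex.ofReal_neg,
    Complex.ofReal_mul]
  push_cast
  ring

lemma mlB_laplace {α : ℝ} (h1 : 1 < α) (s : ℂ) (hs : s.re = 2) :
    IntegrableOn (fun t : ℝ => (mlB α t : ℂ) * cexp (-(s * t))) (Ioi 0) ∧
    ∫ t in Ioi (0 : ℝ), (mlB α t : ℂ) * cexp (-(s * t)) =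
      (1 / α) * (cexp (-(Real.pi / α * I)) / (cexp (Real.pi / α * I) - s)
        + cexp (Real.pi / α * I) / (cexp (-(Real.pi / α * I)) - s)) := by
  have key : ∀ p q : ℂ, ‖p‖ = 1 →
    IntegrableOn (fun t : ℝ => q * cexp ((p - s) * t)) (Ioi 0) ∧
    ∫ t in Ioi (0 : ℝ), q * cexp ((p - s) * t) = -(q / (p - s)) := by
    intro p q hp
    have hre : (p - s).re < 0 := by
      have := Complex.re_le_norm p
      simp only [sub_re, hs]; linarith
    refine ⟨(integrableOn_exp_mul_complex_Ioi hre 0).const_mul q, ?_⟩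
    rw [integral_const_mul, integral_exp_mul_complex_Ioi hre]
    simp; ring
  have ea : ‖cexp (Real.pi / α * I)‖ = 1 := by
    rw [show (Real.pi / α * I : ℂ) = ((Real.pi / α : ℝ) : ℂ) * I by push_cast; ring]
    exact Complex.norm_exp_ofReal_mul_I _
  have eb : ‖cexp (-(Real.pi / α * I))‖ = 1 := by
    rw [show (-(Real.pi / α * I) : ℂ) = ((-(Real.pi / α) : ℝ) : ℂ) * I by push_cast; ring]
    exact Complex.norm_exp_ofReal_mul_I _
  have k1 := key _ (cexp (-(Real.pi / α * I))) ea
  have k2 := key _ (cexp (Real.pi / α * I)) eb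
  have e : ∀ t : ℝ, (mlB α t : ℂ) * cexp (-(s * t)) =
     -(1 / α) * (cexp (-(Real.pi / α * I)) * cexp ((cexp (Real.pi / α * I) - s) * t)
      + cexp (Real.pi / α * I) * cexp ((cexp (-(Real.pi / α * I)) - s) * t)) := by
    intro t
    rw [mlB_eq h1, sub_mul, sub_mul, sub_eq_add_neg, sub_eq_add_neg, Complex.exp_add, Complex.exp_add]
    ring
  simp only [e]
  refine ⟨(k1.1.add k2.1).const_mul _, ?_⟩
  rw [integral_const_mul, integral_add k1.1 k2.1, k1.2, k2.2]
  ring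

lemma mlf_cont {α : ℝ} (h1 : 1 < α) : ContinuousOn (mlf α) (Ioi 0) := by
  have hc : ContinuousOn (fun t : ℝ => t * mlE α (-(t ^ α))) (Ioi 0) := by
    apply continuousOn_id.mul
    apply (mlE_cont h1).comp_continuousOn
    apply ContinuousOn.neg
    intro t ht
    exact (Real.continuousAt_rpow_const t α (Or.inl (ne_of_gt ht))).continuousWithinAt
  exact hc.congr fun t ht => mlf_eq t ht

theorem mlf_rep {α : ℝ} (h1 : 1 < α) (h2 : α ≤ 4 / 3) (t : ℝ) (ht : 0 < t) :
    mlf α t = mlA α t - mlB α t := by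
  have h := ml_unique (fun t : ℝ => (mlf α t : ℂ) - (mlA α t - mlB α t)) ?_ ?_ ?_ t ht
  · have h' : (mlf α t : ℂ) = ((mlA α t - mlB α t : ℝ) : ℂ) := by
      push_cast
      exact sub_eq_zero.1 h
    exact_mod_cast h'
  · have hA := (mlA_cont h1 h2).mono Ioi_subset_Ici_self
    have hf := mlf_cont h1
    have hB : ContinuousOn (mlB α) (Ioi 0) := by unfold mlB; fun_prop
    have := Complex.continuous_ofReal
    exact (this.comp_continuousOn hf).sub ((this.comp_continuousOn hA).sub (this.comp_continuousOn hB))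
  · have := ((mlf_laplace h1 2 (by simp)).1.sub ((mlA_laplace h1 h2 2 (by simp)).1.sub (mlB_laplace h1 2 (by simp)).1))
    refine this.congr_fun ?_ measurableSet_Ioi
    intro t _
    simp only [Pi.sub_apply]
    ring
  · intro s hs
    obtain ⟨f1, f2⟩ := mlf_laplace h1 s (by rw [hs]; norm_num)
    obtain ⟨a1, a2⟩ := mlA_laplace h1 h2 s hs
    obtain ⟨b1, b2⟩ := mlB_laplace h1 s hs
    have hs0 : s ≠ 0 := by intro h; simp [h] at hs
    have e : ∀ t : ℝ, ((mlf α t : ℂ) - (mlA α t - mlB α t)) * cexp (-(s * t)) =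
      (mlf α t : ℂ) * cexp (-(s * t)) - ((mlA α t : ℂ) * cexp (-(s * t)) - (mlB α t : ℂ) * cexp (-(s * t))) := by
      intro t; ring
    simp only [e]
    have i1 := integral_sub f1 (a1.sub b1)
    have i2 := integral_sub a1 b1
    simp only [Pi.sub_apply] at i1
    rw [i1, i2, f2, a2, b2]
    have hst := ml_stieltjes h1 h2 (Complex.log s) (by
      rw [Complex.log_im, Complex.abs_arg_lt_pi_div_two_iff]
      left; rw [hs]; norm_num)
    rw [Complex.exp_log hs0] at hst
    rw [hst]
    ring



lemma mlE_zero {α : ℝ} : mlE α 0 = 1 := by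
  unfold mlE
  rw [tsum_eq_single 0]
  · simp
  · intro k hk; simp [hk]

lemma mlE_lim {α : ℝ} (h1 : 1 < α) : Tendsto (fun t : ℝ => mlE α (-(t ^ α))) (𝓝[>] 0) (𝓝 1) := by
  have h : Continuous (fun t : ℝ => mlE α (-(t ^ α))) := by
    apply (mlE_cont h1).comp
    apply Continuous.neg
    exact Real.continuous_rpow_const (by linarith)
  have h3 := (h.tendsto 0).mono_left (nhdsWithin_le_nhds (s := Ioi (0 : ℝ)))
  rw [Real.zero_rpow (by linarith), neg_zero, mlE_zero] at h3
  exact h3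

lemma mlB_zero {α : ℝ} : mlB α 0 = 2 / α * Real.cos (Real.pi - Real.pi / α) := by
  unfold mlB; simp

lemma mlB_deriv {α : ℝ} : HasDerivAt (mlB α) (-(2 / α)) 0 := by
  unfold mlB
  set δ : ℝ := Real.pi - Real.pi / α
  have e1 : HasDerivAt (fun t : ℝ => Real.exp (-(Real.cos δ * t))) (-Real.cos δ) 0 := by
    have := (((hasDerivAt_id (0 : ℝ)).const_mul (Real.cos δ)).neg).exp
    simpa using this
  have e2 : HasDerivAt (fun t : ℝ => Real.cos (Real.sin δ * t + δ)) (-Real.sin δ * Real.sin δ) 0 := by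
    have := (((hasDerivAt_id (0 : ℝ)).const_mul (Real.sin δ)).add_const δ).cos
    simpa using this
  have := (e1.const_mul (2 / α)).mul e2
  refine this.congr_deriv ?_
  have := Real.sin_sq_add_cos_sq δ
  simp
  linear_combination (-(2 / α)) * this

lemma mlA_zero {α : ℝ} (h1 : 1 < α) (h2 : α ≤ 4 / 3) :
    mlA α 0 = 2 / α * Real.cos (Real.pi - Real.pi / α) := by
  have hA : Tendsto (mlA α) (𝓝[>] 0) (𝓝 (mlA α 0)) :=
    ((mlA_cont h1 h2) 0 (by simp)).mono_left (nhdsWithin_mono _ Ioi_subset_Ici_self)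
  have hB : Tendsto (mlB α) (𝓝[>] 0) (𝓝 (mlB α 0)) :=
    mlB_deriv.continuousAt.tendsto.mono_left nhdsWithin_le_nhds
  have hf : Tendsto (fun t : ℝ => t * mlE α (-(t ^ α)) + mlB α t) (𝓝[>] 0) (𝓝 (0 * 1 + mlB α 0)) :=
    ((tendsto_id.mono_left nhdsWithin_le_nhds).mul (mlE_lim h1)).add hB
  have he : (fun t : ℝ => t * mlE α (-(t ^ α)) + mlB α t) =ᶠ[𝓝[>] 0] mlA α := by
    filter_upwards [self_mem_nhdsWithin] with t ht
    have ht : 0 < t := ht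
    have := mlf_rep h1 h2 t ht
    rw [mlf_eq t ht] at this
    linarith
  have := tendsto_nhds_unique (hf.congr' he) hA
  rw [← this, mlB_zero]; ring

lemma mlA_moment {α : ℝ} (h1 : 1 < α) (h2 : α ≤ 4 / 3) :
    ∫ x : ℝ, Real.exp x * mlk α x = 2 / α - 1 := by
  have hk := mlk_cont h1 h2
  have hlim : Tendsto (fun t : ℝ => ∫ x : ℝ, (1 - Real.exp (-(t * Real.exp x))) / t * mlk α x) (𝓝[>] 0)
      (𝓝 (∫ x : ℝ, Real.exp x * mlk α x)) := by
    apply tendsto_integral_filter_of_dominated_convergence (fun x => Real.exp x * mlk α x)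
    · exact Eventually.of_forall fun t => by
        apply Continuous.aestronglyMeasurable; fun_prop
    · filter_upwards [self_mem_nhdsWithin] with t ht
      have ht : 0 < t := ht
      refine ae_of_all _ fun x => ?_
      have hp := mlk_pos h1 h2 x
      have hx := Real.exp_pos x
      have h3 : Real.exp (-(t * Real.exp x)) ≤ 1 := Real.exp_le_one_iff.2 (by nlinarith)
      have h4 := Real.add_one_le_exp (-(t * Real.exp x))
      rw [Real.norm_of_nonneg (mul_nonneg (div_nonneg (by linarith) ht.le) hp.le)]
      gcongr
      rw [div_le_iff₀ ht]; linarith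
    · exact mlk_int' h1 h2
    · refine ae_of_all _ fun x => ?_
      apply Tendsto.mul_const
      have hd : HasDerivAt (fun t : ℝ => -Real.exp (-(t * Real.exp x))) (Real.exp x) 0 := by
        have h8 : HasDerivAt (fun t : ℝ => Real.exp (-(t * Real.exp x))) (-Real.exp x) 0 := by
          simpa using (((hasDerivAt_id (0 : ℝ)).mul_const (Real.exp x)).neg).exp
        have h9 := h8.neg
        rw [neg_neg] at h9
        exact h9
      have := (hasDerivAt_iff_tendsto_slope.1 hd).mono_left
        (nhdsWithin_mono (0 : ℝ) (fun t (ht : t ∈ Ioi (0 : ℝ)) => ne_of_gt ht))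
      refine this.congr fun t => ?_
      rw [slope_def_field]; simp; ring
  have hlim2 : Tendsto (fun t : ℝ => -mlE α (-(t ^ α)) - (mlB α t - mlB α 0) / (t - 0)) (𝓝[>] 0)
      (𝓝 (-1 - -(2 / α))) := by
    apply (mlE_lim h1).neg.sub
    have := (hasDerivAt_iff_tendsto_slope.1 (mlB_deriv (α := α))).mono_left
        (nhdsWithin_mono (0 : ℝ) (fun t (ht : t ∈ Ioi (0 : ℝ)) => ne_of_gt ht))
    refine this.congr fun t => ?_
    rw [slope_def_field]
  have he : (fun t : ℝ => ∫ x : ℝ, (1 - Real.exp (-(t * Real.exp x))) / t * mlk α x) =ᶠ[𝓝[>] 0]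
      (fun t : ℝ => -mlE α (-(t ^ α)) - (mlB α t - mlB α 0) / (t - 0)) := by
    filter_upwards [self_mem_nhdsWithin] with t ht
    have ht : 0 < t := ht
    have h5 := mlf_rep h1 h2 t ht
    rw [mlf_eq t ht] at h5
    have h6 : mlA α 0 = mlB α 0 := by rw [mlA_zero h1 h2, mlB_zero]
    have h7 : ∫ x : ℝ, (1 - Real.exp (-(t * Real.exp x))) / t * mlk α x = (mlA α 0 - mlA α t) / t := by
      unfold mlA
      rw [← integral_sub (mlA_int h1 h2 0 le_rfl) (mlA_int h1 h2 t ht.le), ← integral_div]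
      congr 1; ext x; simp; ring
    rw [h7, h6, sub_zero]
    field_simp
    linarith
  have := tendsto_nhds_unique (hlim.congr' he) hlim2
  rw [this]; ring

lemma mlA_lower {α : ℝ} (h1 : 1 < α) (h2 : α ≤ 4 / 3) (m t : ℝ) (ht : 0 ≤ t)
    (hm : m * mlA α 0 = 2 / α - 1) : mlA α 0 * Real.exp (-(m * t)) ≤ mlA α t := by
  have i0 := mlk_int h1 h2
  have i1 := mlk_int' h1 h2
  have e0 : mlA α 0 = ∫ x, mlk α x := by unfold mlA; simp
  have key : ∫ x, (Real.exp (-(m * t)) * (1 + m * t) * mlk α x -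
      Real.exp (-(m * t)) * t * (Real.exp x * mlk α x)) ≤ mlA α t := by
    apply integral_mono ((i0.const_mul _).sub (i1.const_mul _)) (mlA_int h1 h2 t ht)
    intro x
    have hp := mlk_pos h1 h2 x
    have h3 := Real.add_one_le_exp (-((Real.exp x - m) * t))
    have h4 : Real.exp (-(t * Real.exp x)) = Real.exp (-(m * t)) * Real.exp (-((Real.exp x - m) * t)) := by
      rw [← Real.exp_add]; ring_nf
    have h5 := mul_le_mul_of_nonneg_left h3 (mul_pos (Real.exp_pos (-(m * t))) hp).le
    simp only [h4, Pi.sub_apply]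
    linarith
  rw [integral_sub (i0.const_mul _) (i1.const_mul _), integral_const_mul, integral_const_mul,
    mlA_moment h1 h2, ← e0, ← hm] at key
  linarith

lemma ml_cos_exp {δ : ℝ} (hc : 0 < Real.cos δ) (u : ℝ) (hu : 0 ≤ u) (hu' : u ≤ Real.pi) :
    Real.cos (u + δ) ≤ Real.cos δ * Real.exp (-(Real.sin δ / Real.cos δ * u)) := by
  set k := Real.sin δ / Real.cos δ with hk
  have hder : ∀ v : ℝ, HasDerivAt (fun v : ℝ => Real.cos (v + δ) * Real.exp (k * v))
      (-Real.sin v / Real.cos δ * Real.exp (k * v)) v := by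
    intro v
    have a1 : HasDerivAt (fun v : ℝ => Real.cos (v + δ)) (-Real.sin (v + δ)) v := by
      simpa using ((hasDerivAt_id v).add_const δ).cos
    have a2 : HasDerivAt (fun v : ℝ => Real.exp (k * v)) (Real.exp (k * v) * k) v := by
      simpa using ((hasDerivAt_id v).const_mul k).exp
    refine (a1.mul a2).congr_deriv ?_
    have : Real.sin v = Real.sin (v + δ) * Real.cos δ - Real.cos (v + δ) * Real.sin δ := by
      rw [← Real.sin_sub]; ring_nf
    rw [this, hk]
    field_simp
    ring
  have hanti : AntitoneOn (fun v : ℝ => Real.cos (v + δ) * Real.exp (k * v)) (Icc 0 Real.pi) := by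
    apply antitoneOn_of_deriv_nonpos (convex_Icc _ _)
    · exact fun v _ => (hder v).continuousAt.continuousWithinAt
    · exact fun v _ => (hder v).differentiableAt.differentiableWithinAt
    · intro v hv
      rw [interior_Icc] at hv
      rw [(hder v).deriv]
      have : 0 ≤ Real.sin v := Real.sin_nonneg_of_nonneg_of_le_pi hv.1.le hv.2.le
      have h3 : 0 ≤ Real.sin v / Real.cos δ * Real.exp (k * v) := by positivity
      rw [neg_div, neg_mul]; linarith
  have h := hanti (left_mem_Icc.2 Real.pi_pos.le) ⟨hu, hu'⟩ hu
  simp only [zero_add, mul_zero, Real.exp_zero, mul_one] at h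
  rw [Real.exp_neg, ← div_eq_mul_inv, le_div_iff₀ (Real.exp_pos _)]
  exact h

lemma mlf_pos {α : ℝ} (h1 : 1 < α) (h2 : α ≤ 4 / 3) (t : ℝ) (ht : 0 < t) : 0 < mlf α t := by
  rw [mlf_rep h1 h2 t ht]
  have hα : 0 < α := by linarith
  have hpi := Real.pi_pos
  have hpi3 := Real.pi_gt_three
  have hpi4 := Real.pi_lt_d2
  have hA0 := mlA_zero h1 h2
  have hlow := mlA_lower h1 h2
  set δ : ℝ := Real.pi - Real.pi / α with hδ
  have hαδ : α * (Real.pi - δ) = Real.pi := by rw [hδ]; field_simp; ring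
  have hδ0 : 0 < δ := by
    rw [hδ, sub_pos, div_lt_iff₀ hα]; nlinarith
  have hδ1 : δ ≤ Real.pi / 4 := by
    have : 3 / 4 * Real.pi ≤ Real.pi / α := by rw [le_div_iff₀ hα]; nlinarith
    rw [hδ]; linarith
  have hc7 : (0.7 : ℝ) < Real.cos δ := by
    have h3 : Real.cos (Real.pi / 4) ≤ Real.cos δ :=
      Real.cos_le_cos_of_nonneg_of_le_pi hδ0.le (by linarith) hδ1
    rw [Real.cos_pi_div_four] at h3
    have : (1.41 : ℝ) < √2 := by
      rw [Real.lt_sqrt (by norm_num)]; norm_num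
    linarith
  have hs0 : 0 < Real.sin δ := Real.sin_pos_of_pos_of_lt_pi hδ0 (by linarith)
  have hsd : Real.sin δ ≤ δ := Real.sin_le hδ0.le
  have hsc := Real.sin_sq_add_cos_sq δ
  have hs2 : Real.sin δ ^ 2 ≤ 1 / 2 := by
    have h3 : Real.cos (Real.pi / 4) ≤ Real.cos δ :=
      Real.cos_le_cos_of_nonneg_of_le_pi hδ0.le (by linarith) hδ1
    rw [Real.cos_pi_div_four] at h3
    have h4 : √2 ^ 2 = 2 := Real.sq_sqrt (by norm_num)
    have h5 : 0 ≤ √2 := Real.sqrt_nonneg 2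
    nlinarith
  set c := Real.cos δ with hc
  set ω := Real.sin δ with hω
  have hc0 : 0 < c := by linarith
  set m := (1 - α / 2) / c with hm
  have hm' : m * mlA α 0 = 2 / α - 1 := by
    rw [hA0, hm]; field_simp
  have hA := hlow m t ht.le hm'
  rw [hA0] at hA
  refine sub_pos.2 (lt_of_lt_of_le ?_ hA)
  have hB : mlB α t = 2 / α * (Real.exp (-(c * t)) * Real.cos (ω * t + δ)) := by
    unfold mlB; rw [← hδ]; ring
  rw [hB, mul_assoc]
  apply mul_lt_mul_of_pos_left _ (by positivity)
  rcases le_or_gt (ω * t) Real.pi with hcase | hcase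
  · have h3 := ml_cos_exp (δ := δ) hc0 (ω * t) (by positivity) hcase
    calc Real.exp (-(c * t)) * Real.cos (ω * t + δ)
        ≤ Real.exp (-(c * t)) * (c * Real.exp (-(ω / c * (ω * t)))) := by gcongr
      _ = c * Real.exp (-(t / c)) := by
        rw [mul_left_comm, ← Real.exp_add]
        congr 2
        field_simp
        linarith
      _ < c * Real.exp (-(m * t)) := by
        apply mul_lt_mul_of_pos_left _ hc0
        apply Real.exp_lt_exp.2
        rw [hm]
        have : 0 < α / 2 * t / c := by positivity
        have e : (1 - α / 2) / c * t = t / c - α / 2 * t / c := by ring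
        rw [e]; linarith
  · have ht4 : 4 < t := by
      have : ω < 0.75 := by nlinarith
      nlinarith
    have hgap : 0.09 ≤ α / 2 - ω ^ 2 := by
      rcases le_or_gt (ω ^ 2) 0.4 with hh | hh
      · linarith
      · have : 0.62 < ω := by nlinarith
        have h6 : 0.62 < δ := by linarith
        nlinarith
    have hy : 1 / c < Real.exp ((c - m) * t) := by
      have := Real.add_one_le_exp ((c - m) * t)
      refine lt_of_lt_of_le ?_ this
      rw [div_lt_iff₀ hc0]
      have e : ((c - m) * t + 1) * c = t * (α / 2 - ω ^ 2) + c := by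
        rw [hm]; field_simp
        linear_combination 2 * t * hsc
      rw [e]
      nlinarith
    calc Real.exp (-(c * t)) * Real.cos (ω * t + δ) ≤ Real.exp (-(c * t)) * 1 := by
          gcongr; exact Real.cos_le_one _
      _ = c * (1 / c) * Real.exp (-(c * t)) := by field_simp
      _ < c * Real.exp ((c - m) * t) * Real.exp (-(c * t)) := by gcongr
      _ = c * Real.exp (-(m * t)) := by
        rw [mul_assoc, ← Real.exp_add]; ring_nf

lemma mlA_large {α : ℝ} (h1 : 1 < α) (h2 : α ≤ 4 / 3) : ∃ K > 0, ∀ t : ℝ, 1 ≤ t →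
    K * t ^ (1 - α) ≤ mlA α t := by
  have hs := ml_sin_neg h1 h2
  have hpi := Real.pi_pos
  set k0 := (-Real.sin (α * Real.pi) / Real.pi) / 4 with hk0
  have hk0p : 0 < k0 := by
    have : 0 < -Real.sin (α * Real.pi) := by linarith
    positivity
  refine ⟨Real.exp (-1) * (k0 * Real.exp (-(α - 1))), by positivity, fun t ht => ?_⟩
  have ht0 : 0 < t := by linarith
  have hl : 0 ≤ Real.log t := Real.log_nonneg ht
  have hmk : ∀ x : ℝ, x ≤ 0 → k0 * Real.exp ((α - 1) * x) ≤ mlk α x := by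
    intro x hx
    obtain ⟨c, hc, hden⟩ := mlk_den h1 h2
    have hd := hden x
    have hy : Real.exp (α * x) ≤ 1 := Real.exp_le_one_iff.2 (by nlinarith)
    have hy0 := Real.exp_pos (α * x)
    have hcos := Real.cos_le_one (α * Real.pi)
    unfold mlk
    rw [le_div_iff₀ (lt_of_lt_of_le (by positivity) hd)]
    have hb : Real.exp (α * x) ^ 2 + 2 * Real.cos (α * Real.pi) * Real.exp (α * x) + 1 ≤ 4 := by nlinarith
    have h0 : 0 ≤ k0 * Real.exp ((α - 1) * x) := by positivity
    calc _ ≤ k0 * Real.exp ((α - 1) * x) * 4 := by gcongr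
      _ = _ := by rw [hk0]; ring
  have hI := mlA_int h1 h2 t ht0.le
  have hset : ∫ x in Icc (-Real.log t - 1) (-Real.log t), Real.exp (-(t * Real.exp x)) * mlk α x ≤ mlA α t := by
    apply setIntegral_le_integral hI
    exact ae_of_all _ fun x => mul_nonneg (Real.exp_pos _).le (mlk_pos h1 h2 x).le
  refine le_trans ?_ hset
  have hconst : ∫ x in Icc (-Real.log t - 1) (-Real.log t),
      (Real.exp (-1) * (k0 * Real.exp (-(α - 1))) * t ^ (1 - α)) =
      Real.exp (-1) * (k0 * Real.exp (-(α - 1))) * t ^ (1 - α) := by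
    rw [setIntegral_const]
    simp
  rw [← hconst]
  apply setIntegral_mono_on _ hI.integrableOn measurableSet_Icc
  · intro x hx
    have e1 : Real.exp (-1) ≤ Real.exp (-(t * Real.exp x)) := by
      apply Real.exp_le_exp.2
      have : Real.exp x ≤ Real.exp (-Real.log t) := Real.exp_le_exp.2 hx.2
      rw [Real.exp_neg, Real.exp_log ht0] at this
      have := mul_le_mul_of_nonneg_left this ht0.le
      rw [mul_inv_cancel₀ ht0.ne'] at this
      linarith
    have e2 := hmk x (by linarith [hx.2])
    have e3 : Real.exp (-(α - 1)) * t ^ (1 - α) ≤ Real.exp ((α - 1) * x) := by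
      rw [Real.rpow_def_of_pos ht0, ← Real.exp_add]
      apply Real.exp_le_exp.2
      nlinarith [hx.1]
    calc _ = Real.exp (-1) * (k0 * (Real.exp (-(α - 1)) * t ^ (1 - α))) := by ring
      _ ≤ Real.exp (-(t * Real.exp x)) * (k0 * Real.exp ((α - 1) * x)) := by gcongr
      _ ≤ _ := by gcongr
  · exact integrableOn_const (by simp)

lemma mlE_large {α : ℝ} (h1 : 1 < α) (h2 : α ≤ 4 / 3) : ∃ K > 0, ∃ T > 0, ∀ t : ℝ, T ≤ t →
    K ≤ t ^ α * mlE α (-(t ^ α)) := by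
  obtain ⟨K, hK, hA⟩ := mlA_large h1 h2
  have hα : 0 < α := by linarith
  have hpi := Real.pi_pos
  have hc : 0 < Real.cos (Real.pi - Real.pi / α) := by
    apply Real.cos_pos_of_mem_Ioo
    have h3 : 3 / 4 * Real.pi ≤ Real.pi / α := by rw [le_div_iff₀ hα]; nlinarith
    have h4 : Real.pi / α ≤ Real.pi := by rw [div_le_iff₀ hα]; nlinarith
    constructor <;> linarith
  have hlim := (tendsto_rpow_mul_exp_neg_mul_atTop_nhds_zero α _ hc).const_mul (2 / α)
  rw [mul_zero] at hlim
  have hev := (hlim.eventually (gt_mem_nhds (half_pos hK))).and (eventually_ge_atTop 1)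
  obtain ⟨T, hT⟩ := eventually_atTop.1 hev
  refine ⟨K / 2, half_pos hK, max T 1, by positivity, fun t ht => ?_⟩
  obtain ⟨hb, ht1⟩ := hT t (le_trans (le_max_left _ _) ht)
  have ht0 : 0 < t := by linarith
  have hrep := mlf_rep h1 h2 t ht0
  rw [mlf_eq t ht0] at hrep
  have hA' := hA t ht1
  have htα : 0 < t ^ α := by positivity
  have hB : mlB α t ≤ 2 / α * Real.exp (-Real.cos (Real.pi - Real.pi / α) * t) := by
    unfold mlB
    rw [neg_mul]
    exact mul_le_of_le_one_right (by positivity) (Real.cos_le_one _)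
  have hE : t ^ α * (t * mlE α (-(t ^ α))) ≥ K * t - K / 2 := by
    rw [hrep]
    have e1 : t ^ α * (K * t ^ (1 - α)) = K * t := by
      rw [mul_left_comm, ← Real.rpow_add ht0]; simp
    have e2 := mul_le_mul_of_nonneg_left hA' htα.le
    have e3 := mul_le_mul_of_nonneg_left hB htα.le
    nlinarith
  have : t * (K / 2) ≤ t * (t ^ α * mlE α (-(t ^ α))) := by nlinarith
  exact le_of_mul_le_mul_left this ht0

lemma mlE_final {α : ℝ} (h1 : 1 < α) (h2 : α ≤ 4 / 3) : ∃ C : ℝ, 0 < C ∧ ∀ x : ℝ, 0 < x →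
    C ≤ (1 + x) * mlE α (-x) := by
  obtain ⟨K, hK, T, hT, hL⟩ := mlE_large h1 h2
  have hα : 0 < α := by linarith
  have hpow : ∀ x : ℝ, 0 < x → (x ^ (1 / α)) ^ α = x := by
    intro x hx
    rw [← Real.rpow_mul hx.le, one_div_mul_cancel hα.ne', Real.rpow_one]
  have hpos : ∀ x : ℝ, 0 ≤ x → 0 < mlE α (-x) := by
    intro x hx
    rcases hx.eq_or_lt with rfl | hx
    · rw [neg_zero, mlE_zero]; norm_num
    · have ht : 0 < x ^ (1 / α) := by positivity
      have := mlf_pos h1 h2 _ ht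
      rw [mlf_eq _ ht, hpow x hx] at this
      exact pos_of_mul_pos_right this ht.le
  have hcont : Continuous (fun x : ℝ => (1 + x) * mlE α (-x)) := by
    have := mlE_cont h1
    fun_prop
  obtain ⟨x0, hx0, hmin⟩ := (isCompact_Icc (a := (0 : ℝ)) (b := T ^ α)).exists_isMinOn
    (nonempty_Icc.2 (by positivity)) hcont.continuousOn
  refine ⟨min K ((1 + x0) * mlE α (-x0)), lt_min hK ?_, fun x hx => ?_⟩
  · have := hpos x0 hx0.1
    have := hx0.1
    positivity
  · rcases le_or_gt x (T ^ α) with h | h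
    · exact (min_le_right _ _).trans (hmin ⟨hx.le, h⟩)
    · refine (min_le_left _ _).trans ?_
      have h3 : T ≤ x ^ (1 / α) := by
        have := Real.rpow_le_rpow (by positivity) h.le (show 0 ≤ 1 / α by positivity)
        rwa [← Real.rpow_mul hT.le, mul_one_div_cancel hα.ne', Real.rpow_one] at this
      have h4 := hL _ h3
      rw [hpow x hx] at h4
      have := hpos x hx.le
      linarith

end MLHelpers

theorem mittagLeffler_lower_bound (α : ℝ) (hα1 : 1 < α) (hα2 : α ≤ 4 / 3) :
    ∃ C : ℝ, 0 < C ∧ ∀ lam t : ℝ, 0 < lam → 0 < t →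
      C / (1 + lam * t ^ α) ≤ mittagLeffler α 2 (-(lam * t ^ α)) := by
  obtain ⟨C, hC, h⟩ := mlE_final hα1 hα2
  refine ⟨C, hC, fun lam t hl ht => ?_⟩
  have hx : 0 < lam * t ^ α := mul_pos hl (Real.rpow_pos_of_pos ht α)
  have h3 : mittagLeffler α 2 (-(lam * t ^ α)) = mlE α (-(lam * t ^ α)) := rfl
  rw [h3, div_le_iff₀ (by linarith), mul_comm]
  exact h _ hx
end

section
/- Let 1 < α ≤ 4/3. Then there exists a constant C > 0 depending only on α such that for every λ > 0 and every T > 0, C^{-1} / (1 + λ T^α) ≤ E_{α,2}(−λ T^α) ≤ C / (1 + λ T^α). -/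
open MeasureTheory Set Filter Topology

def CMd : ℕ → (ℝ → ℝ) → Prop
  | 0, f => ∀ s > 0, 0 ≤ f s
  | n + 1, f => (∀ s > 0, 0 ≤ f s) ∧ ∃ g : ℝ → ℝ, (∀ s > 0, HasDerivAt f (-(g s)) s) ∧ CMd n g

lemma CMd.nonneg {n : ℕ} {f : ℝ → ℝ} (h : CMd n f) : ∀ s > 0, 0 ≤ f s := by
  cases n with
  | zero => exact h
  | succ n => exact h.1

lemma CMd.pred {n : ℕ} : ∀ {f : ℝ → ℝ}, CMd (n + 1) f → CMd n f := by
  induction n with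
  | zero => intro f h; exact h.1
  | succ n ih =>
    rintro f ⟨h0, g, hg, h⟩
    exact ⟨h0, g, hg, ih h⟩

lemma CMd.congr {n : ℕ} {f g : ℝ → ℝ} (h : CMd n f) (hfg : ∀ s > 0, f s = g s) : CMd n g := by
  cases n with
  | zero => intro s hs; rw [← hfg s hs]; exact h s hs
  | succ n =>
    obtain ⟨h0, k, hk, h⟩ := h
    refine ⟨fun s hs => by rw [← hfg s hs]; exact h0 s hs, k, fun s hs => ?_, h⟩
    refine (hk s hs).congr_of_eventuallyEq ?_
    filter_upwards [lt_mem_nhds hs] with y hy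
    exact (hfg y hy).symm

lemma CMd.add {n : ℕ} : ∀ {f g : ℝ → ℝ}, CMd n f → CMd n g → CMd n (fun s => f s + g s) := by
  induction n with
  | zero => intro f g hf hg s hs; exact add_nonneg (hf s hs) (hg s hs)
  | succ n ih =>
    rintro f g ⟨hf0, f', hf, hf1⟩ ⟨hg0, g', hg, hg1⟩
    refine ⟨fun s hs => add_nonneg (hf0 s hs) (hg0 s hs), fun s => f' s + g' s, fun s hs => ?_,
      ih hf1 hg1⟩
    exact ((hf s hs).add (hg s hs)).congr_deriv (by ring)

lemma CMd.mul {n : ℕ} : ∀ {f g : ℝ → ℝ}, CMd n f → CMd n g → CMd n (fun s => f s * g s) := by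
  induction n with
  | zero => intro f g hf hg s hs; exact mul_nonneg (hf s hs) (hg s hs)
  | succ n ih =>
    rintro f g hF hG
    have hF' := hF.pred
    have hG' := hG.pred
    obtain ⟨hf0, f', hf, hf1⟩ := hF
    obtain ⟨hg0, g', hg, hg1⟩ := hG
    refine ⟨fun s hs => mul_nonneg (hf0 s hs) (hg0 s hs), fun s => f' s * g s + f s * g' s,
      fun s hs => ?_, (ih hf1 hG').add (ih hF' hg1)⟩
    exact ((hf s hs).mul (hg s hs)).congr_deriv (by ring)

lemma CMd.const {n : ℕ} : ∀ {c : ℝ}, 0 ≤ c → CMd n (fun _ => c) := by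
  induction n with
  | zero => intro c hc s _; exact hc
  | succ n ih =>
    intro c hc
    refine ⟨fun _ _ => hc, fun _ => 0, fun s _ => ?_, ih le_rfl⟩
    simpa using hasDerivAt_const s c

lemma CMd.rpow {n : ℕ} : ∀ {p : ℝ}, p ≤ 0 → CMd n (fun s => s ^ p) := by
  induction n with
  | zero => intro p hp s hs; positivity
  | succ n ih =>
    intro p hp
    refine ⟨fun s hs => by positivity, fun s => (-p) * s ^ (p - 1), fun s hs => ?_,
      (CMd.const (by linarith)).mul (ih (by linarith))⟩
    convert Real.hasDerivAt_rpow_const (Or.inl hs.ne') using 1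
    ring

lemma CMd.exp {γ x : ℝ} (hγ0 : 0 ≤ γ) (hγ : γ ≤ 1) (hx : 0 ≤ x) {n : ℕ} :
    CMd n (fun s => Real.exp (-(x * s ^ γ))) := by
  induction n with
  | zero => intro s hs; positivity
  | succ n ih =>
    refine ⟨fun s hs => by positivity,
      fun s => (x * γ) * s ^ (γ - 1) * Real.exp (-(x * s ^ γ)), fun s hs => ?_,
      ((CMd.const (by positivity)).mul (CMd.rpow (by linarith))).mul ih⟩
    have h := (((Real.hasDerivAt_rpow_const (p := γ) (Or.inl hs.ne')).const_mul x).fun_neg).exp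
    exact h.congr_deriv (by ring)

def Dop (f : ℝ → ℝ) : ℝ → ℝ := fun s => f s - f (s + 1)

lemma CMd.dop {n : ℕ} : ∀ {f : ℝ → ℝ}, CMd (n + 1) f → CMd n (Dop f) := by
  have key : ∀ {n : ℕ} {f : ℝ → ℝ}, CMd (n + 1) f → ∀ s > 0, 0 ≤ Dop f s := by
    rintro n f ⟨h0, g, hg, h⟩ s hs
    have : AntitoneOn f (Ioi 0) := by
      apply antitoneOn_of_deriv_nonpos (convex_Ioi 0)
      · intro y hy; exact (hg y hy).continuousAt.continuousWithinAt
      · intro y hy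
        rw [interior_Ioi] at hy
        exact (hg y hy).differentiableAt.differentiableWithinAt
      · intro y hy
        rw [interior_Ioi] at hy
        rw [(hg y hy).deriv]
        linarith [h.nonneg y hy]
    have := this (a := s) (b := s + 1) hs (by simp; linarith) (by linarith)
    unfold Dop; linarith
  induction n with
  | zero => intro f h; exact key h
  | succ n ih =>
    intro f h
    refine ⟨key h, ?_⟩
    obtain ⟨h0, g, hg, h⟩ := h
    refine ⟨Dop g, fun s hs => ?_, ih h⟩
    have h1 := (hg (s + 1) (by linarith)).comp_add_const s 1
    exact ((hg s hs).sub h1).congr_deriv (by unfold Dop; ring)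

lemma CMd.dop_iter {n : ℕ} : ∀ {f : ℝ → ℝ}, CMd n f → ∀ s > 0, 0 ≤ Dop^[n] f s := by
  induction n with
  | zero => intro f h; exact h
  | succ n ih => intro f h; rw [Function.iterate_succ_apply]; exact ih h.dop

lemma dop_integral {μ : Measure ℝ} {n : ℕ} : ∀ {φ : ℝ → ℝ → ℝ} {G : ℝ → ℝ},
    (∀ s ≥ 2, Integrable (fun x => φ x s) μ) → (∀ s ≥ 2, G s = ∫ x, φ x s ∂μ) →
    ∀ s ≥ 2, Dop^[n] G s = ∫ x, Dop^[n] (φ x) s ∂μ := by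
  induction n with
  | zero => intro φ G _ hG; exact hG
  | succ n ih =>
    intro φ G hφ hG
    simp only [Function.iterate_succ_apply]
    refine ih (φ := fun x => Dop (φ x)) ?_ ?_
    · intro s hs
      exact (hφ s hs).sub (hφ (s + 1) (by linarith))
    · intro s hs
      unfold Dop
      rw [integral_sub (hφ s hs) (hφ (s + 1) (by linarith)), hG s hs, hG (s + 1) (by linarith)]

lemma dop_exp (t v : ℝ) (n : ℕ) : ∀ s, Dop^[n] (fun s => Real.exp (-(s * t)) * v) s
    = Real.exp (-(s * t)) * ((1 - Real.exp (-t)) ^ n * v) := by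
  induction n generalizing v with
  | zero => intro s; simp
  | succ n ih =>
    intro s
    rw [Function.iterate_succ_apply]
    have : Dop (fun s => Real.exp (-(s * t)) * v)
        = fun s => Real.exp (-(s * t)) * ((1 - Real.exp (-t)) * v) := by
      funext s
      have : Real.exp (-((s + 1) * t)) = Real.exp (-(s * t)) * Real.exp (-t) := by
        rw [← Real.exp_add]; ring_nf
      unfold Dop; simp only []; rw [this]; ring
    rw [this, ih]; ring

lemma pos_of_moments {V : ℝ → ℝ} (hVc : ContinuousOn V (Ioi 0))
    (hVi : IntegrableOn (fun t => Real.exp (-(2 * t)) * V t) (Ioi 0))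
    (hm : ∀ n k : ℕ, 0 ≤ ∫ t in Ioi (0:ℝ), Real.exp (-((2 + k) * t)) *
      ((1 - Real.exp (-t)) ^ n * V t)) : ∀ t > 0, 0 ≤ V t := by
  set W : ℝ → ℝ := fun t => Real.exp (-(2 * t)) * V t with hW
  -- the substitution point
  let z : ℝ → unitInterval := fun t => ⟨Real.exp (-|t|), (Real.exp_pos _).le, by
    rw [Real.exp_le_one_iff]; simp⟩
  have hzc : Continuous z := by
    apply Continuous.subtype_mk; fun_prop
  have hint : ∀ f : C(unitInterval, ℝ), IntegrableOn (fun t => f (z t) * W t) (Ioi 0) := by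
    intro f
    refine hVi.bdd_mul (c := ‖f‖) (f.continuous.comp hzc).aestronglyMeasurable ?_
    exact Eventually.of_forall fun t => f.norm_coe_le_norm _
  have hbern : ∀ n k : ℕ, 0 ≤ ∫ t in Ioi (0:ℝ), bernstein n k (z t) * W t := by
    intro n k
    have h := mul_nonneg (Nat.cast_nonneg (α := ℝ) (n.choose k)) (hm (n - k) k)
    rw [← integral_const_mul] at h
    refine h.trans_eq (setIntegral_congr_fun measurableSet_Ioi fun t ht => ?_)
    have ht : 0 < t := ht
    simp only [bernstein_apply, hW, z, abs_of_pos ht]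
    have : Real.exp (-((2 + k) * t)) = Real.exp (-(2 * t)) * Real.exp (-t) ^ k := by
      rw [← Real.exp_nat_mul, ← Real.exp_add]; ring_nf
    rw [this]; ring
  have hpos : ∀ f : C(unitInterval, ℝ), (∀ y, 0 ≤ f y) →
      0 ≤ ∫ t in Ioi (0:ℝ), f (z t) * W t := by
    intro f hf
    have hlim : Tendsto (fun n => ∫ t in Ioi (0:ℝ), bernsteinApproximation n f (z t) * W t) atTop
        (𝓝 (∫ t in Ioi (0:ℝ), f (z t) * W t)) := by
      have hb := bernsteinApproximation_uniform f
      rw [tendsto_iff_norm_sub_tendsto_zero] at hb ⊢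
      refine squeeze_zero (fun _ => norm_nonneg _) (fun n => ?_)
        (g := fun n => ‖bernsteinApproximation n f - f‖ * ∫ t in Ioi (0:ℝ), ‖W t‖) ?_
      · rw [← integral_sub (hint _) (hint _), ← integral_const_mul]
        refine norm_integral_le_of_norm_le (hVi.norm.const_mul _) (Eventually.of_forall fun t => ?_)
        rw [← sub_mul, norm_mul]
        gcongr
        exact (bernsteinApproximation n f - f).norm_coe_le_norm (z t)
      · simpa using hb.mul_const (∫ t in Ioi (0:ℝ), ‖W t‖)
    refine ge_of_tendsto' hlim fun n => ?_
    have : ∀ t, bernsteinApproximation n f (z t) * W t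
        = ∑ k : Fin (n + 1), f (bernstein.z k) * (bernstein n k (z t) * W t) := by
      intro t
      rw [bernsteinApproximation.apply, Finset.sum_mul]
      refine Finset.sum_congr rfl fun k _ => ?_
      rw [smul_eq_mul]; ring
    simp only [this]
    rw [integral_finsetSum _ fun k _ => (hint _).const_mul _]
    refine Finset.sum_nonneg fun k _ => ?_
    rw [integral_const_mul]
    exact mul_nonneg (hf _) (hbern _ _)
  by_contra! hcon
  obtain ⟨t0, ht0, hneg⟩ := hcon
  have hev : ∀ᶠ t in 𝓝 t0, V t < 0 :=
    (hVc.continuousAt (Ioi_mem_nhds ht0)).eventually_lt continuousAt_const hneg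
  obtain ⟨ε, hε, hball⟩ := Metric.eventually_nhds_iff.1 (hev.and (lt_mem_nhds ht0))
  -- bump in the variable y = exp(-t)
  have hdist : ∃ δ > 0, ∀ t > 0, |Real.exp (-t) - Real.exp (-t0)| < δ → |t - t0| < ε := by
    have hc : ContinuousAt (fun y => -Real.log y) (Real.exp (-t0)) :=
      (Real.continuousAt_log (Real.exp_pos _).ne').neg
    obtain ⟨δ, hδ, h⟩ := Metric.continuousAt_iff.1 hc ε hε
    refine ⟨δ, hδ, fun t _ h1 => ?_⟩
    have := h (x := Real.exp (-t)) h1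
    simpa [Real.dist_eq] using this
  obtain ⟨δ, hδ, hδ2⟩ := hdist
  let f : C(unitInterval, ℝ) := ⟨fun y => max (δ - |(y:ℝ) - Real.exp (-t0)|) 0, by fun_prop⟩
  have h1 := hpos f (fun y => le_max_right _ _)
  have hle : ∀ t ∈ Ioi (0:ℝ), f (z t) * W t ≤ 0 := by
    intro t ht
    have ht : 0 < t := ht
    by_cases h : |Real.exp (-t) - Real.exp (-t0)| < δ
    · have := (hball (hδ2 t ht h)).1
      have hf : 0 ≤ f (z t) := le_max_right _ _
      have : W t ≤ 0 := mul_nonpos_of_nonneg_of_nonpos (Real.exp_pos _).le this.le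
      exact mul_nonpos_of_nonneg_of_nonpos hf this
    · have : f (z t) = 0 := by
        simp only [f, z, ContinuousMap.coe_mk, abs_of_pos ht]
        exact max_eq_right (by linarith)
      rw [this, zero_mul]
  have h2 : ∫ t in Ioi (0:ℝ), f (z t) * W t = 0 :=
    le_antisymm (setIntegral_nonpos measurableSet_Ioi hle) h1
  have h3 : 0 < ∫ t in Ioi (0:ℝ), -(f (z t) * W t) := by
    rw [setIntegral_pos_iff_support_of_nonneg_ae]
    · have hopen : IsOpen {t : ℝ | 0 < t ∧ |t - t0| < ε ∧ |Real.exp (-t) - Real.exp (-t0)| < δ} := by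
        have o1 : IsOpen {t : ℝ | 0 < t} := isOpen_lt (by fun_prop) (by fun_prop)
        have o2 : IsOpen {t : ℝ | |t - t0| < ε} := isOpen_lt (by fun_prop) (by fun_prop)
        have o3 : IsOpen {t : ℝ | |Real.exp (-t) - Real.exp (-t0)| < δ} :=
          isOpen_lt (by fun_prop) (by fun_prop)
        exact o1.inter (o2.inter o3)
      refine (hopen.measure_pos volume ⟨t0, ht0, by simpa using hε, by simpa using hδ⟩).trans_le
        (measure_mono ?_)
      rintro t ⟨ht, hte, htd⟩
      refine ⟨?_, ht⟩
      have hV := (hball (y := t) hte).1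
      have hf : 0 < f (z t) := by
        simp only [f, z, ContinuousMap.coe_mk, abs_of_pos ht]
        exact lt_max_of_lt_left (by linarith)
      have hWn : W t < 0 := mul_neg_of_pos_of_neg (Real.exp_pos _) hV
      simp only [Function.mem_support]
      have := mul_neg_of_pos_of_neg hf hWn
      intro h; linarith
    · filter_upwards [ae_restrict_mem measurableSet_Ioi] with t ht
      simpa using hle t ht
    · exact (hint f).neg
  rw [integral_neg, h2] at h3
  simp at h3

lemma main_pos {V : ℝ → ℝ} (hVc : ContinuousOn V (Ioi 0))
    (hVi : ∀ s ≥ (2:ℝ), IntegrableOn (fun t => Real.exp (-(s * t)) * V t) (Ioi 0))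
    (φ : ℝ → ℝ → ℝ) (hφ : ∀ x > 0, ∀ n, CMd n (φ x))
    (hφi : ∀ s ≥ 2, IntegrableOn (fun x => φ x s) (Ioi 0))
    (hL : ∀ s ≥ (2:ℝ), ∫ t in Ioi (0:ℝ), Real.exp (-(s * t)) * V t = ∫ x in Ioi (0:ℝ), φ x s) :
    ∀ t > 0, 0 ≤ V t := by
  refine pos_of_moments hVc (hVi 2 le_rfl) fun n k => ?_
  have hk : (2:ℝ) + k ≥ 2 := by have := Nat.cast_nonneg (α := ℝ) k; linarith
  have h1 := dop_integral (n := n) (μ := volume.restrict (Ioi 0))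
    (φ := fun t s => Real.exp (-(s * t)) * V t) hVi (G := fun s => ∫ x in Ioi (0:ℝ), φ x s)
    (fun s hs => (hL s hs).symm) (2 + k) hk
  have h2 := dop_integral (n := n) (μ := volume.restrict (Ioi 0)) hφi (fun s _ => rfl) (2 + k) hk
  simp only [dop_exp] at h1
  rw [← h1, h2]
  refine setIntegral_nonneg measurableSet_Ioi fun x hx => ?_
  exact (hφ x hx n).dop_iter _ (by linarith)


lemma tendsto_pow_exp (n : ℕ) {w : ℝ} (hw : 0 < w) :
    Tendsto (fun x : ℝ => x ^ n * Real.exp (-(x * w))) atTop (𝓝 0) := by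
  have := tendsto_rpow_mul_exp_neg_mul_atTop_nhds_zero n w hw
  refine this.congr fun x => ?_
  rw [Real.rpow_natCast]; ring_nf

lemma integrable_pow_exp (n : ℕ) {w : ℝ} (hw : 0 < w) :
    IntegrableOn (fun x : ℝ => x ^ n * Real.exp (-(x * w))) (Ioi 0) := by
  have hn : (0:ℝ) < n + 1 := by positivity
  have h := Real.integral_rpow_mul_exp_neg_mul_Ioi (a := n + 1) (r := w) hn hw
  have h2 : IntegrableOn (fun t : ℝ => t ^ ((n:ℝ) + 1 - 1) * Real.exp (-(w * t))) (Ioi 0) := by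
    refine Integrable.of_integral_ne_zero ?_
    rw [h]
    have := Real.Gamma_pos_of_pos hn
    positivity
  refine h2.congr_fun (fun x _ => ?_) measurableSet_Ioi
  simp only [add_sub_cancel_right, Real.rpow_natCast]; ring_nf

lemma integral_pow_exp (n : ℕ) {w : ℝ} (hw : 0 < w) :
    ∫ x in Ioi (0:ℝ), x ^ n * Real.exp (-(x * w)) = n.factorial / w ^ (n + 1) := by
  have hn : (0:ℝ) < n + 1 := by positivity
  have h := Real.integral_rpow_mul_exp_neg_mul_Ioi (a := n + 1) (r := w) hn hw
  rw [Real.Gamma_nat_eq_factorial] at h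
  have h3 : (1 / w) ^ ((n:ℝ) + 1) = 1 / w ^ (n + 1) := by
    rw [← Nat.cast_succ, Real.rpow_natCast, one_div_pow]
  rw [h3] at h
  rw [div_eq_mul_one_div, mul_comm, ← h]
  refine setIntegral_congr_fun measurableSet_Ioi fun x _ => ?_
  simp only [add_sub_cancel_right, Real.rpow_natCast]; ring_nf

lemma integrable_bdd_pow_exp {b : ℝ → ℝ} (hb : Continuous b) (C : ℝ) (hC : ∀ x, |b x| ≤ C)
    (n : ℕ) {w : ℝ} (hw : 0 < w) :
    IntegrableOn (fun x : ℝ => b x * (x ^ n * Real.exp (-(x * w)))) (Ioi 0) :=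
  (integrable_pow_exp n hw).bdd_mul (c := C) hb.aestronglyMeasurable
    (Eventually.of_forall fun t => hC t)

lemma gen_osc {w : ℝ} (hw : 0 < w) (p0 p1 p2 q0 q1 q2 : ℝ) {f : ℝ → ℝ}
    (hf : ∀ x, f x = ((p1 + 2 * p2 * x + (q0 + q1 * x + q2 * x ^ 2)
        - w * (p0 + p1 * x + p2 * x ^ 2)) * Real.cos x
      + (q1 + 2 * q2 * x - (p0 + p1 * x + p2 * x ^ 2)
        - w * (q0 + q1 * x + q2 * x ^ 2)) * Real.sin x) * Real.exp (-(x * w)))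
    (hi : IntegrableOn f (Ioi 0)) : ∫ x in Ioi (0:ℝ), f x = -p0 := by
  have hd : ∀ x ∈ Ici (0:ℝ), HasDerivAt (fun x => ((p0 + p1 * x + p2 * x ^ 2) * Real.cos x
      + (q0 + q1 * x + q2 * x ^ 2) * Real.sin x) * Real.exp (-(x * w))) (f x) x := by
    intro x _
    have h1 : ∀ a b c : ℝ, HasDerivAt (fun x => a + b * x + c * x ^ 2) (b + 2 * c * x) x := by
      intro a b c
      have := (((hasDerivAt_id x).const_mul b).const_add a).add ((hasDerivAt_pow 2 x).const_mul c)
      refine this.congr_deriv ?_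
      simp; ring
    have h2 : HasDerivAt (fun x => Real.exp (-(x * w))) (Real.exp (-(x * w)) * (-(1 * w))) x :=
      (((hasDerivAt_id x).mul_const w).fun_neg).exp
    have := (((h1 p0 p1 p2).mul (Real.hasDerivAt_cos x)).add
      ((h1 q0 q1 q2).mul (Real.hasDerivAt_sin x))).mul h2
    refine this.congr_deriv ?_
    rw [hf]; simp only [Pi.add_apply, Pi.mul_apply]; ring
  have ht : Tendsto (fun x => ((p0 + p1 * x + p2 * x ^ 2) * Real.cos x
      + (q0 + q1 * x + q2 * x ^ 2) * Real.sin x) * Real.exp (-(x * w))) atTop (𝓝 0) := by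
    have hb : ∀ a b c : ℝ, Tendsto (fun x : ℝ => (a + b * x + c * x ^ 2) * Real.exp (-(x * w)))
        atTop (𝓝 0) := by
      intro a b c
      have := (((tendsto_pow_exp 0 hw).const_mul a).add ((tendsto_pow_exp 1 hw).const_mul b)).add
        ((tendsto_pow_exp 2 hw).const_mul c)
      simp only [mul_zero, add_zero] at this
      refine this.congr fun x => ?_
      ring
    have hc : ∀ a b c : ℝ, ∀ g : ℝ → ℝ, (∀ x, |g x| ≤ 1) →
        Tendsto (fun x : ℝ => g x * ((a + b * x + c * x ^ 2) * Real.exp (-(x * w))))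
        atTop (𝓝 0) := by
      intro a b c g hg
      have hn := (hb a b c).norm
      rw [norm_zero] at hn
      refine squeeze_zero_norm (fun x => ?_) hn
      rw [norm_mul]
      exact mul_le_of_le_one_left (norm_nonneg _) (hg x)
    have := (hc p0 p1 p2 Real.cos Real.abs_cos_le_one).add
      (hc q0 q1 q2 Real.sin Real.abs_sin_le_one)
    rw [add_zero] at this
    refine this.congr fun x => ?_
    ring
  rw [integral_Ioi_of_hasDerivAt_of_tendsto' hd hi ht]
  simp

lemma int_cos0 {w : ℝ} (hw : 0 < w) :
    ∫ x in Ioi (0:ℝ), Real.cos x * (x ^ 0 * Real.exp (-(x * w))) = w / (w ^ 2 + 1) := by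
  have hD : w ^ 2 + 1 ≠ 0 := by positivity
  rw [gen_osc hw (-(w / (w ^ 2 + 1))) 0 0 (1 / (w ^ 2 + 1)) 0 0 ?_
    (integrable_bdd_pow_exp Real.continuous_cos 1 Real.abs_cos_le_one 0 hw)]
  · ring
  · intro x; field_simp; ring

lemma int_cos1 {w : ℝ} (hw : 0 < w) :
    ∫ x in Ioi (0:ℝ), Real.cos x * (x ^ 1 * Real.exp (-(x * w)))
      = (w ^ 2 - 1) / (w ^ 2 + 1) ^ 2 := by
  have hD : w ^ 2 + 1 ≠ 0 := by positivity
  rw [gen_osc hw (-((w ^ 2 - 1) / (w ^ 2 + 1) ^ 2)) (-(w / (w ^ 2 + 1))) 0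
    (2 * w / (w ^ 2 + 1) ^ 2) (1 / (w ^ 2 + 1)) 0 ?_
    (integrable_bdd_pow_exp Real.continuous_cos 1 Real.abs_cos_le_one 1 hw)]
  · ring
  · intro x; field_simp; ring

lemma int_sin0 {w : ℝ} (hw : 0 < w) :
    ∫ x in Ioi (0:ℝ), Real.sin x * (x ^ 0 * Real.exp (-(x * w))) = 1 / (w ^ 2 + 1) := by
  have hD : w ^ 2 + 1 ≠ 0 := by positivity
  rw [gen_osc hw (-(1 / (w ^ 2 + 1))) 0 0 (-(w / (w ^ 2 + 1))) 0 0 ?_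
    (integrable_bdd_pow_exp Real.continuous_sin 1 Real.abs_sin_le_one 0 hw)]
  · ring
  · intro x; field_simp; ring

lemma int_sin1 {w : ℝ} (hw : 0 < w) :
    ∫ x in Ioi (0:ℝ), Real.sin x * (x ^ 1 * Real.exp (-(x * w)))
      = 2 * w / (w ^ 2 + 1) ^ 2 := by
  have hD : w ^ 2 + 1 ≠ 0 := by positivity
  rw [gen_osc hw (-(2 * w / (w ^ 2 + 1) ^ 2)) (-(1 / (w ^ 2 + 1))) 0
    (-((w ^ 2 - 1) / (w ^ 2 + 1) ^ 2)) (-(w / (w ^ 2 + 1))) 0 ?_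
    (integrable_bdd_pow_exp Real.continuous_sin 1 Real.abs_sin_le_one 1 hw)]
  · ring
  · intro x; field_simp; ring

lemma int_sin2 {w : ℝ} (hw : 0 < w) :
    ∫ x in Ioi (0:ℝ), Real.sin x * (x ^ 2 * Real.exp (-(x * w)))
      = (6 * w ^ 2 - 2) / (w ^ 2 + 1) ^ 3 := by
  have hD : w ^ 2 + 1 ≠ 0 := by positivity
  rw [gen_osc hw (-(2 * (3 * w ^ 2 - 1) / (w ^ 2 + 1) ^ 3)) (-(2 * (2 * w) / (w ^ 2 + 1) ^ 2))
    (-(1 / (w ^ 2 + 1)))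
    (-(2 * (w ^ 3 - 3 * w) / (w ^ 2 + 1) ^ 3)) (-(2 * (w ^ 2 - 1) / (w ^ 2 + 1) ^ 2))
    (-(w / (w ^ 2 + 1))) ?_
    (integrable_bdd_pow_exp Real.continuous_sin 1 Real.abs_sin_le_one 2 hw)]
  · ring
  · intro x; field_simp; ring

/-- Laplace transform of a power. -/
lemma lap_pow {b s : ℝ} (hb : 0 < b) (hs : 0 < s) :
    IntegrableOn (fun t : ℝ => Real.exp (-(s * t)) * t ^ (b - 1)) (Ioi 0) ∧
    ∫ t in Ioi (0:ℝ), Real.exp (-(s * t)) * t ^ (b - 1) = (1 / s) ^ b * Real.Gamma b := by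
  have h := Real.integral_rpow_mul_exp_neg_mul_Ioi hb hs
  have e : (fun t : ℝ => Real.exp (-(s * t)) * t ^ (b - 1))
      = fun t => t ^ (b - 1) * Real.exp (-(s * t)) := by funext t; ring
  rw [e, h]
  refine ⟨Integrable.of_integral_ne_zero ?_, rfl⟩
  rw [h]
  have := Real.Gamma_pos_of_pos hb
  positivity

lemma integrable_tsum_aux {μ : Measure ℝ} {F : ℕ → ℝ → ℝ} (hF : ∀ i, Integrable (F i) μ)
    (hs : Summable fun i => ∫ a, ‖F i a‖ ∂μ)
    (hm : AEStronglyMeasurable (fun t => ∑' i, F i t) μ) :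
    Integrable (fun t => ∑' i, F i t) μ := by
  refine ⟨hm, ?_⟩
  have h1 : ∀ t, ‖∑' i, F i t‖ₑ ≤ ∑' i, ‖F i t‖ₑ := fun t => enorm_tsum_le_tsum_enorm
  have h2 : ∫⁻ t, ∑' i, ‖F i t‖ₑ ∂μ = ∑' i, ∫⁻ t, ‖F i t‖ₑ ∂μ :=
    lintegral_tsum fun i => (hF i).1.enorm
  have h3 : ∀ i, ∫⁻ t, ‖F i t‖ₑ ∂μ = ENNReal.ofReal (∫ a, ‖F i a‖ ∂μ) := fun i =>
    (ofReal_integral_norm_eq_lintegral_enorm (hF i)).symm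
  refine (lintegral_mono h1).trans_lt ?_
  rw [h2]; simp_rw [h3]
  rw [← ENNReal.ofReal_tsum_of_nonneg (fun i => integral_nonneg fun _ => norm_nonneg _) hs]
  exact ENNReal.ofReal_lt_top

lemma series_lap {α b s : ℝ} (hα : 1 < α) (hb : 0 < b) (hs : 2 ≤ s) {c : ℕ → ℝ}
    (hc : Summable fun k : ℕ => |c k| * Real.Gamma (α * k + b) * (1 / 2) ^ k)
    (hcont : ContinuousOn (fun t : ℝ => ∑' k, c k * (t ^ α) ^ k) (Ioi 0)) :
    IntegrableOn (fun t : ℝ => Real.exp (-(s * t)) * (t ^ (b - 1) * ∑' k, c k * (t ^ α) ^ k))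
      (Ioi 0) ∧
    ∫ t in Ioi (0:ℝ), Real.exp (-(s * t)) * (t ^ (b - 1) * ∑' k, c k * (t ^ α) ^ k)
      = (1 / s) ^ b * ∑' k : ℕ, c k * Real.Gamma (α * k + b) * ((1 / s) ^ α) ^ k := by
  have hs0 : 0 < s := by linarith
  have hbk : ∀ k : ℕ, 0 < α * k + b := fun k => by positivity
  set F : ℕ → ℝ → ℝ := fun k t => c k * (Real.exp (-(s * t)) * t ^ (α * k + b - 1)) with hFdef
  have hF : ∀ k, IntegrableOn (F k) (Ioi 0) := fun k => (lap_pow (hbk k) hs0).1.const_mul _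
  have hpow : ∀ k : ℕ, (1 / s) ^ (α * k + b) = ((1 / s) ^ α) ^ k * (1 / s) ^ b := by
    intro k
    rw [Real.rpow_add (by positivity), Real.rpow_mul (by positivity), Real.rpow_natCast]
  have hr : (1 / s) ^ α ≤ 1 / 2 := by
    calc (1 / s) ^ α ≤ (1 / s) ^ (1:ℝ) :=
          Real.rpow_le_rpow_of_exponent_ge (by positivity) (by rw [div_le_one hs0]; linarith) hα.le
      _ = 1 / s := Real.rpow_one _
      _ ≤ 1 / 2 := by gcongr
  have hsum : Summable fun k => ∫ t in Ioi (0:ℝ), ‖F k t‖ := by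
    have : ∀ k : ℕ, ∫ t in Ioi (0:ℝ), ‖F k t‖
        = |c k| * (((1 / s) ^ α) ^ k * (1 / s) ^ b * Real.Gamma (α * k + b)) := by
      intro k
      rw [← hpow, ← (lap_pow (hbk k) hs0).2, ← integral_const_mul]
      refine setIntegral_congr_fun measurableSet_Ioi fun t ht => ?_
      have ht : 0 < t := ht
      simp only [hFdef, norm_mul, Real.norm_eq_abs]
      rw [abs_of_pos (Real.exp_pos _), abs_of_nonneg (by positivity : 0 ≤ t ^ (α * k + b - 1))]
    simp_rw [this]
    refine Summable.of_nonneg_of_le (fun k => ?_) (fun k => ?_) (hc.mul_left ((1 / s) ^ b))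
    · have := Real.Gamma_pos_of_pos (hbk k); positivity
    · have hG := Real.Gamma_pos_of_pos (hbk k)
      have : ((1 / s) ^ α) ^ k ≤ (1 / 2) ^ k := by gcongr
      calc _ = |c k| * Real.Gamma (α * k + b) * (1 / s) ^ b * ((1 / s) ^ α) ^ k := by ring
        _ ≤ |c k| * Real.Gamma (α * k + b) * (1 / s) ^ b * (1 / 2) ^ k := by gcongr
        _ = _ := by ring
  have heq : ∀ t ∈ Ioi (0:ℝ), Real.exp (-(s * t)) * (t ^ (b - 1) * ∑' k, c k * (t ^ α) ^ k)
      = ∑' k, F k t := by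
    intro t ht
    have ht : 0 < t := ht
    rw [← mul_assoc, ← tsum_mul_left]
    refine tsum_congr fun k => ?_
    have : t ^ (α * k + b - 1) = (t ^ α) ^ k * t ^ (b - 1) := by
      rw [add_sub_assoc, Real.rpow_add ht, Real.rpow_mul ht.le, Real.rpow_natCast]
    rw [hFdef]; simp only []; rw [this]; ring
  have hcont2 : ContinuousOn (fun t : ℝ => Real.exp (-(s * t)) *
      (t ^ (b - 1) * ∑' k, c k * (t ^ α) ^ k)) (Ioi 0) := by
    refine ContinuousOn.mul (by fun_prop) (ContinuousOn.mul ?_ hcont)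
    exact ContinuousOn.rpow_const continuousOn_id fun t ht => Or.inl (ne_of_gt ht)
  have hcont3 : ContinuousOn (fun t => ∑' k, F k t) (Ioi 0) :=
    hcont2.congr fun t ht => (heq t ht).symm
  have hInt := integrable_tsum_aux hF hsum (hcont3.aestronglyMeasurable measurableSet_Ioi)
  refine ⟨IntegrableOn.congr_fun hInt (fun t ht => (heq t ht).symm) measurableSet_Ioi, ?_⟩
  rw [setIntegral_congr_fun measurableSet_Ioi heq,
    ← integral_tsum_of_summable_integral_norm hF hsum, ← tsum_mul_left]
  refine tsum_congr fun k => ?_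
  rw [hFdef]; simp only []
  rw [integral_const_mul, (lap_pow (hbk k) hs0).2, hpow]; ring


lemma hs_quad {r : ℝ} (hr : |r| < 1) (A B C : ℝ) :
    HasSum (fun k : ℕ => (A * (k:ℝ) ^ 2 + B * k + C) * r ^ k)
      (A * (2 * (1 / (1 - r)) ^ 3 - 3 * (1 / (1 - r)) ^ 2 + 1 / (1 - r))
        + B * ((1 / (1 - r)) ^ 2 - 1 / (1 - r)) + C * (1 / (1 - r))) := by
  have hr' : ‖r‖ < 1 := hr
  have h0 := hasSum_choose_mul_geometric_of_norm_lt_one 0 hr'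
  have h1 := hasSum_choose_mul_geometric_of_norm_lt_one 1 hr'
  have h2 := hasSum_choose_mul_geometric_of_norm_lt_one 2 hr'
  have h := ((h2.mul_left (2 * A)).add (h1.mul_left (B - 3 * A))).add (h0.mul_left (C - B + A))
  convert! h using 1
  · funext k
    have : (((k + 2).choose 2 : ℕ) : ℝ) = (k + 2) * (k + 1) / 2 := by
      rw [Nat.cast_choose_two]; push_cast; ring
    rw [this]
    simp; ring
  · have : 1 - r ≠ 0 := by
      have := (abs_lt.1 hr).2; intro h; linarith
    field_simp; ring

lemma cont_series {a : ℕ → ℝ} (ha : ∀ R : ℝ, 0 ≤ R → Summable fun k => |a k| * R ^ k) :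
    Continuous fun x : ℝ => ∑' k, a k * x ^ k := by
  rw [continuous_iff_continuousAt]
  intro x
  have h : ContinuousOn (fun x : ℝ => ∑' k, a k * x ^ k) (Metric.ball 0 (|x| + 1)) := by
    refine continuousOn_tsum (fun k => by fun_prop) (ha (|x| + 1) (by positivity)) ?_
    intro k y hy
    rw [norm_mul, norm_pow, Real.norm_eq_abs]
    have : ‖y‖ ≤ |x| + 1 := by simpa using (mem_ball_zero_iff.1 hy).le
    gcongr
  exact h.continuousAt (Metric.isOpen_ball.mem_nhds (by simp))

noncomputable def mlc (α : ℝ) (k : ℕ) : ℝ := (-1) ^ k / Real.Gamma (α * k + 2)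

lemma mlc_bound {α : ℝ} (hα : 1 < α) (k : ℕ) : |mlc α k| * (k + 3) ≤ 3 / k.factorial := by
  have h1 : (((k + 1).factorial : ℕ) : ℝ) ≤ Real.Gamma (α * k + 2) := by
    have : Real.Gamma ((k + 1 : ℕ) + 1) = (k + 1).factorial := Real.Gamma_nat_eq_factorial _
    rw [← this]
    have hk : (0:ℝ) ≤ k := Nat.cast_nonneg k
    apply Real.Gamma_strictMonoOn_Ici.monotoneOn
    · simp only [mem_Ici]; push_cast; linarith
    · simp only [mem_Ici]; nlinarith
    · push_cast; nlinarith
  have h0 : (0:ℝ) < (k + 1).factorial := by positivity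
  rw [mlc, abs_div, abs_pow, abs_neg, abs_one, one_pow, abs_of_pos (h0.trans_le h1)]
  calc 1 / Real.Gamma (α * k + 2) * (k + 3) ≤ 1 / ((k + 1).factorial : ℝ) * (k + 3) := by gcongr
    _ ≤ 3 / k.factorial := by
      rw [Nat.factorial_succ]; push_cast
      have hf : (0:ℝ) < k.factorial := by positivity
      rw [div_mul_eq_mul_div, div_le_div_iff₀ (by positivity) hf]
      have hk : (0:ℝ) ≤ k := Nat.cast_nonneg k
      nlinarith [mul_nonneg hk hf.le]

lemma mlc_summable3 {α : ℝ} (hα : 1 < α) (R : ℝ) (hR : 0 ≤ R) :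
    Summable fun k : ℕ => |mlc α k * (k + 3)| * R ^ k := by
  have h := (Real.summable_pow_div_factorial R).mul_left 3
  refine Summable.of_nonneg_of_le (fun k => by positivity) (fun k => ?_) h
  have := mlc_bound hα k
  rw [abs_mul, abs_of_nonneg (by positivity : (0:ℝ) ≤ (k:ℝ) + 3)]
  calc _ ≤ 3 / (k.factorial : ℝ) * R ^ k := by gcongr
    _ = _ := by ring

lemma mlc_summable {α : ℝ} (hα : 1 < α) (R : ℝ) (hR : 0 ≤ R) :
    Summable fun k : ℕ => |mlc α k| * R ^ k := by
  refine Summable.of_nonneg_of_le (fun k => by positivity) (fun k => ?_) (mlc_summable3 hα R hR)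
  rw [abs_mul, abs_of_nonneg (by positivity : (0:ℝ) ≤ (k:ℝ) + 3)]
  have hk : (0:ℝ) ≤ k := Nat.cast_nonneg k
  have : |mlc α k| ≤ |mlc α k| * (k + 3) := le_mul_of_one_le_right (abs_nonneg _) (by linarith)
  gcongr

noncomputable def mle (α x : ℝ) : ℝ := ∑' k, mlc α k * x ^ k

lemma mle_eq (α x : ℝ) : mle α x = mittagLeffler α 2 (-x) := by
  unfold mle mittagLeffler mlc
  refine tsum_congr fun k => ?_
  rw [neg_pow]; ring

lemma mle_cont {α : ℝ} (hα : 1 < α) : Continuous (mle α) := cont_series (mlc_summable hα)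

noncomputable def mle3 (α x : ℝ) : ℝ := ∑' k : ℕ, (mlc α k * (k + 3)) * x ^ k

lemma mle3_cont {α : ℝ} (hα : 1 < α) : Continuous (mle3 α) := cont_series (mlc_summable3 hα)

lemma mle_deriv {α : ℝ} (hα : 1 < α) (x : ℝ) :
    HasDerivAt (fun x => x ^ 3 * mle α x) (x ^ 2 * mle3 α x) x := by
  have h := hasDerivAt_tsum_of_isPreconnected (𝕜 := ℝ)
    (g := fun (k : ℕ) x => mlc α k * x ^ (k + 3))
    (g' := fun (k : ℕ) x => mlc α k * (((k + 3 : ℕ) : ℝ) * x ^ (k + 3 - 1)))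
    (u := fun k : ℕ => (|x| + 1) ^ 2 * (|mlc α k * (k + 3)| * (|x| + 1) ^ k))
    (t := Metric.ball 0 (|x| + 1)) (y₀ := x) (y := x)
    ((mlc_summable3 hα _ (by positivity)).mul_left _) Metric.isOpen_ball
    (convex_ball _ _).isPreconnected
    (fun k y _ => (hasDerivAt_pow (k + 3) y).const_mul _) ?_ (by simp) ?_ (by simp)
  · convert! h using 1
    · funext y; unfold mle; rw [← tsum_mul_left]
      refine tsum_congr fun k => ?_; ring
    · unfold mle3; rw [← tsum_mul_left]
      refine tsum_congr fun k => ?_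
      rw [show k + 3 - 1 = k + 2 by lia]; push_cast; ring
  · intro k y hy
    have hy : |y| ≤ |x| + 1 := by simpa using (mem_ball_zero_iff.1 hy).le
    rw [show k + 3 - 1 = k + 2 by lia, norm_mul, norm_mul, norm_pow, abs_mul]
    simp only [Real.norm_eq_abs]
    push_cast
    calc |mlc α k| * (|(k:ℝ) + 3| * |y| ^ (k + 2))
        ≤ |mlc α k| * (|(k:ℝ) + 3| * (|x| + 1) ^ (k + 2)) := by gcongr
      _ = _ := by ring
  · have h := ((mlc_summable hα |x| (by positivity)).mul_left (|x| ^ 3))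
    refine Summable.of_norm (h.congr fun k => ?_)
    rw [norm_mul, norm_pow]; simp only [Real.norm_eq_abs]; ring

lemma mlc_mul_Gamma {α : ℝ} (hα : 1 < α) (k : ℕ) :
    mlc α k * Real.Gamma (α * k + 2) = (-1) ^ k := by
  unfold mlc
  have : 0 < Real.Gamma (α * k + 2) := Real.Gamma_pos_of_pos (by positivity)
  field_simp

lemma Gamma_four {b : ℝ} (hb : 0 < b) : Real.Gamma (b + 2) = (b + 1) * b * Real.Gamma b := by
  rw [show b + 2 = (b + 1) + 1 by ring, Real.Gamma_add_one (by linarith),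
    Real.Gamma_add_one (by linarith)]; ring

lemma mlc_mul_Gamma4 {α : ℝ} (hα : 1 < α) (k : ℕ) :
    mlc α k * Real.Gamma (α * k + 4) = (α * k + 3) * (α * k + 2) * (-1) ^ k := by
  rw [show α * (k:ℝ) + 4 = (α * k + 2) + 2 by ring, Gamma_four (by positivity),
    ← mlc_mul_Gamma hα k]
  ring

lemma abs_mlc_mul {α : ℝ} (hα : 1 < α) (k : ℕ) (b : ℝ) (hb : 0 < b) :
    |mlc α k| * Real.Gamma (α * k + b) = |mlc α k * Real.Gamma (α * k + b)| := by
  rw [abs_mul, abs_of_pos (Real.Gamma_pos_of_pos (by positivity : 0 < α * k + b))]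

/-- basic powers -/
lemma pow_facts {α s : ℝ} (hs : 0 < s) (w : ℝ) (hw : w = s ^ (α / 2)) :
    0 < w ∧ (1 / s) ^ α = 1 / w ^ 2 ∧ s ^ (3 * (α / 2) - 2) = w ^ 3 / s ^ 2 := by
  refine ⟨by rw [hw]; positivity, ?_, ?_⟩
  · rw [hw, ← Real.rpow_natCast, ← Real.rpow_mul hs.le, one_div, Real.inv_rpow hs.le, one_div]
    congr 2; push_cast; ring
  · rw [Real.rpow_sub hs, hw, ← Real.rpow_natCast, ← Real.rpow_mul hs.le]
    congr 1
    · congr 1; push_cast; ring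
    · exact_mod_cast Real.rpow_natCast s 2

lemma w_gt_one {α s : ℝ} (hα : 1 < α) (hs : 2 ≤ s) : |-((1 / s) ^ α)| < 1 := by
  rw [abs_neg, abs_of_nonneg (by positivity)]
  exact Real.rpow_lt_one (by positivity) (by rw [div_lt_one (by linarith)]; linarith) (by linarith)

lemma lap_u {α s : ℝ} (hα : 1 < α) (hs : 2 ≤ s) :
    IntegrableOn (fun t : ℝ => Real.exp (-(s * t)) * (t * mle α (t ^ α))) (Ioi 0) ∧
    ∫ t in Ioi (0:ℝ), Real.exp (-(s * t)) * (t * mle α (t ^ α))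
      = (1 / s ^ 2) * (1 / (1 + (1 / s) ^ α)) := by
  have hg := mle_cont hα
  have h := series_lap (c := mlc α) (b := 2) hα two_pos hs ?_ ?_
  · have e1 : (1 / s) ^ (2:ℝ) = 1 / s ^ 2 := by
      rw [show (2:ℝ) = ((2:ℕ):ℝ) by norm_num, Real.rpow_natCast, one_div_pow]
    have e2 : ∑' k : ℕ, mlc α k * Real.Gamma (α * k + 2) * ((1 / s) ^ α) ^ k
        = 1 / (1 + (1 / s) ^ α) := by
      have := (hs_quad (w_gt_one hα hs) 0 0 1).tsum_eq
      simp only [zero_mul, zero_add, one_mul, sub_neg_eq_add] at this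
      rw [← this]
      refine tsum_congr fun k => ?_
      rw [mlc_mul_Gamma hα, neg_pow ((1 / s) ^ α)]
    rw [e1, e2] at h
    rw [show (2:ℝ) - 1 = 1 by norm_num] at h
    simpa only [mle, mle3, Real.rpow_one] using h
  · have := (hs_quad (r := 1 / 2) (by rw [abs_of_pos] <;> norm_num) 0 0 1).summable
    refine this.congr fun k => ?_
    rw [abs_mlc_mul hα k 2 two_pos, mlc_mul_Gamma hα]; simp
  · exact (hg.comp (Real.continuous_rpow_const (by linarith : (0:ℝ) ≤ α))).continuousOn

lemma lap_u3 {α s : ℝ} (hα : 1 < α) (hs : 2 ≤ s) :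
    IntegrableOn (fun t : ℝ => Real.exp (-(s * t)) * (t * mle3 α (t ^ α))) (Ioi 0) ∧
    ∫ t in Ioi (0:ℝ), Real.exp (-(s * t)) * (t * mle3 α (t ^ α))
      = (1 / s ^ 2) * ((1 / (1 + (1 / s) ^ α)) ^ 2 + 2 * (1 / (1 + (1 / s) ^ α))) := by
  have hg := mle3_cont hα
  have h := series_lap (c := fun k : ℕ => mlc α k * (k + 3)) (b := 2) hα two_pos hs ?_ ?_
  · have e1 : (1 / s) ^ (2:ℝ) = 1 / s ^ 2 := by
      rw [show (2:ℝ) = ((2:ℕ):ℝ) by norm_num, Real.rpow_natCast, one_div_pow]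
    have e2 : ∑' k : ℕ, mlc α k * (k + 3) * Real.Gamma (α * k + 2) * ((1 / s) ^ α) ^ k
        = (1 / (1 + (1 / s) ^ α)) ^ 2 + 2 * (1 / (1 + (1 / s) ^ α)) := by
      have := (hs_quad (w_gt_one hα hs) 0 1 3).tsum_eq
      simp only [zero_mul, zero_add, one_mul, sub_neg_eq_add] at this
      trans (1 / (1 + (1 / s) ^ α)) ^ 2 - 1 / (1 + (1 / s) ^ α) + 3 * (1 / (1 + (1 / s) ^ α))
      · rw [← this]
        refine tsum_congr fun k => ?_
        rw [mul_right_comm (mlc α k), mlc_mul_Gamma hα, neg_pow ((1 / s) ^ α)]; ring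
      · ring
    rw [e1, e2] at h
    rw [show (2:ℝ) - 1 = 1 by norm_num] at h
    simpa only [mle, mle3, Real.rpow_one] using h
  · have := (hs_quad (r := 1 / 2) (by rw [abs_of_pos] <;> norm_num) 0 1 3).summable
    refine this.congr fun k => ?_
    rw [abs_mul, mul_right_comm |mlc α k|, abs_mlc_mul hα k 2 two_pos, mlc_mul_Gamma hα,
      abs_of_nonneg (by positivity : (0:ℝ) ≤ (k:ℝ) + 3)]; simp
  · exact (hg.comp (Real.continuous_rpow_const (by linarith : (0:ℝ) ≤ α))).continuousOn

lemma lap_u2 {α s : ℝ} (hα : 1 < α) (hs : 2 ≤ s) :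
    IntegrableOn (fun t : ℝ => Real.exp (-(s * t)) * (t ^ 3 * mle α (t ^ α))) (Ioi 0) ∧
    ∫ t in Ioi (0:ℝ), Real.exp (-(s * t)) * (t ^ 3 * mle α (t ^ α))
      = (1 / s ^ 4) * (α ^ 2 * (2 * (1 / (1 + (1 / s) ^ α)) ^ 3 - 3 * (1 / (1 + (1 / s) ^ α)) ^ 2
          + 1 / (1 + (1 / s) ^ α))
        + 5 * α * ((1 / (1 + (1 / s) ^ α)) ^ 2 - 1 / (1 + (1 / s) ^ α))
        + 6 * (1 / (1 + (1 / s) ^ α))) := by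
  have hg := mle_cont hα
  have h := series_lap (c := mlc α) (b := 4) hα four_pos hs ?_ ?_
  · have e1 : (1 / s) ^ (4:ℝ) = 1 / s ^ 4 := by
      rw [show (4:ℝ) = ((4:ℕ):ℝ) by norm_num, Real.rpow_natCast, one_div_pow]
    have := (hs_quad (w_gt_one hα hs) (α ^ 2) (5 * α) 6).tsum_eq
    simp only [sub_neg_eq_add] at this
    rw [← this]
    have e2 : ∑' k : ℕ, mlc α k * Real.Gamma (α * k + 4) * ((1 / s) ^ α) ^ k
        = ∑' k : ℕ, (α ^ 2 * (k:ℝ) ^ 2 + 5 * α * k + 6) * (-(1 / s) ^ α) ^ k := by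
      refine tsum_congr fun k => ?_
      rw [mlc_mul_Gamma4 hα, neg_pow ((1 / s) ^ α)]; ring
    rw [e1, e2] at h
    rw [show (4:ℝ) - 1 = ((3:ℕ):ℝ) by norm_num] at h
    simpa only [mle, Real.rpow_natCast] using h
  · have := (hs_quad (r := 1 / 2) (by rw [abs_of_pos] <;> norm_num) (α ^ 2) (5 * α) 6).summable
    refine this.congr fun k => ?_
    rw [abs_mlc_mul hα k 4 four_pos, mlc_mul_Gamma4 hα, abs_mul,
      abs_of_nonneg (by positivity : (0:ℝ) ≤ (α * k + 3) * (α * k + 2))]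
    simp; ring
  · exact (hg.comp (Real.continuous_rpow_const (by linarith : (0:ℝ) ≤ α))).continuousOn


lemma ml_int_sub_add {f g h : ℝ → ℝ} {μ : Measure ℝ} (hf : Integrable f μ) (hg : Integrable g μ)
    (hh : Integrable h μ) : ∫ x, (f x - g x + h x) ∂μ = ∫ x, f x ∂μ - ∫ x, g x ∂μ + ∫ x, h x ∂μ := by
  have hfg : Integrable (fun x => f x - g x) μ := hf.sub hg
  rw [integral_add hfg hh, integral_sub hf hg]

lemma ml_int_add3 {f g h : ℝ → ℝ} {μ : Measure ℝ} (hf : Integrable f μ) (hg : Integrable g μ)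
    (hh : Integrable h μ) : ∫ x, (f x + g x + h x) ∂μ = ∫ x, f x ∂μ + ∫ x, g x ∂μ + ∫ x, h x ∂μ := by
  have hfg : Integrable (fun x => f x + g x) μ := hf.add hg
  rw [integral_add hfg hh, integral_add hf hg]

lemma rpow_split {s γ : ℝ} (hs : 0 < s) (m n : ℕ) :
    s ^ ((m:ℝ) * γ - n) = (s ^ γ) ^ m / s ^ n := by
  rw [Real.rpow_sub hs, Real.rpow_natCast, mul_comm, Real.rpow_mul hs.le, Real.rpow_natCast]

lemma rpow_split' {s γ : ℝ} (hs : 0 < s) (m n : ℕ) :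
    (1 / s) ^ ((n:ℝ) - m * γ) = (s ^ γ) ^ m / s ^ n := by
  rw [← rpow_split hs, one_div, Real.inv_rpow hs.le, ← Real.rpow_neg hs.le]
  congr 1; ring

lemma CMd.special {γ x : ℝ} (hγ0 : 0 ≤ γ) (hγ : γ ≤ 2 / 3) (hx : 0 ≤ x) (n : ℕ) :
    CMd n (fun s => (3 + x * s ^ γ) * Real.exp (-(x * s ^ γ))) := by
  apply CMd.pred
  apply CMd.pred
  have hexp : ∀ s > 0, HasDerivAt (fun s : ℝ => Real.exp (-(x * s ^ γ)))
      (-(x * γ * s ^ (γ - 1)) * Real.exp (-(x * s ^ γ))) s := by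
    intro s hs
    have h := (((Real.hasDerivAt_rpow_const (p := γ) (Or.inl (ne_of_gt hs))).const_mul x).fun_neg).exp
    exact h.congr_deriv (by ring)
  refine ⟨fun s hs => by positivity,
    fun s => γ * (2 * x * s ^ (γ - 1) + x ^ 2 * s ^ (2 * γ - 1)) * Real.exp (-(x * s ^ γ)),
    fun s hs => ?_, fun s hs => by positivity,
    fun s => (γ * (2 * (1 - γ) * x) * s ^ (γ - 2) + γ * x ^ 2 * s ^ (2 * γ - 2)
      + γ * (γ * x ^ 3) * s ^ (3 * γ - 2)) * Real.exp (-(x * s ^ γ)), fun s hs => ?_, ?_⟩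
  · have h1 := ((Real.hasDerivAt_rpow_const (p := γ) (Or.inl (ne_of_gt hs))).const_mul x).const_add 3
    refine (h1.mul (hexp s hs)).congr_deriv ?_
    have : s ^ (2 * γ - 1) = s ^ γ * s ^ (γ - 1) := by rw [← Real.rpow_add hs]; congr 1; ring
    beta_reduce
    rw [this]; ring
  · have h1 := (Real.hasDerivAt_rpow_const (p := γ - 1) (Or.inl (ne_of_gt hs))).const_mul (2 * x)
    have h2 := (Real.hasDerivAt_rpow_const (p := 2 * γ - 1) (Or.inl (ne_of_gt hs))).const_mul (x ^ 2)
    refine (((h1.add h2).const_mul γ).mul (hexp s hs)).congr_deriv ?_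
    have e1 : s ^ (γ - 1 - 1) = s ^ (γ - 2) := by congr 1; ring
    have e2 : s ^ (2 * γ - 1 - 1) = s ^ (2 * γ - 2) := by congr 1; ring
    have e3 : s ^ (2 * γ - 2) = s ^ (γ - 1) * s ^ (γ - 1) := by
      rw [← Real.rpow_add hs]; congr 1; ring
    have e4 : s ^ (3 * γ - 2) = s ^ (γ - 1) * s ^ (2 * γ - 1) := by
      rw [← Real.rpow_add hs]; congr 1; ring
    simp only [Pi.add_apply]
    rw [e1, e2, e4, e3]; ring
  · refine CMd.mul ?_ (CMd.exp hγ0 (by linarith) hx)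
    refine ((CMd.mul (CMd.const ?_) (CMd.rpow (by linarith))).add
      (CMd.mul (CMd.const ?_) (CMd.rpow (by linarith)))).add
      (CMd.mul (CMd.const ?_) (CMd.rpow (by linarith)))
    · have : 0 ≤ 1 - γ := by linarith
      positivity
    · positivity
    · positivity

lemma bdd_sin (A a : ℝ) : ∀ x, |A - a * Real.sin x| ≤ |A| + |a| := by
  intro x
  refine (abs_sub _ _).trans ?_
  rw [abs_mul]
  have := mul_le_of_le_one_right (abs_nonneg a) (Real.abs_sin_le_one x)
  linarith

lemma bdd_cos (A a : ℝ) : ∀ x, |A - a * Real.cos x| ≤ |A| + |a| := by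
  intro x
  refine (abs_sub _ _).trans ?_
  rw [abs_mul]
  have := mul_le_of_le_one_right (abs_nonneg a) (Real.abs_cos_le_one x)
  linarith

lemma integrable_sin (A a : ℝ) (n : ℕ) {w : ℝ} (hw : 0 < w) :
    IntegrableOn (fun x : ℝ => (A - a * Real.sin x) * (x ^ n * Real.exp (-(x * w)))) (Ioi 0) :=
  integrable_bdd_pow_exp (by fun_prop) _ (bdd_sin A a) n hw

lemma integrable_cos (A a : ℝ) (n : ℕ) {w : ℝ} (hw : 0 < w) :
    IntegrableOn (fun x : ℝ => (A - a * Real.cos x) * (x ^ n * Real.exp (-(x * w)))) (Ioi 0) :=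
  integrable_bdd_pow_exp (by fun_prop) _ (bdd_cos A a) n hw

lemma ml_integral_sin (A a : ℝ) (n : ℕ) {w : ℝ} (hw : 0 < w) :
    ∫ x in Ioi (0:ℝ), (A - a * Real.sin x) * (x ^ n * Real.exp (-(x * w)))
    = A * (n.factorial / w ^ (n + 1))
      - a * ∫ x in Ioi (0:ℝ), Real.sin x * (x ^ n * Real.exp (-(x * w))) := by
  rw [← integral_pow_exp n hw, ← integral_const_mul, ← integral_const_mul, ← integral_sub]
  · congr 1; funext x; ring
  · exact (integrable_pow_exp n hw).const_mul _
  · exact (integrable_bdd_pow_exp Real.continuous_sin 1 Real.abs_sin_le_one n hw).const_mul _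

lemma ml_integral_cos (A a : ℝ) (n : ℕ) {w : ℝ} (hw : 0 < w) :
    ∫ x in Ioi (0:ℝ), (A - a * Real.cos x) * (x ^ n * Real.exp (-(x * w)))
    = A * (n.factorial / w ^ (n + 1))
      - a * ∫ x in Ioi (0:ℝ), Real.cos x * (x ^ n * Real.exp (-(x * w))) := by
  rw [← integral_pow_exp n hw, ← integral_const_mul, ← integral_const_mul, ← integral_sub]
  · congr 1; funext x; ring
  · exact (integrable_pow_exp n hw).const_mul _
  · exact (integrable_bdd_pow_exp Real.continuous_cos 1 Real.abs_cos_le_one n hw).const_mul _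

lemma cont_rpow_Ioi (p : ℝ) : ContinuousOn (fun t : ℝ => t ^ p) (Ioi 0) :=
  ContinuousOn.rpow_const continuousOn_id fun _ ht => Or.inl (ne_of_gt ht)

lemma cont_mle_rpow {α : ℝ} (hα : 1 < α) :
    Continuous (fun t : ℝ => mle α (t ^ α)) :=
  (mle_cont hα).comp (Real.continuous_rpow_const (by linarith))

lemma r_eq {α s : ℝ} (hs : 0 < s) : (1 / s) ^ α = 1 / (s ^ (α / 2)) ^ 2 :=
  (pow_facts hs _ rfl).2.1

/-- upper bound -/
lemma app1 {α : ℝ} (hα1 : 1 < α) (hα2 : α ≤ 4 / 3) : ∀ t > 0,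
    0 ≤ 2 / Real.Gamma (2 - α) * t ^ (2 - α - 1) - t * mle α (t ^ α) := by
  have hG : 0 < Real.Gamma (2 - α) := Real.Gamma_pos_of_pos (by linarith)
  have hI : ∀ s ≥ (2:ℝ), IntegrableOn (fun t => Real.exp (-(s * t)) *
      (2 / Real.Gamma (2 - α) * t ^ (2 - α - 1) - t * mle α (t ^ α))) (Ioi 0) ∧
      ∫ t in Ioi (0:ℝ), Real.exp (-(s * t)) *
      (2 / Real.Gamma (2 - α) * t ^ (2 - α - 1) - t * mle α (t ^ α)) =
      2 / Real.Gamma (2 - α) * ((1 / s) ^ (2 - α) * Real.Gamma (2 - α))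
      - (1 / s ^ 2) * (1 / (1 + (1 / s) ^ α)) := by
    intro s hs
    obtain ⟨i1, j1⟩ := lap_pow (b := 2 - α) (s := s) (by linarith) (by linarith)
    obtain ⟨i2, j2⟩ := lap_u hα1 hs
    rw [← j1, ← j2, ← integral_const_mul, ← integral_sub (i1.const_mul _) i2]
    refine ⟨((i1.const_mul (2 / Real.Gamma (2 - α))).sub i2).congr
      (Eventually.of_forall fun t => ?_), integral_congr_ae (Eventually.of_forall fun t => ?_)⟩
    · simp only [Pi.sub_apply]; ring
    · simp only []; ring
  have hφ : ∀ s > 0, ∀ x : ℝ, (1 + Real.cos x) *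
      (s ^ (3 * (α / 2) - 2) * Real.exp (-(x * s ^ (α / 2))))
      = ((s ^ (α / 2)) ^ 3 / s ^ 2) *
        ((1 - (-1) * Real.cos x) * (x ^ 0 * Real.exp (-(x * s ^ (α / 2))))) := by
    intro s hs x
    rw [(pow_facts hs _ rfl).2.2]; ring
  refine main_pos ?_ (fun s hs => (hI s hs).1)
    (fun x s => (1 + Real.cos x) * (s ^ (3 * (α / 2) - 2) * Real.exp (-(x * s ^ (α / 2)))))
    ?_ ?_ ?_
  · refine ContinuousOn.sub (continuousOn_const.mul (cont_rpow_Ioi _)) ?_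
    exact (continuous_id.mul (cont_mle_rpow hα1)).continuousOn
  · intro x hx n
    refine CMd.mul (CMd.const ?_) (CMd.mul (CMd.rpow (by linarith))
      (CMd.exp (by linarith) (by linarith) hx.le))
    linarith [Real.neg_one_le_cos x]
  · intro s hs
    have hs : 0 < s := by linarith
    simp only [hφ s hs]
    exact (integrable_cos 1 (-1) 0 (by positivity)).const_mul _
  · intro s hs
    have hs0 : 0 < s := by linarith
    have hw : 0 < s ^ (α / 2) := by positivity
    rw [(hI s hs).2]
    simp only [hφ s hs0]
    rw [integral_const_mul, ml_integral_cos _ _ _ hw, int_cos0 hw, r_eq (α := α) hs0]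
    have h2 : (1 / s) ^ (2 - α) = (s ^ (α / 2)) ^ 2 / s ^ 2 := by
      rw [← rpow_split' hs0]; congr 1; push_cast; ring
    rw [h2]
    generalize s ^ (α / 2) = w at *
    simp only [Nat.factorial]
    have : w ^ 2 + 1 ≠ 0 := by positivity
    have : 1 + w ^ 2 ≠ 0 := by positivity
    field_simp
    push_cast
    ring

lemma app3 {α : ℝ} (hα1 : 1 < α) (hα2 : α ≤ 4 / 3) : ∀ t > 0, 0 ≤ t * mle3 α (t ^ α) := by
  have hφ : ∀ s > 0, ∀ x : ℝ, (1 / 2 * (1 - Real.cos x)) *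
      (s ^ (3 * (α / 2) - 2) * ((3 + x * s ^ (α / 2)) * Real.exp (-(x * s ^ (α / 2)))))
      = ((s ^ (α / 2)) ^ 3 / s ^ 2) * (3 / 2) *
        ((1 - 1 * Real.cos x) * (x ^ 0 * Real.exp (-(x * s ^ (α / 2)))))
       + ((s ^ (α / 2)) ^ 3 / s ^ 2) * (s ^ (α / 2) / 2) *
        ((1 - 1 * Real.cos x) * (x ^ 1 * Real.exp (-(x * s ^ (α / 2))))) := by
    intro s hs x
    rw [(pow_facts hs _ rfl).2.2]; ring
  refine main_pos ?_ (fun s hs => (lap_u3 hα1 hs).1)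
    (fun x s => (1 / 2 * (1 - Real.cos x)) *
      (s ^ (3 * (α / 2) - 2) * ((3 + x * s ^ (α / 2)) * Real.exp (-(x * s ^ (α / 2))))))
    ?_ ?_ ?_
  · exact (continuous_id.mul ((mle3_cont hα1).comp
      (Real.continuous_rpow_const (by linarith)))).continuousOn
  · intro x hx n
    refine CMd.mul (CMd.const ?_) (CMd.mul (CMd.rpow (by linarith))
      (CMd.special (by linarith) (by linarith) hx.le n))
    linarith [Real.cos_le_one x]
  · intro s hs
    have hs : 0 < s := by linarith
    simp only [hφ s hs]
    exact ((integrable_cos 1 1 0 (by positivity)).const_mul _).add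
      ((integrable_cos 1 1 1 (by positivity)).const_mul _)
  · intro s hs
    have hs0 : 0 < s := by linarith
    have hw : 0 < s ^ (α / 2) := by positivity
    rw [(lap_u3 hα1 hs).2]
    simp only [hφ s hs0]
    rw [integral_add ((integrable_cos 1 1 0 hw).const_mul _)
      ((integrable_cos 1 1 1 hw).const_mul _), integral_const_mul, integral_const_mul,
      ml_integral_cos _ _ _ hw, ml_integral_cos _ _ _ hw, int_cos0 hw, int_cos1 hw, r_eq (α := α) hs0]
    generalize s ^ (α / 2) = w at *
    simp only [Nat.factorial]
    have : w ^ 2 + 1 ≠ 0 := by positivity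
    have : 1 + w ^ 2 ≠ 0 := by positivity
    field_simp
    push_cast
    ring

lemma app2 {α : ℝ} (hα1 : 1 < α) (hα2 : α ≤ 4 / 3) : ∃ C : ℝ, ∀ t > 0,
    0 ≤ t ^ 3 * mle α (t ^ α) - 1 / Real.Gamma (2 - α) * t ^ (4 - α - 1)
      + C * t ^ (4 - 3 * (α / 2) - 1) := by
  have hG : 0 < Real.Gamma (2 - α) := Real.Gamma_pos_of_pos (by linarith)
  have hG4 : Real.Gamma (4 - α) = (3 - α) * (2 - α) * Real.Gamma (2 - α) := by
    rw [show 4 - α = (2 - α) + 2 by ring, Gamma_four (by linarith)]; ring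
  have hG3 : 0 < Real.Gamma (4 - 3 * (α / 2)) := Real.Gamma_pos_of_pos (by linarith)
  obtain ⟨a0, ha0⟩ : ∃ a0, a0 = (2 * α - 2) * (2 * α - 3) := ⟨_, rfl⟩
  obtain ⟨a1, ha1⟩ : ∃ a1, a1 = -(α / 2) * (2 * (2 * α - 2) - 1 + α / 2) := ⟨_, rfl⟩
  obtain ⟨a2, ha2⟩ : ∃ a2, a2 = (α / 2) ^ 2 := ⟨_, rfl⟩
  obtain ⟨C0, hC0⟩ : ∃ C0, C0 = |a0| + |a1| + 2 * |a2| := ⟨_, rfl⟩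
  refine ⟨C0 / Real.Gamma (4 - 3 * (α / 2)), ?_⟩
  have hI : ∀ s ≥ (2:ℝ), IntegrableOn (fun t => Real.exp (-(s * t)) *
      (t ^ 3 * mle α (t ^ α) - 1 / Real.Gamma (2 - α) * t ^ (4 - α - 1)
      + C0 / Real.Gamma (4 - 3 * (α / 2)) * t ^ (4 - 3 * (α / 2) - 1))) (Ioi 0) ∧
      ∫ t in Ioi (0:ℝ), Real.exp (-(s * t)) *
      (t ^ 3 * mle α (t ^ α) - 1 / Real.Gamma (2 - α) * t ^ (4 - α - 1)
      + C0 / Real.Gamma (4 - 3 * (α / 2)) * t ^ (4 - 3 * (α / 2) - 1)) =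
      (∫ t in Ioi (0:ℝ), Real.exp (-(s * t)) * (t ^ 3 * mle α (t ^ α)))
      - 1 / Real.Gamma (2 - α) * ((1 / s) ^ (4 - α) * Real.Gamma (4 - α))
      + C0 / Real.Gamma (4 - 3 * (α / 2)) *
        ((1 / s) ^ (4 - 3 * (α / 2)) * Real.Gamma (4 - 3 * (α / 2))) := by
    intro s hs
    obtain ⟨i1, j1⟩ := lap_pow (b := 4 - α) (s := s) (by linarith) (by linarith)
    obtain ⟨i3, j3⟩ := lap_pow (b := 4 - 3 * (α / 2)) (s := s) (by linarith) (by linarith)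
    obtain ⟨i2, j2⟩ := lap_u2 hα1 hs
    have k1 := i1.const_mul (1 / Real.Gamma (2 - α))
    have k3 := i3.const_mul (C0 / Real.Gamma (4 - 3 * (α / 2)))
    rw [← j1, ← j3, ← integral_const_mul, ← integral_const_mul, ← ml_int_sub_add i2 k1 k3]
    refine ⟨((i2.sub k1).add k3).congr
      (Eventually.of_forall fun t => ?_), integral_congr_ae (Eventually.of_forall fun t => ?_)⟩
    · simp only [Pi.sub_apply, Pi.add_apply]; ring
    · simp only []; ring
  have hφ : ∀ s > 0, ∀ x : ℝ,
      (|a0| - a0 * Real.sin x) * (s ^ ((4:ℕ) * (α / 2) - (4:ℕ)) * Real.exp (-(x * s ^ (α / 2))))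
      + ((|a1| - a1 * Real.sin x) * x ^ 1) *
        (s ^ ((5:ℕ) * (α / 2) - (4:ℕ)) * Real.exp (-(x * s ^ (α / 2))))
      + ((|a2| - a2 * Real.sin x) * x ^ 2) *
        (s ^ ((6:ℕ) * (α / 2) - (4:ℕ)) * Real.exp (-(x * s ^ (α / 2))))
      = ((s ^ (α / 2)) ^ 4 / s ^ 4) *
        ((|a0| - a0 * Real.sin x) * (x ^ 0 * Real.exp (-(x * s ^ (α / 2)))))
       + ((s ^ (α / 2)) ^ 5 / s ^ 4) *
        ((|a1| - a1 * Real.sin x) * (x ^ 1 * Real.exp (-(x * s ^ (α / 2)))))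
       + ((s ^ (α / 2)) ^ 6 / s ^ 4) *
        ((|a2| - a2 * Real.sin x) * (x ^ 2 * Real.exp (-(x * s ^ (α / 2))))) := by
    intro s hs x
    rw [rpow_split hs, rpow_split hs, rpow_split hs]; ring
  have hnn : ∀ a x : ℝ, 0 ≤ |a| - a * Real.sin x := by
    intro a x
    have h1 := le_abs_self (a * Real.sin x)
    rw [abs_mul] at h1
    have := mul_le_of_le_one_right (abs_nonneg a) (Real.abs_sin_le_one x)
    linarith
  refine main_pos ?_ (fun s hs => (hI s hs).1)
    (fun x s =>
      (|a0| - a0 * Real.sin x) * (s ^ ((4:ℕ) * (α / 2) - (4:ℕ)) * Real.exp (-(x * s ^ (α / 2))))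
      + ((|a1| - a1 * Real.sin x) * x ^ 1) *
        (s ^ ((5:ℕ) * (α / 2) - (4:ℕ)) * Real.exp (-(x * s ^ (α / 2))))
      + ((|a2| - a2 * Real.sin x) * x ^ 2) *
        (s ^ ((6:ℕ) * (α / 2) - (4:ℕ)) * Real.exp (-(x * s ^ (α / 2)))))
    ?_ ?_ ?_
  · refine ContinuousOn.add (ContinuousOn.sub ?_ (continuousOn_const.mul (cont_rpow_Ioi _)))
      (continuousOn_const.mul (cont_rpow_Ioi _))
    exact ((continuous_pow 3).mul (cont_mle_rpow hα1)).continuousOn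
  · intro x hx n
    have hE : CMd n (fun s => Real.exp (-(x * s ^ (α / 2)))) :=
      CMd.exp (by linarith) (by linarith) hx.le
    refine ((CMd.mul (CMd.const (hnn _ _)) (CMd.mul (CMd.rpow ?_) hE)).add
      (CMd.mul (CMd.const (mul_nonneg (hnn _ _) (by positivity))) (CMd.mul (CMd.rpow ?_) hE))).add
      (CMd.mul (CMd.const (mul_nonneg (hnn _ _) (by positivity))) (CMd.mul (CMd.rpow ?_) hE))
    all_goals push_cast; linarith
  · intro s hs
    have hs : 0 < s := by linarith
    simp only [hφ s hs]
    exact (((integrable_sin _ _ 0 (by positivity)).const_mul _).add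
      ((integrable_sin _ _ 1 (by positivity)).const_mul _)).add
      ((integrable_sin _ _ 2 (by positivity)).const_mul _)
  · intro s hs
    have hs0 : 0 < s := by linarith
    have hw : 0 < s ^ (α / 2) := by positivity
    rw [(hI s hs).2, (lap_u2 hα1 hs).2]
    simp only [hφ s hs0]
    have m0 := (integrable_sin |a0| a0 0 hw).const_mul ((s ^ (α / 2)) ^ 4 / s ^ 4)
    have m1 := (integrable_sin |a1| a1 1 hw).const_mul ((s ^ (α / 2)) ^ 5 / s ^ 4)
    have m2 := (integrable_sin |a2| a2 2 hw).const_mul ((s ^ (α / 2)) ^ 6 / s ^ 4)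
    rw [ml_int_add3 m0 m1 m2, integral_const_mul, integral_const_mul,
      integral_const_mul,
      ml_integral_sin _ _ _ hw, ml_integral_sin _ _ _ hw, ml_integral_sin _ _ _ hw, int_sin0 hw,
      int_sin1 hw, int_sin2 hw, r_eq hs0, hG4]
    have h2 : (1 / s) ^ (4 - α) = (s ^ (α / 2)) ^ 2 / s ^ 4 := by
      rw [← rpow_split' hs0]; congr 1; push_cast; ring
    have h3 : (1 / s) ^ (4 - 3 * (α / 2)) = (s ^ (α / 2)) ^ 3 / s ^ 4 := by
      rw [← rpow_split' hs0]; congr 1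
    rw [h2, h3, hC0]
    generalize s ^ (α / 2) = w at *
    have h4 : 1 / Real.Gamma (2 - α) * (w ^ 2 / s ^ 4 * ((3 - α) * (2 - α) * Real.Gamma (2 - α)))
        = w ^ 2 / s ^ 4 * ((3 - α) * (2 - α)) := by field_simp
    have h5 : (|a0| + |a1| + 2 * |a2|) / Real.Gamma (4 - 3 * (α / 2)) *
        (w ^ 3 / s ^ 4 * Real.Gamma (4 - 3 * (α / 2))) = (|a0| + |a1| + 2 * |a2|) * (w ^ 3 / s ^ 4) := by
      generalize Real.Gamma (4 - 3 * (α / 2)) = G at *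
      have := hG3.ne'
      field_simp
    rw [h4, h5]
    generalize |a0| = A0
    generalize |a1| = A1
    generalize |a2| = A2
    rw [ha0, ha1, ha2]
    simp only [Nat.factorial]
    have : w ^ 2 + 1 ≠ 0 := by positivity
    have : 1 + w ^ 2 ≠ 0 := by positivity
    have : 1 / (1 + 1 / w ^ 2) = w ^ 2 / (w ^ 2 + 1) := by field_simp
    rw [this]
    field_simp
    push_cast
    ring

lemma mle_zero (α : ℝ) : mle α 0 = 1 := by
  unfold mle
  rw [tsum_eq_single 0]
  · simp [mlc]
  · intro k hk; simp [hk]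

lemma mle_pos {α : ℝ} (hα1 : 1 < α) (hα2 : α ≤ 4 / 3) : ∀ x ≥ 0, 0 < mle α x := by
  have h3 : ∀ x > 0, 0 ≤ mle3 α x := by
    intro x hx
    have h := app3 hα1 hα2 (x ^ (1 / α)) (by positivity)
    rw [← Real.rpow_mul hx.le, one_div_mul_cancel (by linarith), Real.rpow_one] at h
    exact nonneg_of_mul_nonneg_right h (by positivity)
  have hmono : MonotoneOn (fun x => x ^ 3 * mle α x) (Ici 0) := by
    apply monotoneOn_of_deriv_nonneg (convex_Ici 0)
    · exact ((continuous_pow 3).mul (mle_cont hα1)).continuousOn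
    · exact fun x _ => (mle_deriv hα1 x).differentiableAt.differentiableWithinAt
    · intro x hx
      rw [interior_Ici] at hx
      rw [(mle_deriv hα1 x).deriv]
      exact mul_nonneg (by positivity) (h3 x hx)
  intro x hx
  by_contra! hcon
  have hx0 : 0 < x := by
    rcases hx.lt_or_eq with h | h
    · exact h
    · rw [← h, mle_zero] at hcon; linarith
  have hev : ∀ᶠ y in 𝓝 (0:ℝ), 0 < mle α y :=
    (mle_cont hα1).continuousAt.eventually_const_lt (by rw [mle_zero]; norm_num)
  obtain ⟨ε, hε, hb⟩ := Metric.eventually_nhds_iff.1 hev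
  have hm : 0 < min (ε / 2) x := lt_min (by linarith) hx0
  have h1 := hb (y := min (ε / 2) x) (by
    rw [dist_zero_right, Real.norm_eq_abs, abs_of_pos hm]
    exact (min_le_left _ _).trans_lt (by linarith))
  have h2 := hmono (a := min (ε / 2) x) (b := x) hm.le hx (min_le_right _ _)
  simp only [] at h2
  have : x ^ 3 * mle α x ≤ 0 := mul_nonpos_of_nonneg_of_nonpos (by positivity) hcon
  have : 0 < (min (ε / 2) x) ^ 3 * mle α (min (ε / 2) x) := by positivity
  linarith

lemma mle_upper {α : ℝ} (hα1 : 1 < α) (hα2 : α ≤ 4 / 3) : ∀ x > 0,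
    x * mle α x ≤ 2 / Real.Gamma (2 - α) := by
  intro x hx
  set t := x ^ (1 / α) with ht
  have ht0 : 0 < t := by positivity
  have hta : t ^ α = x := by
    rw [ht, ← Real.rpow_mul hx.le, one_div_mul_cancel (by linarith), Real.rpow_one]
  have h := app1 hα1 hα2 t ht0
  have e : t ^ (2 - α - 1) = t / x := by
    rw [show 2 - α - 1 = 1 - α by ring, Real.rpow_sub ht0, Real.rpow_one, hta]
  rw [e, hta] at h
  have h' : t * (x * mle α x) ≤ t * (2 / Real.Gamma (2 - α)) := by
    have := mul_nonneg hx.le h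
    have e2 : x * (2 / Real.Gamma (2 - α) * (t / x) - t * mle α x)
      = t * (2 / Real.Gamma (2 - α)) - t * (x * mle α x) := by field_simp
    linarith
  exact le_of_mul_le_mul_left h' ht0

lemma mle_lower {α : ℝ} (hα1 : 1 < α) (hα2 : α ≤ 4 / 3) : ∃ C : ℝ, ∀ x > 0,
    1 / Real.Gamma (2 - α) - C * x ^ (-(1 / 2) : ℝ) ≤ x * mle α x := by
  obtain ⟨C, hC⟩ := app2 hα1 hα2
  refine ⟨C, fun x hx => ?_⟩
  set t := x ^ (1 / α) with ht
  have ht0 : 0 < t := by positivity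
  have hta : t ^ α = x := by
    rw [ht, ← Real.rpow_mul hx.le, one_div_mul_cancel (by linarith), Real.rpow_one]
  have h := hC t ht0
  have ht3 : t ^ (3:ℝ) = t ^ 3 := by exact_mod_cast Real.rpow_natCast t 3
  have e : t ^ (4 - α - 1) = t ^ 3 / x := by
    rw [show 4 - α - 1 = 3 - α by ring, Real.rpow_sub ht0, ht3, hta]
  have e2 : t ^ (4 - 3 * (α / 2) - 1) = t ^ 3 / x * x ^ (-(1 / 2) : ℝ) := by
    rw [show 4 - 3 * (α / 2) - 1 = (3 - α) + α * (-(1 / 2)) by ring, Real.rpow_add ht0,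
      Real.rpow_sub ht0, ht3, Real.rpow_mul ht0.le, hta]
  rw [e, e2, hta] at h
  have hp : 0 < t ^ 3 / x := by positivity
  refine le_of_mul_le_mul_left (a := t ^ 3 / x) ?_ hp
  have e3 : t ^ 3 / x * (x * mle α x) = t ^ 3 * mle α x := by field_simp
  rw [e3]
  linarith

lemma mle_main {α : ℝ} (hα1 : 1 < α) (hα2 : α ≤ 4 / 3) : ∃ C : ℝ, 0 < C ∧ ∀ x > 0,
    C⁻¹ / (1 + x) ≤ mle α x ∧ mle α x ≤ C / (1 + x) := by
  have hG : 0 < Real.Gamma (2 - α) := Real.Gamma_pos_of_pos (by linarith)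
  obtain ⟨C, hC⟩ := mle_lower hα1 hα2
  have hlim : Tendsto (fun x : ℝ => 1 / Real.Gamma (2 - α) - C * x ^ (-(1 / 2) : ℝ)) atTop
      (𝓝 (1 / Real.Gamma (2 - α) - C * 0)) :=
    ((tendsto_rpow_neg_atTop (by norm_num)).const_mul C).const_sub _
  have hev := hlim.eventually_const_lt (u := 1 / Real.Gamma (2 - α) / 2) (by
    rw [mul_zero, sub_zero]; exact half_lt_self (by positivity))
  obtain ⟨X, hX⟩ := eventually_atTop.1 hev
  set Y := max X 1 with hY
  have hY1 : 1 ≤ Y := le_max_right _ _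
  have hcomp : IsCompact (Icc 0 Y) := isCompact_Icc
  have hne : (Icc 0 Y).Nonempty := ⟨0, by constructor <;> linarith⟩
  obtain ⟨m, hm, hmin⟩ := hcomp.exists_isMinOn hne (mle_cont hα1).continuousOn
  obtain ⟨M, hM, hmax⟩ := hcomp.exists_isMaxOn hne (mle_cont hα1).continuousOn
  have hmpos := mle_pos hα1 hα2 m hm.1
  have hMpos := mle_pos hα1 hα2 M hM.1
  set g := 1 / Real.Gamma (2 - α) with hg
  have hg0 : 0 < g := by positivity
  -- lower constant
  set c := min (mle α m) (g / 2) with hc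
  have hc0 : 0 < c := lt_min hmpos (by linarith)
  set D := mle α M * (1 + Y) + 4 * g with hD
  have hD0 : 0 < D := by positivity
  have key : ∀ x > 0, c ≤ mle α x * (1 + x) ∧ mle α x * (1 + x) ≤ D := by
    intro x hx
    have hp := mle_pos hα1 hα2 x hx.le
    have hu := mle_upper hα1 hα2 x hx
    have e : 2 / Real.Gamma (2 - α) = 2 * g := by rw [hg]; ring
    rw [e] at hu
    rcases le_total x Y with hxY | hxY
    · have h1 : mle α m ≤ mle α x := hmin ⟨hx.le, hxY⟩
      have h2 : mle α x ≤ mle α M := hmax ⟨hx.le, hxY⟩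
      constructor
      · have : c ≤ mle α m := min_le_left _ _
        nlinarith
      · have : mle α x * (1 + x) ≤ mle α M * (1 + Y) := by gcongr
        linarith
    · have h1 := hX x ((le_max_left _ _).trans hxY)
      have h2 := hC x hx
      constructor
      · have : c ≤ g / 2 := min_le_right _ _
        nlinarith
      · have h3 : mle α x ≤ x * mle α x := le_mul_of_one_le_left hp.le (by linarith)
        have : 0 < mle α M * (1 + Y) := by positivity
        nlinarith
  refine ⟨max c⁻¹ D, lt_max_of_lt_right hD0, fun x hx => ?_⟩
  obtain ⟨k1, k2⟩ := key x hx
  have h1x : 0 < 1 + x := by linarith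
  constructor
  · rw [div_le_iff₀ h1x]
    refine le_trans ?_ k1
    exact inv_le_of_inv_le₀ hc0 (le_max_left _ _)
  · rw [le_div_iff₀ h1x]
    exact k2.trans (le_max_right _ _)

/-- for `1 < α ≤ 4/3` there is `C > 0` depending only on `α` with
`C⁻¹/(1 + λ T^α) ≤ E_{α,2}(−λ T^α) ≤ C/(1 + λ T^α)` for all `λ > 0`, `T > 0`. -/
theorem mittagLeffler_two_sided_bound (α : ℝ) (hα1 : 1 < α) (hα2 : α ≤ 4 / 3) :
    ∃ C : ℝ, 0 < C ∧ ∀ lam T : ℝ, 0 < lam → 0 < T →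
      C⁻¹ / (1 + lam * T ^ α) ≤ mittagLeffler α 2 (-(lam * T ^ α)) ∧
      mittagLeffler α 2 (-(lam * T ^ α)) ≤ C / (1 + lam * T ^ α) := by
  obtain ⟨C, hC, h⟩ := mle_main hα1 hα2
  refine ⟨C, hC, fun lam T hl hT => ?_⟩
  rw [← mle_eq]
  exact h _ (by positivity)
end

section
/- Let 1 < α < 2 and T > 0, and let λ : ℕ → ℝ be a nondecreasing sequence of positive numbers with λ_n → ∞ such that E_{α,2}(−λ_n T^α) ≠ 0 for every n. Then there exists a constant C_T > 0 (depending on α, T and the sequence λ) such that for every n, |E_{α,2}(−λ_n T^α)| ≥ C_T / (1 + λ_n T^α). -/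
open MeasureTheory Set Filter Topology

noncomputable def mlGam (p : ℝ) (z : ℂ) : ℂ := Complex.exp (Complex.exp z + p * z)

noncomputable def mlJ (θ a : ℝ) (g : ℂ → ℂ) : ℂ :=
  (∫ s in Ioi a, g ((s:ℂ) + (θ:ℝ) * Complex.I)) - (∫ s in Ioi a, g ((s:ℂ) + ((-θ : ℝ) : ℂ) * Complex.I))
    + Complex.I * ∫ y in (-θ)..θ, g ((a:ℂ) + y * Complex.I)

lemma mlGam_norm (p s τ : ℝ) : ‖mlGam p ((s:ℂ) + τ * Complex.I)‖
    = Real.exp (Real.exp s * Real.cos τ + p * s) := by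
  unfold mlGam
  rw [Complex.norm_exp]
  congr 1
  simp [Complex.exp_re]

lemma mlGam_diff (p : ℝ) : Differentiable ℂ (mlGam p) := by
  unfold mlGam; fun_prop

lemma mlGam_cont (p : ℝ) : Continuous (mlGam p) := (mlGam_diff p).continuous

lemma mlGam_line_cont (p τ : ℝ) : Continuous (fun s : ℝ => mlGam p ((s:ℂ) + τ * Complex.I)) :=
  (mlGam_cont p).comp (by fun_prop)

lemma mlGam_integrable (p τ : ℝ) (hp : 0 < p) (hτ : Real.cos τ < 0) :
    Integrable (fun s : ℝ => mlGam p ((s:ℂ) + τ * Complex.I)) := by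
  have h := integrableOn_rpow_mul_exp_neg_mul_rpow (p := 1) (s := p - 1) (b := - Real.cos τ)
    (by linarith) one_pos (by linarith)
  have himg : Real.exp '' univ = Ioi 0 := by rw [image_univ, Real.range_exp]
  rw [← himg, integrableOn_image_iff_integrableOn_abs_deriv_smul MeasurableSet.univ
    (fun x _ => (Real.hasDerivAt_exp x).hasDerivWithinAt) Real.exp_injective.injOn] at h
  rw [integrableOn_univ] at h
  refine Integrable.mono' h (mlGam_line_cont p τ).aestronglyMeasurable (Eventually.of_forall fun s => ?_)
  rw [mlGam_norm, abs_of_pos (Real.exp_pos s), smul_eq_mul, ← Real.exp_mul, ← Real.exp_add,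
    ← Real.exp_add, Real.rpow_one]
  apply le_of_eq
  congr 1
  ring

lemma mlGam_integrableOn (p τ a : ℝ) (hτ : Real.cos τ < 0) :
    IntegrableOn (fun s : ℝ => mlGam p ((s:ℂ) + τ * Complex.I)) (Ioi a) := by
  have h := ((mlGam_integrable (max p 1) τ (by positivity) hτ).norm.integrableOn (s := Ioi a)).const_mul
    (Real.exp ((p - max p 1) * a))
  refine Integrable.mono' h (mlGam_line_cont p τ).aestronglyMeasurable ?_
  rw [ae_restrict_iff' measurableSet_Ioi]
  refine Eventually.of_forall fun s hs => ?_
  rw [mlGam_norm, mlGam_norm, ← Real.exp_add]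
  apply Real.exp_le_exp.2
  have h1 : p ≤ max p 1 := le_max_left _ _
  have h2 : a < s := hs
  nlinarith

lemma ml_rotate (p τ σ c : ℝ) (hp : 0 < p) (hc : c < 0) (h : ∀ y ∈ uIcc τ σ, Real.cos y ≤ c) :
    ∫ s : ℝ, mlGam p ((s:ℂ) + τ * Complex.I) = ∫ s : ℝ, mlGam p ((s:ℂ) + σ * Complex.I) := by
  have hB1 : Tendsto (fun s : ℝ => Real.exp (Real.exp s * c + p * s)) atBot (𝓝 0) := by
    apply squeeze_zero (g := fun s => Real.exp (p * s)) (fun _ => (Real.exp_pos _).le)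
    · intro s
      apply Real.exp_le_exp.2
      nlinarith [Real.exp_pos s]
    · exact Real.tendsto_exp_atBot.comp (tendsto_id.const_mul_atBot hp)
  have hB2 : Tendsto (fun s : ℝ => Real.exp (Real.exp s * c + p * s)) atTop (𝓝 0) := by
    have := (tendsto_rpow_mul_exp_neg_mul_atTop_nhds_zero p (-c) (by linarith)).comp Real.tendsto_exp_atTop
    refine this.congr fun s => ?_
    simp only [Function.comp]
    rw [← Real.exp_mul, ← Real.exp_add]
    congr 1
    ring
  have edge : ∀ s : ℝ, ‖Complex.I * ∫ y in τ..σ, mlGam p ((s:ℂ) + y * Complex.I)‖ ≤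
      Real.exp (Real.exp s * c + p * s) * |σ - τ| := by
    intro s
    rw [norm_mul, Complex.norm_I, one_mul]
    apply intervalIntegral.norm_integral_le_of_norm_le_const
    intro y hy
    rw [mlGam_norm]
    apply Real.exp_le_exp.2
    have := h y (uIoc_subset_uIcc hy)
    nlinarith [Real.exp_pos s]
  have e1 := squeeze_zero_norm edge (by simpa using hB1.mul_const |σ - τ|)
  have e2 := squeeze_zero_norm edge (by simpa using hB2.mul_const |σ - τ|)
  have i1 := mlGam_integrable p τ hp ((h τ left_mem_uIcc).trans_lt hc)
  have i2 := mlGam_integrable p σ hp ((h σ right_mem_uIcc).trans_lt hc)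
  have t1 := intervalIntegral_tendsto_integral i1 tendsto_neg_atTop_atBot tendsto_id
  have t2 := intervalIntegral_tendsto_integral i2 tendsto_neg_atTop_atBot tendsto_id
  have t := ((t1.sub t2).add e2).sub (e1.comp tendsto_neg_atTop_atBot)
  have z : ∀ R : ℝ, _ := fun R => Complex.integral_boundary_rect_eq_zero_of_differentiableOn (mlGam p) ⟨-R, τ⟩ ⟨R, σ⟩
    (mlGam_diff p).differentiableOn
  have t' := tendsto_nhds_unique (tendsto_const_nhds.congr fun R => (z R).symm) t
  rw [add_zero, sub_zero] at t'
  exact (sub_eq_zero.1 t'.symm)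

lemma ml_neg_axis (p ε : ℝ) (hp : 0 < p) (hε : ε = 1 ∨ ε = -1) :
    ∫ s : ℝ, mlGam p ((s:ℂ) + (ε * Real.pi : ℝ) * Complex.I)
      = Real.Gamma p * Complex.exp (p * (ε * Real.pi) * Complex.I) := by
  have h := Real.Gamma_eq_integral hp
  have himg : Real.exp '' univ = Ioi 0 := by rw [image_univ, Real.range_exp]
  rw [← himg, integral_image_eq_integral_abs_deriv_smul MeasurableSet.univ
    (fun x _ => (Real.hasDerivAt_exp x).hasDerivWithinAt) Real.exp_injective.injOn, setIntegral_univ] at h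
  have hpi : Complex.exp ((ε * Real.pi : ℝ) * Complex.I) = -1 := by
    rcases hε with rfl | rfl
    · simp
    · simp [Complex.exp_neg]
  have e1 : ∀ s : ℝ, mlGam p ((s:ℂ) + (ε * Real.pi : ℝ) * Complex.I) =
     ((|Real.exp s| • (Real.exp (-Real.exp s) * Real.exp s ^ (p - 1)) : ℝ) : ℂ) *
       Complex.exp (p * (ε * Real.pi) * Complex.I) := by
    intro s
    rw [abs_of_pos (Real.exp_pos s), smul_eq_mul, ← Real.exp_mul, ← Real.exp_add, ← Real.exp_add,
      Complex.ofReal_exp, ← Complex.exp_add]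
    unfold mlGam
    rw [Complex.exp_add (s:ℂ), hpi]
    congr 1
    push_cast
    ring
  simp_rw [e1]
  rw [integral_mul_const, h]
  congr 1
  exact integral_ofReal

lemma ml_cos_le (θ y : ℝ) (h1 : 0 < θ) (h2 : θ ≤ |y|) (h3 : |y| ≤ Real.pi) : Real.cos y ≤ Real.cos θ := by
  rw [← Real.cos_abs y]
  exact Real.cos_le_cos_of_nonneg_of_le_pi h1.le h3 h2

lemma mlGam_lines (p θ : ℝ) (hp : 0 < p) (h0 : 0 < θ) (hpi : θ ≤ Real.pi) (hθ : Real.cos θ < 0) :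
    (∫ s : ℝ, mlGam p ((s:ℂ) + (θ:ℝ) * Complex.I))
      - (∫ s : ℝ, mlGam p ((s:ℂ) + ((-θ : ℝ) : ℂ) * Complex.I))
     = 2 * Real.pi * Complex.I * ((Real.Gamma (1 - p))⁻¹ : ℝ) := by
  rw [ml_rotate p θ (1 * Real.pi) (Real.cos θ) hp hθ, ml_rotate p (-θ) (-1 * Real.pi) (Real.cos θ) hp hθ,
    ml_neg_axis p 1 hp (Or.inl rfl), ml_neg_axis p (-1) hp (Or.inr rfl)]
  · have hs : (Real.Gamma (1 - p))⁻¹ = Real.Gamma p * Real.sin (Real.pi * p) / Real.pi := by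
      have h := Real.Gamma_mul_Gamma_one_sub p
      have hg := (Real.Gamma_pos_of_pos hp).ne'
      have : Real.Gamma (1 - p) = Real.pi / Real.sin (Real.pi * p) / Real.Gamma p := by
        rw [← h]; field_simp
      rw [this]
      rw [inv_div, div_div_eq_mul_div]
    rw [hs]
    push_cast
    have : Complex.sin (Real.pi * p) = (Complex.exp (-(Real.pi * p) * Complex.I) - Complex.exp ((Real.pi * p) * Complex.I)) * Complex.I / 2 := rfl
    rw [this]
    have hpi' : (Real.pi : ℂ) ≠ 0 := by exact_mod_cast Real.pi_ne_zero
    field_simp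
    rw [Complex.I_sq]
    ring_nf
  · intro y hy
    rw [uIcc_of_ge (by linarith)] at hy
    have : y < 0 := by linarith [hy.2]
    apply ml_cos_le θ y h0 <;> rw [abs_of_neg this] <;> linarith [hy.1, hy.2]
  · intro y hy
    rw [uIcc_of_le (by linarith)] at hy
    have : 0 < y := by linarith [hy.1]
    apply ml_cos_le θ y h0 <;> rw [abs_of_pos this] <;> linarith [hy.1, hy.2]

lemma mlJ_shift (θ a b : ℝ) (hθ : 0 < θ) (hab : a ≤ b) (g : ℂ → ℂ)
    (hd : ∀ z : ℂ, |z.im| ≤ θ → DifferentiableAt ℂ g z)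
    (h1 : IntegrableOn (fun s : ℝ => g ((s:ℂ) + (θ:ℝ) * Complex.I)) (Ioi a))
    (h2 : IntegrableOn (fun s : ℝ => g ((s:ℂ) + ((-θ : ℝ) : ℂ) * Complex.I)) (Ioi a)) :
    mlJ θ a g = mlJ θ b g := by
  have h := Complex.integral_boundary_rect_eq_zero_of_differentiableOn g ⟨a, -θ⟩ ⟨b, θ⟩ (by
    intro z hz
    refine (hd z ?_).differentiableWithinAt
    have := hz.2
    simp only [mem_preimage] at this
    rw [uIcc_of_le (by linarith)] at this
    exact abs_le.2 this)
  simp only [smul_eq_mul] at h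
  unfold mlJ
  rw [← intervalIntegral.integral_Ioi_sub_Ioi h1 hab, ← intervalIntegral.integral_Ioi_sub_Ioi h2 hab] at h
  linear_combination -h

lemma mlJ_full (θ a : ℝ) (hθ : 0 < θ) (g : ℂ → ℂ)
    (hd : ∀ z : ℂ, |z.im| ≤ θ → DifferentiableAt ℂ g z)
    (h1 : Integrable (fun s : ℝ => g ((s:ℂ) + (θ:ℝ) * Complex.I)))
    (h2 : Integrable (fun s : ℝ => g ((s:ℂ) + ((-θ : ℝ) : ℂ) * Complex.I)))
    (B : ℝ → ℝ) (hB : Tendsto B atBot (𝓝 0))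
    (hgB : ∀ s y : ℝ, |y| ≤ θ → ‖g ((s:ℂ) + y * Complex.I)‖ ≤ B s) :
    mlJ θ a g = (∫ s : ℝ, g ((s:ℂ) + (θ:ℝ) * Complex.I))
      - ∫ s : ℝ, g ((s:ℂ) + ((-θ : ℝ) : ℂ) * Complex.I) := by
  have t1 := (aecover_Ioi (μ := volume) (tendsto_id (α := ℝ) (x := atBot))).integral_tendsto_of_countably_generated h1
  have t2 := (aecover_Ioi (μ := volume) (tendsto_id (α := ℝ) (x := atBot))).integral_tendsto_of_countably_generated h2
  have t3 : Tendsto (fun s : ℝ => Complex.I * ∫ y in (-θ)..θ, g ((s:ℂ) + y * Complex.I)) atBot (𝓝 0) := by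
    apply squeeze_zero_norm (a := fun s => B s * |θ - -θ|)
    · intro s
      rw [norm_mul, Complex.norm_I, one_mul]
      apply intervalIntegral.norm_integral_le_of_norm_le_const
      intro y hy
      rw [uIoc_of_le (by linarith)] at hy
      exact hgB s y (abs_le.2 ⟨hy.1.le, hy.2⟩)
    · simpa using hB.mul_const _
  have t : Tendsto (fun s => mlJ θ s g) atBot (𝓝 _) := (t1.sub t2).add t3
  rw [add_zero] at t
  refine tendsto_nhds_unique (Tendsto.congr' ?_ tendsto_const_nhds) t
  filter_upwards [Iic_mem_atBot a] with s hs
  exact (mlJ_shift θ s a hθ hs g hd h1.integrableOn h2.integrableOn).symm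

lemma mlGam_J_pos (p θ a : ℝ) (hp : 0 < p) (h0 : 0 < θ) (hpi : θ ≤ Real.pi) (hθ : Real.cos θ < 0) :
    mlJ θ a (mlGam p) = 2 * Real.pi * Complex.I * ((Real.Gamma (1 - p))⁻¹ : ℝ) := by
  rw [← mlGam_lines p θ hp h0 hpi hθ]
  apply mlJ_full θ a h0 _ (fun z _ => mlGam_diff p z) (mlGam_integrable p θ hp hθ)
    (mlGam_integrable p (-θ) hp (by simpa using hθ)) (fun s => Real.exp (Real.exp s + p * s))
  · have h1 : Tendsto (fun s : ℝ => Real.exp s + p * s) atBot atBot :=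
      Real.tendsto_exp_atBot.add_atBot (tendsto_id.const_mul_atBot hp)
    exact Real.tendsto_exp_atBot.comp h1
  · intro s y _
    rw [mlGam_norm]
    apply Real.exp_le_exp.2
    nlinarith [Real.exp_pos s, Real.cos_le_one y]

lemma mlGam_line_contAt (τ : ℝ) (hτ : Real.cos τ < 0) :
    ContinuousAt (fun p : ℝ => ∫ s in Ioi (0:ℝ), mlGam p ((s:ℂ) + τ * Complex.I)) 0 := by
  apply continuousAt_of_dominated (bound := fun s : ℝ => ‖mlGam 1 ((s:ℂ) + τ * Complex.I)‖)
  · exact Eventually.of_forall fun p => (mlGam_line_cont p τ).aestronglyMeasurable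
  · filter_upwards [Iio_mem_nhds (zero_lt_one)] with p hp
    rw [ae_restrict_iff' measurableSet_Ioi]
    refine Eventually.of_forall fun s hs => ?_
    rw [mlGam_norm, mlGam_norm]
    apply Real.exp_le_exp.2
    have h1 : p < 1 := hp
    have h2 : 0 < s := hs
    nlinarith
  · exact (mlGam_integrableOn 1 τ 0 hτ).norm
  · refine Eventually.of_forall fun s => ?_
    unfold mlGam
    fun_prop

lemma mlGam_J_contAt (θ : ℝ) (hθ : Real.cos θ < 0) :
    ContinuousAt (fun p : ℝ => mlJ θ 0 (mlGam p)) 0 := by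
  unfold mlJ
  refine ((mlGam_line_contAt θ hθ).sub (mlGam_line_contAt (-θ) (by simpa using hθ))).add ?_
  refine continuousAt_const.mul (Continuous.continuousAt ?_)
  apply intervalIntegral.continuous_parametric_intervalIntegral_of_continuous'
  unfold mlGam Function.uncurry
  fun_prop

lemma mlGam_J_zero (θ : ℝ) (h0 : 0 < θ) (hpi : θ ≤ Real.pi) (hθ : Real.cos θ < 0) :
    mlJ θ 0 (mlGam 0) = 2 * Real.pi * Complex.I * ((Real.Gamma (1 - 0))⁻¹ : ℝ) := by
  have t1 : Tendsto (fun p : ℝ => mlJ θ 0 (mlGam p)) (𝓝[>] 0) (𝓝 (mlJ θ 0 (mlGam 0))) :=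
    (mlGam_J_contAt θ hθ).tendsto.mono_left nhdsWithin_le_nhds
  have c : ContinuousAt (fun p : ℝ => 2 * Real.pi * Complex.I * ((Real.Gamma (1 - p))⁻¹ : ℝ)) 0 := by
    have : ContinuousAt Real.Gamma (1 - 0) := by
      apply DifferentiableAt.continuousAt (𝕜 := ℝ)
      apply Real.differentiableAt_Gamma
      intro m
      have : (0:ℝ) ≤ m := m.cast_nonneg
      linarith
    have h2 : ContinuousAt (fun p : ℝ => Real.Gamma (1 - p)) 0 :=
      ContinuousAt.comp (f := fun p : ℝ => 1 - p) this (by fun_prop)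
    have h3 := h2.inv₀ (by simp)
    exact continuousAt_const.mul (Complex.continuous_ofReal.continuousAt.comp h3)
  have t2 := c.tendsto.mono_left (nhdsWithin_le_nhds (s := Ioi 0))
  refine tendsto_nhds_unique t1 (t2.congr' ?_)
  filter_upwards [self_mem_nhdsWithin] with p hp
  exact (mlGam_J_pos p θ 0 hp h0 hpi hθ).symm

lemma mlGam_hasDerivAt (p : ℝ) (z : ℂ) : HasDerivAt (mlGam p) (mlGam (p+1) z + p * mlGam p z) z := by
  unfold mlGam
  have h := ((Complex.hasDerivAt_exp z).add ((hasDerivAt_id z).const_mul (p:ℂ))).cexp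
  refine h.congr_deriv ?_
  change Complex.exp (Complex.exp z + (p:ℂ) * z) * (Complex.exp z + ↑p * 1) = _
  push_cast
  rw [add_mul, one_mul, show Complex.exp z + ((p:ℂ) * z + z) = (Complex.exp z + p * z) + z by ring,
    Complex.exp_add (Complex.exp z + p * z) z]
  ring

lemma mlGam_line_deriv (p τ a : ℝ) (hτ : Real.cos τ < 0) :
    (∫ s in Ioi a, mlGam (p+1) ((s:ℂ) + τ * Complex.I)) + p * (∫ s in Ioi a, mlGam p ((s:ℂ) + τ * Complex.I))
      = - mlGam p ((a:ℂ) + τ * Complex.I) := by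
  have i1 := mlGam_integrableOn (p+1) τ a hτ
  have i2 := mlGam_integrableOn p τ a hτ
  have hd : ∀ s : ℝ, HasDerivAt (fun s : ℝ => mlGam p ((s:ℂ) + τ * Complex.I))
      (mlGam (p+1) ((s:ℂ) + τ * Complex.I) + p * mlGam p ((s:ℂ) + τ * Complex.I)) s := by
    intro s
    have h1 : HasDerivAt (fun s : ℝ => (s:ℂ) + τ * Complex.I) 1 s :=
      (Complex.ofRealCLM.hasDerivAt (x := s)).add_const _
    have := HasDerivAt.comp s (mlGam_hasDerivAt p ((s:ℂ) + τ * Complex.I)) h1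
    rw [mul_one] at this
    exact this
  have i3 := i1.add (i2.const_mul (p:ℂ))
  have t := tendsto_zero_of_hasDerivAt_of_integrableOn_Ioi (a := a) (fun s _ => hd s) i3 i2
  have h := integral_Ioi_of_hasDerivAt_of_tendsto (a := a) (hd a).continuousAt.continuousWithinAt
    (fun s _ => hd s) i3 t
  rw [integral_add i1 (i2.const_mul (p:ℂ)), integral_const_mul, zero_sub] at h
  exact h

lemma mlGam_J_rec (p θ a : ℝ) (hθ : Real.cos θ < 0) :
    mlJ θ a (mlGam (p+1)) + p * mlJ θ a (mlGam p) = 0 := by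
  have e1 := mlGam_line_deriv p θ a hθ
  have e2 := mlGam_line_deriv p (-θ) a (by simpa using hθ)
  have hc : ∀ q : ℝ, Continuous (fun y : ℝ => mlGam q ((a:ℂ) + y * Complex.I)) := fun q =>
    (mlGam_cont q).comp (by fun_prop)
  have e3 : Complex.I * (∫ y in (-θ)..θ, mlGam (p+1) ((a:ℂ) + y * Complex.I)) +
      p * (Complex.I * ∫ y in (-θ)..θ, mlGam p ((a:ℂ) + y * Complex.I)) =
      mlGam p ((a:ℂ) + θ * Complex.I) - mlGam p ((a:ℂ) + ((-θ:ℝ):ℂ) * Complex.I) := by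
    rw [← intervalIntegral.integral_eq_sub_of_hasDerivAt (a := -θ) (b := θ)
      (f := fun y : ℝ => mlGam p ((a:ℂ) + y * Complex.I))
      (f' := fun y : ℝ => Complex.I * mlGam (p+1) ((a:ℂ) + y * Complex.I) + p * (Complex.I * mlGam p ((a:ℂ) + y * Complex.I)))]
    · rw [intervalIntegral.integral_add, intervalIntegral.integral_const_mul,
        intervalIntegral.integral_const_mul, intervalIntegral.integral_const_mul]
      · exact (continuous_const.mul (hc _)).intervalIntegrable _ _
      · exact (continuous_const.mul (continuous_const.mul (hc _))).intervalIntegrable _ _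
    · intro y _
      have h1 : HasDerivAt (fun y : ℝ => (a:ℂ) + y * Complex.I) (1 * Complex.I) y :=
        ((Complex.ofRealCLM.hasDerivAt (x := y)).mul_const _).const_add _
      have := HasDerivAt.comp y (mlGam_hasDerivAt p ((a:ℂ) + y * Complex.I)) h1
      rw [show (mlGam (p + 1) (↑a + ↑y * Complex.I) + ↑p * mlGam p (↑a + ↑y * Complex.I)) * (1 * Complex.I) =
        Complex.I * mlGam (p+1) ((a:ℂ) + y * Complex.I) + p * (Complex.I * mlGam p ((a:ℂ) + y * Complex.I)) by ring] at this
      exact this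
    · exact ((continuous_const.mul (hc _)).add (continuous_const.mul (continuous_const.mul (hc _)))).intervalIntegrable _ _
  unfold mlJ
  linear_combination e1 - e2 + e3

lemma mlGam_J_zero_all (θ : ℝ) (h0 : 0 < θ) (hpi : θ ≤ Real.pi) (hθ : Real.cos θ < 0) (n : ℕ) :
    ∀ p : ℝ, -(n:ℝ) ≤ p → mlJ θ 0 (mlGam p) = 2 * Real.pi * Complex.I * ((Real.Gamma (1 - p))⁻¹ : ℝ) := by
  induction n with
  | zero =>
    intro p hp
    simp only [Nat.cast_zero, neg_zero] at hp
    rcases hp.eq_or_lt with rfl | hp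
    · exact mlGam_J_zero θ h0 hpi hθ
    · exact mlGam_J_pos p θ 0 hp h0 hpi hθ
  | succ n ih =>
    intro p hp
    push_cast at hp
    rcases le_or_gt (-(n:ℝ)) p with h | h
    · exact ih p h
    · have hn : (0:ℝ) ≤ n := n.cast_nonneg
      have hr := mlGam_J_rec p θ 0 hθ
      rw [ih (p+1) (by linarith)] at hr
      have hp0 : p < 0 := by linarith
      have hg : Real.Gamma (1 - p) = -p * Real.Gamma (-p) := by
        rw [← Real.Gamma_add_one (by linarith : -p ≠ 0)]
        congr 1; ring
      have hg0 := (Real.Gamma_pos_of_pos (by linarith : 0 < -p)).ne'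
      rw [show 1 - (p+1) = -p by ring] at hr
      rw [hg]
      have hp' : (p:ℂ) ≠ 0 := by exact_mod_cast hp0.ne
      apply mul_left_cancel₀ hp'
      rw [eq_neg_of_add_eq_zero_right hr]
      push_cast
      have : (Real.Gamma (-p) : ℂ) ≠ 0 := by exact_mod_cast hg0
      field_simp

lemma mlGam_J (p θ a : ℝ) (h0 : 0 < θ) (hpi : θ ≤ Real.pi) (hθ : Real.cos θ < 0) :
    mlJ θ a (mlGam p) = 2 * Real.pi * Complex.I * ((Real.Gamma (1 - p))⁻¹ : ℝ) := by
  obtain ⟨n, hn⟩ := exists_nat_ge (-p)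
  rw [← mlGam_J_zero_all θ h0 hpi hθ n p (by linarith)]
  have hθ' : Real.cos (-θ) < 0 := by simpa using hθ
  rcases le_total a 0 with h | h
  · exact mlJ_shift θ a 0 h0 h _ (fun z _ => mlGam_diff p z) (mlGam_integrableOn p θ a hθ)
      (mlGam_integrableOn p (-θ) a hθ')
  · exact (mlJ_shift θ 0 a h0 h _ (fun z _ => mlGam_diff p z) (mlGam_integrableOn p θ 0 hθ)
      (mlGam_integrableOn p (-θ) 0 hθ')).symm

noncomputable def mlG (α x : ℝ) (z : ℂ) : ℂ := mlGam (α - 1) z / (Complex.exp (α * z) + x)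

lemma ml_den_lower (α θ x : ℝ) (hα : 0 < α) (hθ : 0 < θ) (h1 : α * θ < Real.pi) (hx : 0 < x) (z : ℂ)
    (hz : |z.im| ≤ θ) : Real.sin (α * θ) * x ≤ ‖Complex.exp (α * z) + x‖ := by
  have hs : 0 < Real.sin (α * θ) := Real.sin_pos_of_pos_of_lt_pi (by positivity) h1
  have hc : Real.cos (α * θ) ≤ Real.cos (α * z.im) := by
    rw [← Real.cos_abs (α * z.im), abs_mul, abs_of_pos hα]
    exact Real.cos_le_cos_of_nonneg_of_le_pi (by positivity) h1.le (by gcongr)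
  refine abs_le_of_sq_le_sq' ?_ (norm_nonneg _) |>.2
  · rw [Complex.sq_norm, Complex.normSq_apply]
    simp only [Complex.add_re, Complex.add_im, Complex.exp_re, Complex.exp_im, Complex.ofReal_re,
      Complex.ofReal_im, Complex.re_ofReal_mul, Complex.im_ofReal_mul]
    set R := Real.exp (α * z.re)
    have hR : 0 < R := Real.exp_pos _
    have t1 := Real.sin_sq_add_cos_sq (α * z.im)
    have t2 := Real.sin_sq_add_cos_sq (α * θ)
    have t3 : (R * Real.cos (α * z.im) + x) * (R * Real.cos (α * z.im) + x) +
      (R * Real.sin (α * z.im) + 0) * (R * Real.sin (α * z.im) + 0) = R^2 + 2 * (R * x) * Real.cos (α * z.im) + x^2 := by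
      linear_combination R^2 * t1
    have t4 : (Real.sin (α * θ) * x)^2 = x^2 - x^2 * Real.cos (α * θ)^2 := by
      linear_combination x^2 * t2
    rw [t3, t4]
    have : R * x * Real.cos (α * θ) ≤ R * x * Real.cos (α * z.im) := by gcongr
    nlinarith [sq_nonneg (R + x * Real.cos (α * θ))]

lemma ml_den_ne (α θ x : ℝ) (hα : 1 < α) (hθ : 0 < θ) (h1 : α * θ < Real.pi) (hx : 0 < x)
    (z : ℂ) (hz : |z.im| ≤ θ) : Complex.exp (α * z) + x ≠ 0 := by
  have hs : 0 < Real.sin (α * θ) := Real.sin_pos_of_pos_of_lt_pi (by positivity) h1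
  have := ml_den_lower α θ x (by linarith) hθ h1 hx z hz
  intro h
  rw [h, norm_zero] at this
  have : 0 < Real.sin (α * θ) * x := by positivity
  linarith

lemma mlG_diff (α θ x : ℝ) (hα : 1 < α) (hθ : 0 < θ) (h1 : α * θ < Real.pi) (hx : 0 < x)
    (z : ℂ) (hz : |z.im| ≤ θ) : DifferentiableAt ℂ (mlG α x) z := by
  unfold mlG
  exact (mlGam_diff _ z).div (by fun_prop) (ml_den_ne α θ x hα hθ h1 hx z hz)

lemma mlG_norm (α θ x : ℝ) (hα : 1 < α) (hθ : 0 < θ) (h1 : α * θ < Real.pi) (hx : 0 < x)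
    (z : ℂ) (hz : |z.im| ≤ θ) : ‖mlG α x z‖ ≤ ‖mlGam (α - 1) z‖ / (Real.sin (α * θ) * x) := by
  have hs : 0 < Real.sin (α * θ) := Real.sin_pos_of_pos_of_lt_pi (by positivity) h1
  unfold mlG
  rw [norm_div]
  gcongr
  exact ml_den_lower α θ x (by linarith) hθ h1 hx z hz

lemma mlG_line_cont (α θ x : ℝ) (hα : 1 < α) (hθ : 0 < θ) (h1 : α * θ < Real.pi) (hx : 0 < x)
    (τ : ℝ) (hτ : |τ| ≤ θ) : Continuous (fun s : ℝ => mlG α x ((s:ℂ) + τ * Complex.I)) := by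
  rw [continuous_iff_continuousAt]
  intro s
  have := (mlG_diff α θ x hα hθ h1 hx ((s:ℂ) + τ * Complex.I) (by simpa using hτ)).continuousAt
  exact ContinuousAt.comp (f := fun s : ℝ => (s:ℂ) + τ * Complex.I) this (by fun_prop)

lemma mlG_integrable (α θ x : ℝ) (hα : 1 < α) (hθ : 0 < θ) (h1 : α * θ < Real.pi) (hx : 0 < x)
    (τ : ℝ) (hτ : |τ| ≤ θ) (hc : Real.cos τ < 0) :
    Integrable (fun s : ℝ => mlG α x ((s:ℂ) + τ * Complex.I)) := by
  refine Integrable.mono' ((mlGam_integrable (α - 1) τ (by linarith) hc).norm.div_const (Real.sin (α * θ) * x))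
    (mlG_line_cont α θ x hα hθ h1 hx τ hτ).aestronglyMeasurable (Eventually.of_forall fun s => ?_)
  exact mlG_norm α θ x hα hθ h1 hx _ (by simpa using hτ)

lemma mlG_J (α θ x : ℝ) (hα : 1 < α) (hθ : 0 < θ) (h1 : α * θ < Real.pi) (hx : 0 < x)
    (hc : Real.cos θ < 0) (a : ℝ) :
    mlJ θ a (mlG α x) = (∫ s : ℝ, mlG α x ((s:ℂ) + (θ:ℝ) * Complex.I))
      - ∫ s : ℝ, mlG α x ((s:ℂ) + ((-θ : ℝ) : ℂ) * Complex.I) := by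
  have hs : 0 < Real.sin (α * θ) := Real.sin_pos_of_pos_of_lt_pi (by positivity) h1
  apply mlJ_full θ a hθ _ (mlG_diff α θ x hα hθ h1 hx)
    (mlG_integrable α θ x hα hθ h1 hx θ (by rw [abs_of_pos hθ]) hc)
    (mlG_integrable α θ x hα hθ h1 hx (-θ) (by rw [abs_neg, abs_of_pos hθ]) (by simpa using hc))
    (fun s => Real.exp (Real.exp s + (α - 1) * s) / (Real.sin (α * θ) * x))
  · have h1 : Tendsto (fun s : ℝ => Real.exp s + (α - 1) * s) atBot atBot :=
      Real.tendsto_exp_atBot.add_atBot (tendsto_id.const_mul_atBot (by linarith))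
    simpa using (Real.tendsto_exp_atBot.comp h1).div_const (Real.sin (α * θ) * x)
  · intro s y hy
    refine (mlG_norm α θ x hα hθ h1 hx _ (by simpa using hy)).trans ?_
    rw [mlGam_norm]
    gcongr
    nlinarith [Real.exp_pos s, Real.cos_le_one y]

lemma mlG_term (α x : ℝ) (k : ℕ) (z : ℂ) : (-x:ℂ)^k * mlGam (-1 - α * k) z =
    mlGam (-1) z * (-x * Complex.exp (-(α * z)))^k := by
  unfold mlGam
  rw [mul_pow, ← Complex.exp_nat_mul, mul_left_comm, ← Complex.exp_add]
  congr 2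
  push_cast
  ring

lemma mlG_ratio (α x s y : ℝ) (hx : 0 < x) :
    ‖(-x * Complex.exp (-(α * ((s:ℂ) + y * Complex.I))) : ℂ)‖ = x * Real.exp (-(α * s)) := by
  rw [norm_mul, Complex.norm_exp, norm_neg, Complex.norm_real, Real.norm_of_nonneg hx.le]
  simp

lemma mlG_hasSum (α x : ℝ) (hx : 0 < x) (s y : ℝ) (hs : x * Real.exp (-(α * s)) < 1) :
    HasSum (fun k : ℕ => (-x:ℂ)^k * mlGam (-1 - α * k) ((s:ℂ) + y * Complex.I))
      (mlG α x ((s:ℂ) + y * Complex.I)) := by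
  simp_rw [mlG_term]
  have h := (hasSum_geometric_of_norm_lt_one (by rw [mlG_ratio α x s y hx]; exact hs)).mul_left
    (mlGam (-1) ((s:ℂ) + y * Complex.I))
  refine (congrArg (HasSum _) ?_).mpr h
  generalize (s:ℂ) + y * Complex.I = z
  have e : Complex.exp (α * z) ≠ 0 := Complex.exp_ne_zero _
  unfold mlG
  have e2 : mlGam (α - 1) z = mlGam (-1) z * Complex.exp (α * z) := by
    unfold mlGam
    rw [← Complex.exp_add]
    congr 1
    push_cast
    ring
  rw [e2, Complex.exp_neg, ← div_eq_mul_inv, mul_div_assoc]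
  congr 1
  rw [← one_div, ← one_div, show (1:ℂ) - -x * (1 / Complex.exp (α * z)) = (Complex.exp (α * z) + x) / Complex.exp (α * z) by
    field_simp; ring, one_div_div]

lemma mlG_term_norm (α x : ℝ) (hα : 0 < α) (hx : 0 < x) (a s y : ℝ) (has : a ≤ s) (k : ℕ) :
    ‖(-x:ℂ)^k * mlGam (-1 - α * k) ((s:ℂ) + y * Complex.I)‖ ≤
      (x * Real.exp (-(α * a)))^k * ‖mlGam (-1) ((s:ℂ) + y * Complex.I)‖ := by
  rw [mlG_term, norm_mul, norm_pow, mlG_ratio α x s y hx, mul_comm]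
  gcongr

lemma mlG_line_hasSum (α x : ℝ) (hα : 0 < α) (hx : 0 < x) (a : ℝ) (ha : x * Real.exp (-(α * a)) < 1)
    (τ : ℝ) (hc : Real.cos τ < 0) :
    HasSum (fun k : ℕ => (-x:ℂ)^k * ∫ s in Ioi a, mlGam (-1 - α * k) ((s:ℂ) + τ * Complex.I))
      (∫ s in Ioi a, mlG α x ((s:ℂ) + τ * Complex.I)) := by
  simp_rw [← integral_const_mul]
  have hg := summable_geometric_of_lt_one (by positivity) ha
  apply hasSum_integral_of_dominated_convergence
    (fun k (s : ℝ) => (x * Real.exp (-(α * a)))^k * ‖mlGam (-1) ((s:ℂ) + τ * Complex.I)‖)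
  · intro k
    exact (continuous_const.mul (mlGam_line_cont _ τ)).aestronglyMeasurable
  · intro k
    rw [ae_restrict_iff' measurableSet_Ioi]
    exact Eventually.of_forall fun s hs => mlG_term_norm α x hα hx a s τ (le_of_lt hs) k
  · exact Eventually.of_forall fun s => hg.mul_right _
  · simp_rw [tsum_mul_right]
    exact ((mlGam_integrableOn (-1) τ a hc).norm).const_mul _
  · rw [ae_restrict_iff' measurableSet_Ioi]
    refine Eventually.of_forall fun s hs => mlG_hasSum α x hx s τ (lt_of_le_of_lt ?_ ha)
    have : a < s := hs
    gcongr

lemma mlG_edge_hasSum (α x : ℝ) (hα : 0 < α) (hx : 0 < x) (a : ℝ) (ha : x * Real.exp (-(α * a)) < 1)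
    (θ : ℝ) :
    HasSum (fun k : ℕ => (-x:ℂ)^k * ∫ y in (-θ)..θ, mlGam (-1 - α * k) ((a:ℂ) + y * Complex.I))
      (∫ y in (-θ)..θ, mlG α x ((a:ℂ) + y * Complex.I)) := by
  simp_rw [← intervalIntegral.integral_const_mul]
  have hg := summable_geometric_of_lt_one (by positivity) ha
  have hcont : ∀ q : ℝ, Continuous (fun y : ℝ => mlGam q ((a:ℂ) + y * Complex.I)) := fun q =>
    (mlGam_cont q).comp (by fun_prop)
  apply intervalIntegral.hasSum_integral_of_dominated_convergence
    (fun k y => (x * Real.exp (-(α * a)))^k * ‖mlGam (-1) ((a:ℂ) + y * Complex.I)‖)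
  · intro k
    exact (continuous_const.mul (hcont _)).aestronglyMeasurable
  · intro k
    exact Eventually.of_forall fun y _ => mlG_term_norm α x hα hx a a y le_rfl k
  · exact Eventually.of_forall fun s _ => hg.mul_right _
  · simp_rw [tsum_mul_right]
    exact (continuous_const.mul (hcont _).norm).intervalIntegrable _ _
  · exact Eventually.of_forall fun y _ => mlG_hasSum α x hx a y ha

lemma mlG_J_eq (α θ x : ℝ) (hα : 1 < α) (hθ : 0 < θ) (h1 : α * θ < Real.pi) (hx : 0 < x)
    (hc : Real.cos θ < 0) :
    (∫ s : ℝ, mlG α x ((s:ℂ) + (θ:ℝ) * Complex.I))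
      - (∫ s : ℝ, mlG α x ((s:ℂ) + ((-θ : ℝ) : ℂ) * Complex.I)) =
      2 * Real.pi * Complex.I * (mittagLeffler α 2 (-x) : ℝ) := by
  have hα0 : 0 < α := by linarith
  obtain ⟨a, ha⟩ : ∃ a : ℝ, x * Real.exp (-(α * a)) < 1 := by
    have : Tendsto (fun a : ℝ => x * Real.exp (-(α * a))) atTop (𝓝 (x * 0)) :=
      (Real.tendsto_exp_neg_atTop_nhds_zero.comp (tendsto_id.const_mul_atTop hα0)).const_mul x
    rw [mul_zero] at this
    exact (this.eventually (gt_mem_nhds one_pos)).exists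
  rw [← mlG_J α θ x hα hθ h1 hx hc a]
  have hpi : θ ≤ Real.pi := by nlinarith
  have H := ((mlG_line_hasSum α x hα0 hx a ha θ hc).sub
    (mlG_line_hasSum α x hα0 hx a ha (-θ) (by simpa using hc))).add
    ((mlG_edge_hasSum α x hα0 hx a ha θ).mul_left Complex.I)
  have e : ∀ k : ℕ, (-x:ℂ)^k * (∫ s in Ioi a, mlGam (-1 - α * k) ((s:ℂ) + θ * Complex.I)) -
     (-x:ℂ)^k * (∫ s in Ioi a, mlGam (-1 - α * k) ((s:ℂ) + ((-θ:ℝ):ℂ) * Complex.I)) +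
     Complex.I * ((-x:ℂ)^k * ∫ y in (-θ)..θ, mlGam (-1 - α * k) ((a:ℂ) + y * Complex.I)) =
     2 * Real.pi * Complex.I * (((-x)^k / Real.Gamma (α * k + 2) : ℝ) : ℂ) := by
    intro k
    have := mlGam_J (-1 - α * k) θ a hθ hpi hc
    rw [show 1 - (-1 - α * k) = α * k + 2 by ring] at this
    unfold mlJ at this
    push_cast at this ⊢
    rw [div_eq_mul_inv]
    linear_combination (-x:ℂ)^k * this
  simp_rw [e] at H
  have H' : mlJ θ a (mlG α x) = _ := H.tsum_eq.symm
  rw [H', tsum_mul_left, mittagLeffler, Complex.ofReal_tsum]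

lemma ml_line_lim (α θ : ℝ) (hα : 1 < α) (hθ : 0 < θ) (h1 : α * θ < Real.pi)
    (τ : ℝ) (hτ : |τ| ≤ θ) (hc : Real.cos τ < 0) :
    Tendsto (fun x : ℝ => (x:ℂ) * ∫ s : ℝ, mlG α x ((s:ℂ) + τ * Complex.I)) atTop
      (𝓝 (∫ s : ℝ, mlGam (α - 1) ((s:ℂ) + τ * Complex.I))) := by
  have hs : 0 < Real.sin (α * θ) := Real.sin_pos_of_pos_of_lt_pi (by positivity) h1
  simp_rw [← integral_const_mul]
  apply tendsto_integral_filter_of_dominated_convergence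
    (fun s : ℝ => ‖mlGam (α - 1) ((s:ℂ) + τ * Complex.I)‖ / Real.sin (α * θ))
  · filter_upwards [Ioi_mem_atTop 0] with x hx
    exact (continuous_const.mul (mlG_line_cont α θ x hα hθ h1 hx τ hτ)).aestronglyMeasurable
  · filter_upwards [Ioi_mem_atTop 0] with x hx
    refine Eventually.of_forall fun s => ?_
    have hx' : 0 < x := hx
    rw [norm_mul, Complex.norm_real, Real.norm_of_nonneg hx'.le]
    have := mlG_norm α θ x hα hθ h1 hx ((s:ℂ) + τ * Complex.I) (by simpa using hτ)
    calc _ ≤ x * (‖mlGam (α - 1) ((s:ℂ) + τ * Complex.I)‖ / (Real.sin (α * θ) * x)) := by gcongr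
      _ = _ := by field_simp
  · exact (mlGam_integrable (α - 1) τ (by linarith) hc).norm.div_const _
  · refine Eventually.of_forall fun s => ?_
    generalize (s:ℂ) + τ * Complex.I = z
    have hinv : Tendsto (fun x : ℝ => ((x⁻¹ : ℝ) : ℂ)) atTop (𝓝 ((0:ℝ):ℂ)) :=
      (Complex.continuous_ofReal.tendsto 0).comp tendsto_inv_atTop_zero
    have : Tendsto (fun x : ℝ => mlGam (α - 1) z / (Complex.exp (α * z) * ((x⁻¹ : ℝ) : ℂ) + 1)) atTop
        (𝓝 (mlGam (α - 1) z / (Complex.exp (α * z) * ((0:ℝ):ℂ) + 1))) :=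
      tendsto_const_nhds.div ((hinv.const_mul _).add_const _) (by simp)
    simp only [Complex.ofReal_zero, mul_zero, zero_add, div_one] at this
    refine this.congr' ?_
    filter_upwards [Ioi_mem_atTop 0] with x hx
    have hx' : (x:ℂ) ≠ 0 := by exact_mod_cast (ne_of_gt hx)
    unfold mlG
    rw [mul_div_assoc', mul_comm (x:ℂ), ← mul_div_mul_right _ _ hx']
    congr 1
    push_cast
    field_simp

lemma ml_lim (α : ℝ) (hα1 : 1 < α) (hα2 : α < 2) :
    Tendsto (fun x : ℝ => x * mittagLeffler α 2 (-x)) atTop (𝓝 (Real.Gamma (2 - α))⁻¹) := by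
  have hpi := Real.pi_pos
  obtain ⟨θ, ht1, ht2⟩ : ∃ θ, Real.pi / 2 < θ ∧ θ < Real.pi / α := by
    apply exists_between
    gcongr
  have hθ : 0 < θ := by linarith [Real.pi_pos]
  have h1 : α * θ < Real.pi := by
    rw [lt_div_iff₀ (by linarith)] at ht2
    linarith
  have hθpi : θ ≤ Real.pi := by nlinarith
  have hc : Real.cos θ < 0 := Real.cos_neg_of_pi_div_two_lt_of_lt ht1 (by linarith)
  have L := (ml_line_lim α θ hα1 hθ h1 θ (by rw [abs_of_pos hθ]) hc).sub
    (ml_line_lim α θ hα1 hθ h1 (-θ) (by rw [abs_neg, abs_of_pos hθ]) (by simpa using hc))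
  rw [mlGam_lines (α - 1) θ (by linarith) hθ hθpi hc, show 1 - (α - 1) = 2 - α by ring] at L
  have hne : (2 * Real.pi * Complex.I : ℂ) ≠ 0 := Complex.two_pi_I_ne_zero
  have L2 := L.const_mul (2 * Real.pi * Complex.I : ℂ)⁻¹
  rw [inv_mul_cancel_left₀ hne] at L2
  have L3 := (Complex.continuous_re.tendsto _).comp L2
  rw [Complex.ofReal_re] at L3
  refine L3.congr' ?_
  filter_upwards [Ioi_mem_atTop 0] with x hx
  simp only [Function.comp]
  rw [← mul_sub, mlG_J_eq α θ x hα1 hθ h1 hx hc, mul_left_comm, inv_mul_cancel_left₀ hne,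
    ← Complex.ofReal_mul, Complex.ofReal_re]

/-- for `1 < α < 2`, `T > 0` and a nondecreasing sequence `λ_n > 0`
tending to `∞` with `E_{α,2}(−λ_n T^α) ≠ 0` for all `n`, there is `C_T > 0` with
`|E_{α,2}(−λ_n T^α)| ≥ C_T / (1 + λ_n T^α)` for every `n`. -/
theorem mittagLeffler_lower_bound_seq (α T : ℝ) (hα1 : 1 < α) (hα2 : α < 2) (hT : 0 < T)
    (lam : ℕ → ℝ) (hmono : Monotone lam) (hpos : ∀ n, 0 < lam n)
    (htend : Filter.Tendsto lam Filter.atTop Filter.atTop)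
    (hne : ∀ n, mittagLeffler α 2 (-(lam n * T ^ α)) ≠ 0) :
    ∃ C : ℝ, 0 < C ∧ ∀ n : ℕ,
      C / (1 + lam n * T ^ α) ≤ |mittagLeffler α 2 (-(lam n * T ^ α))| := by
  have hTα : 0 < T ^ α := Real.rpow_pos_of_pos hT α
  have hL : 0 < (Real.Gamma (2 - α))⁻¹ := inv_pos.2 (Real.Gamma_pos_of_pos (by linarith))
  set L := (Real.Gamma (2 - α))⁻¹ with hLdef
  have t := (ml_lim α hα1 hα2).comp (htend.atTop_mul_const hTα)
  have ev := t.eventually (lt_mem_nhds (half_lt_self hL))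
  obtain ⟨N, hN⟩ := eventually_atTop.1 ev
  let f : ℕ → ℝ := fun n => (1 + lam n * T ^ α) * |mittagLeffler α 2 (-(lam n * T ^ α))|
  have hx : ∀ n, 0 < lam n * T ^ α := fun n => mul_pos (hpos n) hTα
  have hf : ∀ n, 0 < f n := fun n => mul_pos (by linarith [hx n]) (abs_pos.2 (hne n))
  obtain ⟨m, -, hm⟩ := Finset.exists_min_image (Finset.range (N+1)) f ⟨0, by simp⟩
  refine ⟨min (L/2) (f m), lt_min (by linarith) (hf m), fun n => ?_⟩
  rw [div_le_iff₀ (by linarith [hx n]), mul_comm]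
  change _ ≤ f n
  rcases le_total N n with h | h
  · refine (min_le_left _ _).trans ?_
    have h1 := hN n h
    simp only [Function.comp] at h1
    have h2 : lam n * T ^ α * mittagLeffler α 2 (-(lam n * T ^ α)) ≤
      lam n * T ^ α * |mittagLeffler α 2 (-(lam n * T ^ α))| := by
      have := hx n
      gcongr
      exact le_abs_self _
    have h3 := abs_nonneg (mittagLeffler α 2 (-(lam n * T ^ α)))
    simp only [f]
    linarith
  · exact (min_le_right _ _).trans (hm n (by simp; omega))
end
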